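/- arXiv:0812.1968 — 3 statements merged into one kernel-verified Lean document; each statement's English description precedes it below -/
import Mathlib

section
/- Let G be a countable group admitting a two-sided Følner sequence, (X, B, μ) a standard probability space, and T, S commuting measure-preserving actions of G on X. Let A ∈ B. Then for all ε > 0, the set R_ε := {(g, h) ∈ G × G : μ((A ∩ T_g⁻¹A) ∩ S_h⁻¹(A ∩ T_g⁻¹A)) > μ(A)⁴ − ε} is both left syndetic and right syndetic in G × G. -/
open MeasureTheory Filter

/-- `Φ` is a left Følner sequence in `Γ`: a sequence of nonempty finite subsets with
`|Φₙ ∩ γΦₙ|/|Φₙ| → 1` for every `γ`. -/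
def IsLeftFolner {Γ : Type*} [Group Γ] [DecidableEq Γ] (Φ : ℕ → Finset Γ) : Prop :=
  (∀ n, (Φ n).Nonempty) ∧
    ∀ γ : Γ, Filter.Tendsto
      (fun n => ((Φ n ∩ (Φ n).image (γ * ·)).card : ℝ) / ((Φ n).card : ℝ))
      Filter.atTop (nhds 1)

/-- `Φ` is a two-sided Følner sequence: a left Følner sequence with additionally
`|Φₙ ∩ Φₙγ|/|Φₙ| → 1` for every `γ`. -/
def IsTwoSidedFolner {Γ : Type*} [Group Γ] [DecidableEq Γ] (Φ : ℕ → Finset Γ) : Prop :=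
  IsLeftFolner Φ ∧
    ∀ γ : Γ, Filter.Tendsto
      (fun n => ((Φ n ∩ (Φ n).image (· * γ)).card : ℝ) / ((Φ n).card : ℝ))
      Filter.atTop (nhds 1)

/-- `S` is left syndetic in `Γ`: finitely many left translates of `S` cover `Γ`. -/
def LeftSyndetic {Γ : Type*} [Group Γ] (S : Set Γ) : Prop :=
  ∃ F : Finset Γ, ∀ x : Γ, ∃ g ∈ F, g⁻¹ * x ∈ S

/-- `S` is right syndetic in `Γ`: finitely many right translates of `S` cover `Γ`. -/
def RightSyndetic {Γ : Type*} [Group Γ] (S : Set Γ) : Prop :=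
  ∃ F : Finset Γ, ∀ x : Γ, ∃ g ∈ F, x * g⁻¹ ∈ S

/-- The average of `φ` over the finite set `s`. -/
noncomputable def favg {ι E : Type*} [AddCommGroup E] [Module ℝ E] (s : Finset ι) (φ : ι → E) : E :=
  (s.card : ℝ)⁻¹ • ∑ i ∈ s, φ i

section Favg

variable {ι E F : Type*}

theorem map_favg [AddCommGroup E] [Module ℝ E] [AddCommGroup F] [Module ℝ F]
    (L : E →ₗ[ℝ] F) (s : Finset ι) (φ : ι → E) :
    L (favg s φ) = favg s (fun i => L (φ i)) := by
  simp [favg]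

theorem favg_sub [AddCommGroup E] [Module ℝ E] (s : Finset ι) (φ ψ : ι → E) :
    favg s (fun i => φ i - ψ i) = favg s φ - favg s ψ := by
  simp [favg, smul_sub]

theorem favg_const [AddCommGroup E] [Module ℝ E] {s : Finset ι} (hs : s.Nonempty) (x : E) :
    favg s (fun _ => x) = x := by
  have : (s.card : ℝ) ≠ 0 := by exact_mod_cast hs.card_pos.ne'
  rw [favg, Finset.sum_const, ← Nat.cast_smul_eq_nsmul ℝ, smul_smul, inv_mul_cancel₀ this, one_smul]

theorem norm_favg_le [SeminormedAddCommGroup E] [NormedSpace ℝ E] {s : Finset ι} {φ : ι → E}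
    {C : ℝ} (hC : 0 ≤ C) (h : ∀ i ∈ s, ‖φ i‖ ≤ C) : ‖favg s φ‖ ≤ C := by
  rw [favg, norm_smul, norm_inv, Real.norm_natCast]
  rcases s.eq_empty_or_nonempty with rfl | hs
  · simpa using hC
  have : (0 : ℝ) < s.card := by exact_mod_cast hs.card_pos
  rw [inv_mul_le_iff₀ this]
  simpa using norm_sum_le_of_le s h

theorem norm_favg_comp_sub_le [SeminormedAddCommGroup E] [NormedSpace ℝ E] [DecidableEq ι]
    {s : Finset ι} (hs : s.Nonempty) {σ : ι → ι} (hσ : Function.Injective σ) {φ : ι → E} {C : ℝ}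
    (h : ∀ i, ‖φ i‖ ≤ C) :
    ‖favg s (fun i => φ (σ i)) - favg s φ‖ ≤
      2 * C * (1 - ((s ∩ s.image σ).card : ℝ) / (s.card : ℝ)) := by
  have hpos : (0 : ℝ) < s.card := by exact_mod_cast hs.card_pos
  have hsum : ∑ i ∈ s, φ (σ i) = ∑ i ∈ s.image σ, φ i :=
    (Finset.sum_image fun a _ b _ hab => hσ hab).symm
  have hcard : (s.image σ).card = s.card := Finset.card_image_of_injective s hσ
  have key : ∑ i ∈ s.image σ, φ i - ∑ i ∈ s, φ i =
      ∑ i ∈ s.image σ \ s, φ i - ∑ i ∈ s \ s.image σ, φ i :=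
    (Finset.sum_sdiff_sub_sum_sdiff ..).symm
  have c1 : ((s \ s.image σ).card : ℝ) = s.card - (s ∩ s.image σ).card := by
    rw [eq_sub_iff_add_eq]; exact_mod_cast Finset.card_sdiff_add_card_inter s (s.image σ)
  have c2 : ((s.image σ \ s).card : ℝ) = s.card - (s ∩ s.image σ).card := by
    rw [eq_sub_iff_add_eq, Finset.inter_comm]
    exact_mod_cast (Finset.card_sdiff_add_card_inter (s.image σ) s).trans hcard
  have n1 : ‖∑ i ∈ s.image σ \ s, φ i‖ ≤ (s.image σ \ s).card * C := by
    simpa using norm_sum_le_of_le (s.image σ \ s) (fun i _ => h i)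
  have n2 : ‖∑ i ∈ s \ s.image σ, φ i‖ ≤ (s \ s.image σ).card * C := by
    simpa using norm_sum_le_of_le (s \ s.image σ) (fun i _ => h i)
  rw [favg, favg, hsum, ← smul_sub, key, norm_smul, norm_inv, Real.norm_natCast,
    inv_mul_le_iff₀ hpos]
  refine (norm_sub_le _ _).trans ((add_le_add n1 n2).trans (le_of_eq ?_))
  rw [c1, c2]
  field_simp
  ring

end Favg

section Folner

variable {Γ : Type*} [Group Γ] [DecidableEq Γ] {E : Type*} [SeminormedAddCommGroup E]
  [NormedSpace ℝ E]

theorem IsLeftFolner.tendsto_norm_favg_sub {Φ : ℕ → Finset Γ} (hΦ : IsLeftFolner Φ)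
    (γ : Γ) {φ : ℕ → Γ → E} {C : ℝ} (h : ∀ n i, ‖φ n i‖ ≤ C) :
    Tendsto (fun n => ‖favg (Φ n) (fun i => φ n (γ * i)) - favg (Φ n) (φ n)‖) atTop (nhds 0) := by
  refine squeeze_zero (fun _ => norm_nonneg _)
    (fun n => norm_favg_comp_sub_le (hΦ.1 n) (mul_right_injective γ) (h n)) ?_
  simpa using ((tendsto_const_nhds (x := (1 : ℝ))).sub (hΦ.2 γ)).const_mul (2 * C)

theorem IsTwoSidedFolner.tendsto_norm_favg_sub {Φ : ℕ → Finset Γ} (hΦ : IsTwoSidedFolner Φ)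
    (γ : Γ) {φ : ℕ → Γ → E} {C : ℝ} (h : ∀ n i, ‖φ n i‖ ≤ C) :
    Tendsto (fun n => ‖favg (Φ n) (fun i => φ n (i * γ)) - favg (Φ n) (φ n)‖) atTop (nhds 0) := by
  refine squeeze_zero (fun _ => norm_nonneg _)
    (fun n => norm_favg_comp_sub_le (hΦ.1.1 n) (mul_left_injective γ) (h n)) ?_
  simpa using ((tendsto_const_nhds (x := (1 : ℝ))).sub (hΦ.2 γ)).const_mul (2 * C)

theorem IsLeftFolner.prod {Γ' : Type*} [Group Γ'] [DecidableEq Γ'] {Φ : ℕ → Finset Γ}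
    {Ψ : ℕ → Finset Γ'} (hΦ : IsLeftFolner Φ) (hΨ : IsLeftFolner Ψ) :
    IsLeftFolner (fun n => Φ n ×ˢ Ψ n) := by
  refine ⟨fun n => (hΦ.1 n).product (hΨ.1 n), fun γ => ?_⟩
  have := (hΦ.2 γ.1).mul (hΨ.2 γ.2)
  rw [one_mul] at this
  refine this.congr fun n => ?_
  have him : (Φ n ×ˢ Ψ n).image (γ * ·) = (Φ n).image (γ.1 * ·) ×ˢ (Ψ n).image (γ.2 * ·) := by
    ext ⟨a, b⟩
    simp only [Finset.mem_image, Finset.mem_product, Prod.exists, Prod.ext_iff, Prod.fst_mul,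
      Prod.snd_mul]
    grind
  dsimp only
  rw [him, Finset.product_inter_product, Finset.card_product, Finset.card_product]
  push_cast
  rw [div_mul_div_comm]

end Folner

/-- Boundedness of a real-valued function. -/
def Bdd {Γ : Type*} (φ : Γ → ℝ) : Prop := ∃ C, ∀ x, |φ x| ≤ C

theorem Bdd.const {Γ : Type*} (c : ℝ) : Bdd fun _ : Γ => c := ⟨|c|, fun _ => le_rfl⟩

theorem Bdd.add {Γ : Type*} {φ ψ : Γ → ℝ} (hφ : Bdd φ) (hψ : Bdd ψ) : Bdd fun x => φ x + ψ x := by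
  obtain ⟨C, hC⟩ := hφ
  obtain ⟨D, hD⟩ := hψ
  exact ⟨C + D, fun x => (abs_add_le _ _).trans (add_le_add (hC x) (hD x))⟩

theorem Bdd.const_mul {Γ : Type*} (c : ℝ) {φ : Γ → ℝ} (hφ : Bdd φ) : Bdd fun x => c * φ x := by
  obtain ⟨C, hC⟩ := hφ
  exact ⟨|c| * C, fun x => by rw [abs_mul]; gcongr; exact hC x⟩

theorem Bdd.comp {Γ Δ : Type*} {φ : Γ → ℝ} (hφ : Bdd φ) (σ : Δ → Γ) : Bdd fun x => φ (σ x) :=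
  hφ.imp fun _ h x => h (σ x)

/-- A left-invariant mean on the bounded real-valued functions on `Γ`. -/
structure LeftMean (Γ : Type*) [Group Γ] where
  /-- The value of the mean; only meaningful on bounded functions. -/
  val : (Γ → ℝ) → ℝ
  add : ∀ {φ ψ}, Bdd φ → Bdd ψ → val (fun x => φ x + ψ x) = val φ + val ψ
  smul : ∀ (c : ℝ) {φ}, Bdd φ → val (fun x => c * φ x) = c * val φ
  mono : ∀ {φ ψ}, Bdd φ → Bdd ψ → (∀ x, φ x ≤ ψ x) → val φ ≤ val ψ
  const : ∀ c : ℝ, val (fun _ => c) = c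
  left_inv : ∀ (γ : Γ) {φ}, Bdd φ → val (fun x => φ (γ * x)) = val φ

theorem LeftMean.val_favg {Γ ι : Type*} [Group Γ] (M : LeftMean Γ) {s : Finset ι}
    (hs : s.Nonempty) (σ : ι → Γ) {φ : Γ → ℝ} (hφ : Bdd φ) :
    M.val (fun x => favg s fun i => φ (σ i * x)) = M.val φ := by
  have hsum : ∀ t : Finset ι, (Bdd fun x => ∑ i ∈ t, φ (σ i * x)) ∧
      M.val (fun x => ∑ i ∈ t, φ (σ i * x)) = t.card * M.val φ := by
    classical
    intro t
    induction t using Finset.induction_on with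
    | empty => exact ⟨⟨0, by simp⟩, by simpa using M.const 0⟩
    | insert a t ha ih =>
      simp only [Finset.sum_insert ha]
      refine ⟨(hφ.comp _).add ih.1, ?_⟩
      rw [M.add (hφ.comp _) ih.1, M.left_inv _ hφ, ih.2, Finset.card_insert_of_notMem ha]
      push_cast
      ring
  have : (s.card : ℝ) ≠ 0 := by exact_mod_cast hs.card_pos.ne'
  simp only [favg, smul_eq_mul]
  rw [M.smul _ (hsum s).1, (hsum s).2, inv_mul_cancel_left₀ this]

theorem exists_leftMean {Γ : Type*} [Group Γ] [DecidableEq Γ] {Ψ : ℕ → Finset Γ}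
    (hΨ : IsLeftFolner Ψ) (x : ℕ → Γ) :
    ∃ M : LeftMean Γ, ∀ ψ c, Bdd ψ → (∀ n, ∀ g ∈ Ψ n, ψ (g * x n) ≤ c) → M.val ψ ≤ c := by
  let 𝒰 : Ultrafilter ℕ := hyperfilter ℕ
  let av : (Γ → ℝ) → ℕ → ℝ := fun φ n => favg (Ψ n) (fun g => φ (g * x n))
  have lim : ∀ {φ}, Bdd φ → ∃ y, Tendsto (av φ) 𝒰 (nhds y) := by
    rintro φ ⟨C, hC⟩
    have hmem : ∀ n, av φ n ∈ Metric.closedBall (0 : ℝ) |C| := fun n => by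
      rw [mem_closedBall_zero_iff]
      exact norm_favg_le (abs_nonneg C) fun g _ => (hC _).trans (le_abs_self C)
    obtain ⟨y, -, hy⟩ := (isCompact_closedBall (0 : ℝ) |C|).ultrafilter_le_nhds
      (𝒰.map (av φ))
      (le_principal_iff.2 (mem_map.2 (univ_mem' hmem)))
    exact ⟨y, hy⟩
  classical
  let val : (Γ → ℝ) → ℝ := fun φ => if h : Bdd φ then (lim h).choose else 0
  have hval : ∀ {φ}, Bdd φ → Tendsto (av φ) 𝒰 (nhds (val φ)) := fun {φ} h => by
    simp only [val, dif_pos h]; exact (lim h).choose_spec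
  have huniq : ∀ {φ y}, Bdd φ → Tendsto (av φ) 𝒰 (nhds y) → val φ = y :=
    fun h hy => tendsto_nhds_unique (hval h) hy
  have hle : (𝒰 : Filter ℕ) ≤ atTop := by
    rw [← Nat.cofinite_eq_atTop]; exact hyperfilter_le_cofinite
  refine ⟨⟨val, ?_, ?_, ?_, ?_, ?_⟩, ?_⟩
  · rintro φ ψ hφ hψ
    refine huniq (hφ.add hψ) (((hval hφ).add (hval hψ)).congr fun n => ?_)
    simp [av, favg, Finset.sum_add_distrib, mul_add]
  · rintro c φ hφ
    refine huniq (hφ.const_mul c) (((hval hφ).const_mul c).congr fun n => ?_)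
    simp only [av, favg, smul_eq_mul, ← Finset.mul_sum]
    ring
  · rintro φ ψ hφ hψ h
    refine le_of_tendsto_of_tendsto' (hval hφ) (hval hψ) fun n => ?_
    simp only [av, favg, smul_eq_mul]
    gcongr
    exact h _
  · intro c
    refine huniq (Bdd.const c) (tendsto_const_nhds.congr fun n => ?_)
    exact (favg_const (hΨ.1 n) c).symm
  · rintro γ φ ⟨C, hC⟩
    have h0 := (hΨ.tendsto_norm_favg_sub γ (φ := fun n g => φ (g * x n)) (C := C)
      fun n i => hC _).mono_left hle
    refine huniq ⟨C, fun x => hC _⟩ ?_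
    have h1 := (tendsto_zero_iff_norm_tendsto_zero.2 h0).add (hval ⟨C, hC⟩)
    rw [zero_add] at h1
    refine h1.congr fun n => ?_
    simp only [av, mul_assoc, sub_add_cancel]
  · intro ψ c hψ h
    refine le_of_tendsto' (hval hψ) fun n => ?_
    rw [← favg_const (hΨ.1 n) c]
    simp only [av, favg, smul_eq_mul]
    gcongr with g hg
    exact h n g hg

section MeanErgodic

variable {G E F : Type*} [SeminormedAddCommGroup E] [InnerProductSpace ℝ E]
  [NormedAddCommGroup F] [InnerProductSpace ℝ F] [CompleteSpace F]

/-- The span of the coboundaries `W v y - y` of an action by isometries. -/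
def coboundaries (W : G → E →ₗᵢ[ℝ] E) : Submodule ℝ E :=
  Submodule.span ℝ (Set.range fun p : G × E => W p.1 p.2 - p.2)

theorem sub_mem_coboundaries (W : G → E →ₗᵢ[ℝ] E) (v : G) (y : E) :
    W v y - y ∈ coboundaries W :=
  Submodule.subset_span ⟨(v, y), rfl⟩

theorem favg_sub_mem_coboundaries (W : G → E →ₗᵢ[ℝ] E) {s : Finset G} (hs : s.Nonempty) (y : E) :
    favg s (fun h => W h y) - y ∈ coboundaries W := by
  have : favg s (fun h => W h y) - y = favg s (fun h => W h y - y) := by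
    rw [favg_sub, favg_const hs]
  rw [this]
  exact Submodule.smul_mem _ _ (Submodule.sum_mem _ fun h _ => sub_mem_coboundaries W h y)

theorem norm_favg_apply_le (W : G → E →ₗᵢ[ℝ] E) (s : Finset G) (y : E) :
    ‖favg s (fun h => W h y)‖ ≤ ‖y‖ :=
  norm_favg_le (norm_nonneg _) fun h _ => ((W h).norm_map y).le

theorem IsLeftFolner.tendsto_favg_of_mem_coboundaries [Group G] [DecidableEq G]
    {W : G → E →ₗᵢ[ℝ] E} (hW : ∀ a b x, W (a * b) x = W b (W a x)) {Φ : ℕ → Finset G}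
    (hΦ : IsLeftFolner Φ) {z : E} (hz : z ∈ coboundaries W) :
    Tendsto (fun n => ‖favg (Φ n) (fun h => W h z)‖) atTop (nhds 0) := by
  induction hz using Submodule.span_induction with
  | mem x hx =>
    obtain ⟨⟨v, y⟩, rfl⟩ := hx
    refine (hΦ.tendsto_norm_favg_sub v (φ := fun _ h => W h y) (C := ‖y‖)
      fun _ h => ((W h).norm_map y).le).congr fun n => ?_
    rw [← favg_sub]
    simp only [map_sub, hW]
  | zero => simp [favg]
  | add x y _ _ hx hy =>
    refine squeeze_zero (fun _ => norm_nonneg _) (fun n => ?_) (by simpa using hx.add hy)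
    refine le_trans (le_of_eq ?_) (norm_add_le _ _)
    simp [favg, Finset.sum_add_distrib]
  | smul c x _ hx =>
    have := hx.const_mul ‖c‖
    rw [mul_zero] at this
    refine this.congr fun n => ?_
    rw [← norm_smul]
    simp only [favg, map_smul, ← Finset.smul_sum]
    rw [smul_comm]

/-- The orthogonal projection, in a Hilbert space containing `E`, onto the orthogonal complement
of the coboundaries of an action by isometries of `E`. -/
noncomputable def invProj (ι : E →ₗᵢ[ℝ] F) (W : G → E →ₗᵢ[ℝ] E) : F →L[ℝ] F :=
  ((coboundaries W).map ι.toLinearMap)ᗮ.starProjection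

variable (ι : E →ₗᵢ[ℝ] F) (W : G → E →ₗᵢ[ℝ] E)

theorem inner_invProj_left (x y : F) :
    inner ℝ (invProj ι W x) y = inner ℝ x (invProj ι W y) :=
  Submodule.inner_starProjection_left_eq_right _ x y

theorem invProj_invProj (x : F) : invProj ι W (invProj ι W x) = invProj ι W x :=
  Submodule.starProjection_eq_self_iff.2 (Submodule.starProjection_apply_mem _ x)

theorem inner_self_invProj (x : F) : inner ℝ x (invProj ι W x) = ‖invProj ι W x‖ ^ 2 := by
  rw [← real_inner_self_eq_norm_sq, inner_invProj_left, invProj_invProj]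

theorem norm_invProj_le (x : F) : ‖invProj ι W x‖ ≤ ‖x‖ :=
  Submodule.norm_starProjection_apply_le _ x

theorem norm_sub_invProj_sq (x : F) :
    ‖x - invProj ι W x‖ ^ 2 = ‖x‖ ^ 2 - ‖invProj ι W x‖ ^ 2 := by
  rw [norm_sub_sq_real, inner_self_invProj]
  ring

theorem invProj_of_mem_coboundaries {z : E} (hz : z ∈ coboundaries W) :
    invProj ι W (ι z) = 0 :=
  Submodule.starProjection_orthogonal_apply_eq_zero (Submodule.mem_map_of_mem hz)

theorem invProj_favg {s : Finset G} (hs : s.Nonempty) (y : E) :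
    invProj ι W (ι (favg s fun h => W h y)) = invProj ι W (ι y) := by
  rw [← sub_eq_zero, ← map_sub, ← map_sub]
  exact invProj_of_mem_coboundaries ι W (favg_sub_mem_coboundaries W hs y)

/-- The mean ergodic theorem. -/
theorem IsLeftFolner.tendsto_favg_invProj [Group G] [DecidableEq G]
    {W : G → E →ₗᵢ[ℝ] E} (hW : ∀ a b x, W (a * b) x = W b (W a x)) {Φ : ℕ → Finset G}
    (hΦ : IsLeftFolner Φ) (x : E) :
    Tendsto (fun n => ι (favg (Φ n) fun h => W h x)) atTop (nhds (invProj ι W (ι x))) := by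
  rw [Metric.tendsto_atTop]
  intro ε hε
  have hmem : ι x - invProj ι W (ι x) ∈
      closure ((coboundaries W).map ι.toLinearMap : Set F) := by
    rw [← Submodule.topologicalClosure_coe, SetLike.mem_coe,
      ← Submodule.orthogonal_orthogonal_eq_closure]
    exact Submodule.sub_starProjection_mem_orthogonal (ι x)
  obtain ⟨_, ⟨z, hz, rfl⟩, hzε⟩ := Metric.mem_closure_iff.1 hmem (ε / 2) (half_pos hε)
  have hQ : invProj ι W (ι (x - z)) = invProj ι W (ι x) := by
    rw [map_sub, map_sub, invProj_of_mem_coboundaries ι W hz, sub_zero]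
  obtain ⟨N, hN⟩ := Metric.tendsto_atTop.1 (hΦ.tendsto_favg_of_mem_coboundaries hW hz) (ε / 2)
    (half_pos hε)
  refine ⟨N, fun n hn => ?_⟩
  have h1 : ‖ι (favg (Φ n) fun h => W h z)‖ < ε / 2 := by
    rw [ι.norm_map]
    simpa using hN n hn
  have h2 : ‖ι (favg (Φ n) fun h => W h (x - z)) - invProj ι W (ι x)‖ < ε / 2 := by
    refine lt_of_le_of_lt ?_ (show ‖ι (x - z) - invProj ι W (ι x)‖ < ε / 2 from ?_)
    · refine (sq_le_sq₀ (norm_nonneg _) (norm_nonneg _)).1 ?_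
      rw [← hQ]
      conv_lhs => rw [← invProj_favg ι W (hΦ.1 n)]
      rw [norm_sub_invProj_sq, norm_sub_invProj_sq, invProj_favg ι W (hΦ.1 n), ι.norm_map,
        ι.norm_map]
      have := norm_favg_apply_le W (Φ n) (x - z)
      gcongr
    · rw [dist_eq_norm] at hzε
      rw [map_sub, sub_right_comm]
      exact hzε
  have h3 : ι (favg (Φ n) fun h => W h x) =
      ι (favg (Φ n) fun h => W h (x - z)) + ι (favg (Φ n) fun h => W h z) := by
    simp only [map_sub, favg_sub, sub_add_cancel]
  rw [dist_eq_norm, h3, add_sub_right_comm]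
  exact (norm_add_le _ _).trans_lt (by linarith)

/-- The orthogonal projection of a Hilbert space onto the vectors fixed by an action. -/
noncomputable abbrev fixProj (W : G → F →ₗᵢ[ℝ] F) : F →L[ℝ] F := invProj LinearIsometry.id W

theorem fixProj_favg (W : G → F →ₗᵢ[ℝ] F) {s : Finset G} (hs : s.Nonempty) (y : F) :
    fixProj W (favg s fun h => W h y) = fixProj W y :=
  invProj_favg LinearIsometry.id W hs y

theorem apply_fixProj (W : G → F →ₗᵢ[ℝ] F) (v : G) (x : F) :
    W v (fixProj W x) = fixProj W x := by
  set y := fixProj W x with hy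
  have h0 : fixProj W (W v y) = fixProj W y := by
    rw [← sub_eq_zero, ← map_sub]
    exact invProj_of_mem_coboundaries LinearIsometry.id W (sub_mem_coboundaries W v y)
  have h1 : fixProj W y = y := invProj_invProj _ _ x
  have h2 := norm_sub_invProj_sq LinearIsometry.id W (W v y)
  rw [(W v).norm_map, show invProj LinearIsometry.id W (W v y) = y from h0.trans h1, sub_self] at h2
  exact sub_eq_zero.1 (norm_eq_zero.1 (pow_eq_zero_iff two_ne_zero |>.1 h2))

theorem fixProj_of_fixed (W : G → F →ₗᵢ[ℝ] F) {x : F} (hx : ∀ v, W v x = x) :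
    fixProj W x = x := by
  refine Submodule.starProjection_eq_self_iff.2 ?_
  rw [Submodule.mem_orthogonal]
  rintro _ ⟨z, hz, rfl⟩
  change inner ℝ z x = 0
  induction hz using Submodule.span_induction with
  | mem z hz =>
    obtain ⟨⟨v, y⟩, rfl⟩ := hz
    change inner ℝ (W v y - y) x = 0
    rw [inner_sub_left, sub_eq_zero]
    conv_lhs => rw [← hx v]
    exact (W v).inner_map_map y x
  | zero => simp
  | add a b _ _ ha hb => rw [inner_add_left, ha, hb, add_zero]
  | smul c a _ ha => rw [inner_smul_left, ha, mul_zero]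

theorem sq_inner_le_inner_fixProj (W : G → F →ₗᵢ[ℝ] F) {e : F} (he : ∀ g, W g e = e)
    (hn : ‖e‖ = 1) (x : F) : inner ℝ e x ^ 2 ≤ inner ℝ x (fixProj W x) := by
  rw [inner_self_invProj, ← fixProj_of_fixed W he, inner_invProj_left, ← sq_abs]
  have := abs_real_inner_le_norm e (fixProj W x)
  rw [hn, one_mul] at this
  gcongr

end MeanErgodic

section BddFam

variable {Γ V : Type*} [Group Γ] [NormedAddCommGroup V] [InnerProductSpace ℝ V]

/-- The space of bounded families of vectors of `V` indexed by `Γ`, to be equipped with the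
semi-inner product obtained by averaging inner products with respect to a mean on `Γ`. -/
def BddFam (_M : LeftMean Γ) (V : Type*) [NormedAddCommGroup V] [InnerProductSpace ℝ V] : Type _ :=
  ({ carrier := {F | ∃ C, ∀ γ, ‖F γ‖ ≤ C}
     add_mem' := by
      rintro F H ⟨C, hC⟩ ⟨D, hD⟩
      exact ⟨C + D, fun γ => (norm_add_le _ _).trans (add_le_add (hC γ) (hD γ))⟩
     zero_mem' := ⟨0, fun γ => by simp⟩
     smul_mem' := by
      rintro c F ⟨C, hC⟩
      exact ⟨‖c‖ * C, fun γ => by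
        rw [Pi.smul_apply, norm_smul]; gcongr; exact hC γ⟩ } : Submodule ℝ (Γ → V))

namespace BddFam

variable {M : LeftMean Γ}

noncomputable instance : AddCommGroup (BddFam M V) := by unfold BddFam; infer_instance

noncomputable instance : Module ℝ (BddFam M V) := by unfold BddFam; infer_instance

/-- Evaluation of a family at an index. -/
def eval (γ : Γ) : BddFam M V →ₗ[ℝ] V where
  toFun F := F.1 γ
  map_add' _ _ := rfl
  map_smul' _ _ := rfl

/-- The bounded family with the given entries. -/
def mk (F : Γ → V) (hF : ∃ C, ∀ γ, ‖F γ‖ ≤ C) : BddFam M V := ⟨F, hF⟩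

@[simp]
theorem eval_mk (F : Γ → V) (hF : ∃ C, ∀ γ, ‖F γ‖ ≤ C) (γ : Γ) :
    eval γ (mk F hF : BddFam M V) = F γ := rfl

theorem ext' {F H : BddFam M V} (h : ∀ γ, eval γ F = eval γ H) : F = H :=
  Subtype.ext (funext h)

theorem bdd_inner (F H : BddFam M V) : Bdd fun γ => inner ℝ (eval γ F) (eval γ H) := by
  obtain ⟨C, hC⟩ := F.2
  obtain ⟨D, hD⟩ := H.2
  refine ⟨|C| * |D|, fun γ => (abs_real_inner_le_norm _ _).trans ?_⟩
  exact mul_le_mul ((hC γ).trans (le_abs_self C)) ((hD γ).trans (le_abs_self D)) (norm_nonneg _)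
    (abs_nonneg _)

/-- The semi-inner product on bounded families given by a mean. -/
@[reducible]
noncomputable def core (M : LeftMean Γ) (V : Type*) [NormedAddCommGroup V]
    [InnerProductSpace ℝ V] : PreInnerProductSpace.Core ℝ (BddFam M V) where
  inner F H := M.val fun γ => inner ℝ (eval γ F) (eval γ H)
  conj_inner_symm F H := by simp [real_inner_comm]
  re_inner_nonneg F := by
    rw [RCLike.re_to_real, ← M.const 0]
    exact M.mono ⟨0, fun _ => by simp⟩ (bdd_inner F F) fun γ => real_inner_self_nonneg
  add_left F F' H := by
    simp only [map_add, inner_add_left]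
    exact M.add (bdd_inner F H) (bdd_inner F' H)
  smul_left F H c := by
    simp only [map_smul, inner_smul_left]
    exact M.smul c (bdd_inner F H)

noncomputable instance : SeminormedAddCommGroup (BddFam M V) :=
  @InnerProductSpace.Core.toSeminormedAddCommGroup ℝ _ _ _ _ (core M V)

noncomputable instance : InnerProductSpace ℝ (BddFam M V) :=
  InnerProductSpace.ofCore (core M V)

theorem inner_def (F H : BddFam M V) :
    inner ℝ F H = M.val fun γ => inner ℝ (eval γ F) (eval γ H) := rfl

theorem bdd_norm_sq (F : BddFam M V) : Bdd fun γ => ‖eval γ F‖ ^ 2 := by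
  simpa only [real_inner_self_eq_norm_sq] using bdd_inner F F

theorem norm_sq (F : BddFam M V) : ‖F‖ ^ 2 = M.val fun γ => ‖eval γ F‖ ^ 2 := by
  simp only [← real_inner_self_eq_norm_sq, inner_def]

theorem norm_le {F : BddFam M V} {C : ℝ} (hC : 0 ≤ C) (h : ∀ γ, ‖eval γ F‖ ≤ C) : ‖F‖ ≤ C := by
  refine (sq_le_sq₀ (norm_nonneg _) hC).1 ?_
  rw [norm_sq, ← M.const (C ^ 2)]
  refine M.mono (bdd_norm_sq F) ⟨|C ^ 2|, fun _ => le_rfl⟩ fun γ => ?_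
  have := h γ
  gcongr

/-- The isometry of bounded families obtained by applying an isometry of `V` to every entry. -/
noncomputable def mapₗᵢ (L : V →ₗᵢ[ℝ] V) : BddFam M V →ₗᵢ[ℝ] BddFam M V where
  toFun F := mk (fun γ => L (eval γ F)) (F.2.imp fun _ hC γ => (L.norm_map _).trans_le (hC γ))
  map_add' F H := ext' fun γ => by simp
  map_smul' c F := ext' fun γ => by simp
  norm_map' F := by
    rw [← sq_eq_sq₀ (norm_nonneg _) (norm_nonneg _), norm_sq, norm_sq]
    refine congrArg M.val (funext fun γ => ?_)
    exact congrArg (· ^ 2) (L.norm_map _)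

@[simp]
theorem eval_mapₗᵢ (L : V →ₗᵢ[ℝ] V) (F : BddFam M V) (γ : Γ) :
    eval γ (mapₗᵢ L F) = L (eval γ F) := rfl

end BddFam

end BddFam

/-- The Hilbert space data attached to two commuting measure-preserving actions of `G` and a
measurable set `A`: the Koopman representations `U` and `W`, the multiplication `P` by the
indicator function of `A`, the constant function `e`, and the relevant consequence of the
pointwise multiplicativity of `U`, `W` and `P`. -/
structure KoopmanSystem (G V : Type*) [Group G] [NormedAddCommGroup V] [InnerProductSpace ℝ V] where
  /-- The Koopman representation of the first action. -/
  U : G → V →ₗᵢ[ℝ] V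
  /-- The Koopman representation of the second action. -/
  W : G → V →ₗᵢ[ℝ] V
  /-- Multiplication by the indicator function. -/
  P : V →L[ℝ] V
  /-- The constant function. -/
  e : V
  U_mul : ∀ a b x, U (a * b) x = U b (U a x)
  W_mul : ∀ a b x, W (a * b) x = W b (W a x)
  U_one : ∀ x, U 1 x = x
  W_one : ∀ x, W 1 x = x
  inner_P_left : ∀ x y, inner ℝ (P x) y = inner ℝ x (P y)
  norm_P_le : ∀ x, ‖P x‖ ≤ ‖x‖
  U_e : ∀ g, U g e = e
  W_e : ∀ g, W g e = e
  norm_e : ‖e‖ = 1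
  dense_bdd : Dense {k : V | ∃ C : ℝ, 0 ≤ C ∧ ∀ w g (s : Finset G) l, ∃ q : V, ‖q‖ ≤ C * ‖l‖ ∧
    ∀ h, inner ℝ (W h (P (U g (P (W h⁻¹ l))))) (favg s fun v => W v (P (U g (U w k)))) =
      inner ℝ (W h (P (U g (P e)))) q}

namespace KoopmanSystem

section Algebra

variable {G V : Type*} [Group G] [NormedAddCommGroup V] [InnerProductSpace ℝ V]
  (K : KoopmanSystem G V)

theorem inner_W_left (g : G) (x y : V) : inner ℝ (K.W g x) y = inner ℝ x (K.W g⁻¹ y) := by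
  rw [← (K.W g⁻¹).inner_map_map, ← K.W_mul, mul_inv_cancel, K.W_one]

theorem inner_W_right (g : G) (x y : V) : inner ℝ x (K.W g y) = inner ℝ (K.W g⁻¹ x) y := by
  rw [real_inner_comm, inner_W_left, real_inner_comm]

theorem norm_PU_le (g : G) (x : V) : ‖K.P (K.U g x)‖ ≤ ‖x‖ :=
  (K.norm_P_le _).trans_eq ((K.U g).norm_map x)

variable (M : LeftMean (G × G))

/-- The action of the second Koopman representation on bounded families. -/
noncomputable def famW (h : G) : BddFam M V →ₗᵢ[ℝ] BddFam M V := BddFam.mapₗᵢ (K.W h)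

theorem famW_mul (a b : G) (F : BddFam M V) :
    K.famW M (a * b) F = K.famW M b (K.famW M a F) :=
  BddFam.ext' fun _ => K.W_mul a b _

/-- The family `(g, h) ↦ P (U g k)`. -/
noncomputable def fam : V →L[ℝ] BddFam M V :=
  LinearMap.mkContinuous
    { toFun := fun k => BddFam.mk (fun γ => K.P (K.U γ.1 k)) ⟨‖k‖, fun γ => K.norm_PU_le γ.1 k⟩
      map_add' := fun x y => BddFam.ext' fun γ => by simp
      map_smul' := fun c x => BddFam.ext' fun γ => by simp }
    1 fun k => by
      rw [one_mul]
      exact BddFam.norm_le (norm_nonneg k) fun γ => K.norm_PU_le γ.1 k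

@[simp]
theorem eval_fam (γ : G × G) (k : V) :
    BddFam.eval γ (K.fam M k) = K.P (K.U γ.1 k) := rfl

theorem eval_favg (s : Finset G) (γ : G × G) (F : BddFam M V) :
    BddFam.eval γ (favg s fun v => K.famW M v F) = favg s fun v => K.W v (BddFam.eval γ F) :=
  map_favg (BddFam.eval γ) _ _

theorem inner_fam_U (s : Finset G) (w : G) (x y : V) :
    inner ℝ (K.fam M (K.U w x)) (favg s fun v => K.famW M v (K.fam M (K.U w y))) =
      inner ℝ (K.fam M x) (favg s fun v => K.famW M v (K.fam M y)) := by
  rw [BddFam.inner_def, BddFam.inner_def, ← M.left_inv (w, 1) (BddFam.bdd_inner (K.fam M x) _)]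
  simp only [eval_favg, eval_fam, Prod.fst_mul, K.U_mul]

end Algebra

variable {G V : Type*} [Group G] [NormedAddCommGroup V] [InnerProductSpace ℝ V]
  [CompleteSpace V] (K : KoopmanSystem G V) (M : LeftMean (G × G))

open UniformSpace in
/-- The projection, in the completion of the space of bounded families, onto the vectors
orthogonal to the coboundaries of `famW`. -/
noncomputable def famProj : Completion (BddFam M V) →L[ℝ] Completion (BddFam M V) :=
  invProj Completion.toComplₗᵢ (K.famW M)

open UniformSpace in
/-- The embedding of `V` in the completed space of bounded families. -/
noncomputable def famCompl : V →L[ℝ] Completion (BddFam M V) :=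
  Completion.toComplₗᵢ.toContinuousLinearMap ∘L K.fam M

/-- The positive operator on `V` that represents the quadratic form `‖famProj (fam k)‖ ^ 2`. -/
noncomputable def dual : V →L[ℝ] V :=
  ContinuousLinearMap.adjoint (K.famCompl M) ∘L K.famProj M ∘L K.famCompl M

theorem inner_dual (l k : V) :
    inner ℝ l (K.dual M k) = inner ℝ (K.famCompl M l) (K.famProj M (K.famCompl M k)) := by
  simp [dual, ContinuousLinearMap.adjoint_inner_right]

theorem inner_dual_self (k : V) :
    inner ℝ k (K.dual M k) = ‖K.famProj M (K.famCompl M k)‖ ^ 2 := by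
  rw [inner_dual]
  exact inner_self_invProj _ _ _

variable [DecidableEq G] {Φ : ℕ → Finset G}

theorem tendsto_inner_dual (hΦ : IsLeftFolner Φ) (l k : V) :
    Tendsto (fun j => inner ℝ (K.fam M l) (favg (Φ j) fun v => K.famW M v (K.fam M k))) atTop
      (nhds (inner ℝ l (K.dual M k))) := by
  rw [inner_dual]
  refine (Tendsto.inner (𝕜 := ℝ) (tendsto_const_nhds (x := K.famCompl M l))
    (hΦ.tendsto_favg_invProj UniformSpace.Completion.toComplₗᵢ (K.famW_mul M)
      (K.fam M k))).congr fun j => ?_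
  exact UniformSpace.Completion.inner_coe _ _

theorem dual_U (hΦ : IsLeftFolner Φ) (w : G) (k : V) :
    K.dual M (K.U w k) = K.U w (K.dual M k) := by
  refine ext_inner_left ℝ fun x => ?_
  obtain ⟨x, rfl⟩ : ∃ y, K.U w y = x := ⟨K.U w⁻¹ x, by rw [← K.U_mul, inv_mul_cancel, K.U_one]⟩
  rw [(K.U w).inner_map_map]
  refine tendsto_nhds_unique (K.tendsto_inner_dual M hΦ _ _) ?_
  simp only [inner_fam_U]
  exact K.tendsto_inner_dual M hΦ _ _

theorem exists_tendsto_inner_famW (hΦ : IsTwoSidedFolner Φ) {k : V} {C : ℝ} (l : V)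
    (hk : ∀ g n, ∃ q : V, ‖q‖ ≤ C * ‖l‖ ∧
      ∀ h, inner ℝ (K.W h (K.P (K.U g (K.P (K.W h⁻¹ l)))))
        (favg (Φ n) fun v => K.W v (K.P (K.U g k))) =
        inner ℝ (K.W h (K.P (K.U g (K.P K.e)))) q) :
    ∃ q : ℕ → BddFam M V, (∀ j, ‖q j‖ ≤ C * ‖l‖) ∧ ∀ h, Tendsto
      (fun j => inner ℝ (K.famW M h (K.fam M (K.P K.e))) (q j)) atTop
      (nhds (inner ℝ l (K.W h (K.P (K.dual M k))))) := by
  choose q hq hqi using hk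
  refine ⟨fun j => BddFam.mk (fun γ => q γ.1 j) ⟨_, fun γ => hq γ.1 j⟩,
    fun j => BddFam.norm_le ((norm_nonneg _).trans (hq 1 j)) fun γ => hq γ.1 j, fun h => ?_⟩
  have h1 := K.tendsto_inner_dual M hΦ.1 (K.P (K.W h⁻¹ l)) k
  rw [K.inner_P_left, ← K.inner_W_right] at h1
  have h2 : Tendsto (fun j => inner ℝ (K.famW M h (K.fam M (K.P (K.W h⁻¹ l))))
      ((favg (Φ j) fun v => K.famW M (v * h) (K.fam M k)) -
        favg (Φ j) fun v => K.famW M v (K.fam M k))) atTop (nhds 0) := by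
    refine squeeze_zero_norm (fun j => norm_inner_le_norm _ _) ?_
    have := (hΦ.tendsto_norm_favg_sub h (φ := fun _ v => K.famW M v (K.fam M k))
      (C := ‖K.fam M k‖) fun _ v => ((K.famW M v).norm_map _).le).const_mul
      ‖K.famW M h (K.fam M (K.P (K.W h⁻¹ l)))‖
    rwa [mul_zero] at this
  have h3 := h1.sub h2
  rw [sub_zero] at h3
  refine h3.congr fun j => ?_
  have h4 : (favg (Φ j) fun v => K.famW M (v * h) (K.fam M k)) =
      K.famW M h (favg (Φ j) fun v => K.famW M v (K.fam M k)) := by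
    simp only [famW_mul]
    exact (map_favg (K.famW M h).toLinearMap _ _).symm
  rw [inner_sub_right, h4, (K.famW M h).inner_map_map, sub_sub_cancel, BddFam.inner_def,
    BddFam.inner_def]
  refine congrArg M.val (funext fun γ => ?_)
  rw [eval_favg]
  exact hqi γ.1 j h

theorem norm_favg_sub_favg_le (hΦ : IsTwoSidedFolner Φ) {k : V} {C : ℝ} (hC : 0 ≤ C)
    (hk : ∀ g n l, ∃ q : V, ‖q‖ ≤ C * ‖l‖ ∧
      ∀ h, inner ℝ (K.W h (K.P (K.U g (K.P (K.W h⁻¹ l)))))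
        (favg (Φ n) fun v => K.W v (K.P (K.U g k))) =
        inner ℝ (K.W h (K.P (K.U g (K.P K.e)))) q) (n m : ℕ) :
    ‖(favg (Φ n) fun h => K.W h (K.P (K.dual M k))) -
        favg (Φ m) fun h => K.W h (K.P (K.dual M k))‖ ≤
      C * ‖(favg (Φ n) fun h => K.famW M h (K.fam M (K.P K.e))) -
        favg (Φ m) fun h => K.famW M h (K.fam M (K.P K.e))‖ := by
  set x := (favg (Φ n) fun h => K.W h (K.P (K.dual M k))) -
    favg (Φ m) fun h => K.W h (K.P (K.dual M k)) with hx
  set y := (favg (Φ n) fun h => K.famW M h (K.fam M (K.P K.e))) -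
        favg (Φ m) fun h => K.famW M h (K.fam M (K.P K.e)) with hy
  obtain ⟨q, hq, hlim⟩ := K.exists_tendsto_inner_famW M hΦ x fun g n => hk g n x
  have havg : ∀ i, Tendsto
      (fun j => inner ℝ (favg (Φ i) fun h => K.famW M h (K.fam M (K.P K.e))) (q j)) atTop
      (nhds (inner ℝ x (favg (Φ i) fun h => K.W h (K.P (K.dual M k))))) := fun i => by
    simp only [favg, real_inner_smul_left, real_inner_smul_right, sum_inner, inner_sum]
    exact (tendsto_finsetSum _ fun h _ => hlim h).const_mul _
  have h1 := (havg n).sub (havg m)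
  simp only [← inner_sub_left, ← inner_sub_right, ← hx, ← hy] at h1
  have h2 : inner ℝ x x ≤ C * ‖y‖ * ‖x‖ := by
    refine le_of_tendsto' h1 fun j => (real_inner_le_norm _ _).trans ?_
    calc ‖y‖ * ‖q j‖ ≤ ‖y‖ * (C * ‖x‖) := by gcongr; exact hq j
      _ = _ := by ring
  rw [real_inner_self_eq_norm_mul_norm] at h2
  rcases (norm_nonneg x).eq_or_lt with h0 | h0
  · rw [← h0]; positivity
  · exact le_of_mul_le_mul_right h2 h0

/-- The averages of `P (U w (dual k))` converge uniformly in `w`. -/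
theorem exists_norm_favg_sub_fixProj_le (hΦ : IsTwoSidedFolner Φ) {k : V} {C : ℝ} (hC : 0 ≤ C)
    (hk : ∀ w g (s : Finset G) l, ∃ q : V, ‖q‖ ≤ C * ‖l‖ ∧
      ∀ h, inner ℝ (K.W h (K.P (K.U g (K.P (K.W h⁻¹ l)))))
        (favg s fun v => K.W v (K.P (K.U g (K.U w k)))) = inner ℝ (K.W h (K.P (K.U g (K.P K.e)))) q)
    {η : ℝ} (hη : 0 < η) :
    ∃ N, ∀ n ≥ N, ∀ w, ‖(favg (Φ n) fun h => K.W h (K.P (K.U w (K.dual M k)))) -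
      fixProj K.W (K.P (K.U w (K.dual M k)))‖ ≤ η := by
  have hcau := (hΦ.1.tendsto_favg_invProj UniformSpace.Completion.toComplₗᵢ (K.famW_mul M)
    (K.fam M (K.P K.e))).cauchySeq
  obtain ⟨N, hN⟩ := Metric.cauchySeq_iff.1 hcau (η / (C + 1)) (by positivity)
  refine ⟨N, fun n hn w => ?_⟩
  have hlim := (hΦ.1.tendsto_favg_invProj LinearIsometry.id K.W_mul
    (K.P (K.U w (K.dual M k)))).const_sub (favg (Φ n) fun h => K.W h (K.P (K.U w (K.dual M k))))
  refine le_of_tendsto hlim.norm (eventually_atTop.2 ⟨N, fun m hm => ?_⟩)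
  have h1 := K.norm_favg_sub_favg_le M hΦ hC (k := K.U w k) (fun g n l => hk w g (Φ n) l) n m
  have h2 := (hN n hn m hm).le
  rw [LinearIsometry.dist_map, dist_eq_norm] at h2
  rw [K.dual_U M hΦ.1] at h1
  refine h1.trans ((mul_le_mul_of_nonneg_left h2 hC).trans ?_)
  rw [mul_div_assoc', div_le_iff₀ (by positivity)]
  nlinarith

end KoopmanSystem

namespace KoopmanSystem

variable {G V : Type*} [Group G] [NormedAddCommGroup V] [InnerProductSpace ℝ V]
  (K : KoopmanSystem G V) (M : LeftMean (G × G))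

theorem norm_P_e_le : ‖K.P K.e‖ ≤ 1 := (K.norm_P_le _).trans_eq K.norm_e

theorem bdd_inner_PU (x y : V) : Bdd fun γ : G × G => inner ℝ x (K.P (K.U γ.1 y)) :=
  ⟨‖x‖ * ‖y‖, fun _ => (abs_real_inner_le_norm _ _).trans
    (mul_le_mul_of_nonneg_left (K.norm_PU_le _ _) (norm_nonneg _))⟩

theorem bdd_inner_PU_WPU (x y : V) :
    Bdd fun γ : G × G => inner ℝ (K.P (K.U γ.1 x)) (K.W γ.2 (K.P (K.U γ.1 y))) :=
  ⟨‖x‖ * ‖y‖, fun γ => (abs_real_inner_le_norm _ _).trans (mul_le_mul (K.norm_PU_le _ _)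
    (((K.W γ.2).norm_map _).trans_le (K.norm_PU_le _ _)) (norm_nonneg _) (norm_nonneg _))⟩

theorem mean_inner_WPU_eq {s : Finset G} (hs : s.Nonempty) (x y : V) :
    M.val (fun γ => inner ℝ (K.P (K.U γ.1 x))
      (K.W γ.2 (favg s fun v => K.W v (K.P (K.U γ.1 y))))) =
    M.val fun γ => inner ℝ (K.P (K.U γ.1 x)) (K.W γ.2 (K.P (K.U γ.1 y))) := by
  rw [← M.val_favg hs (fun v => (1, v)) (K.bdd_inner_PU_WPU x y)]
  refine congrArg M.val (funext fun γ => ?_)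
  simp only [Prod.fst_mul, Prod.snd_mul, one_mul, K.W_mul]
  exact map_favg ((innerₗ V (K.P (K.U γ.1 x))) ∘ₗ (K.W γ.2).toLinearMap) _ _

variable [CompleteSpace V]

theorem inner_fixProj_sub_le {s : Finset G} (hs : s.Nonempty) {η : ℝ} {x d r t : V}
    (hx : x = d + r + t) (hx1 : ‖x‖ ≤ 1) (ht : ‖t‖ ≤ η)
    (hd : ‖(favg s fun h => K.W h d) - fixProj K.W d‖ ≤ η) (h : G) :
    inner ℝ x (fixProj K.W x) - 3 * η - 2 * ‖favg s fun h => K.W h r‖ ≤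
      inner ℝ x (K.W h (favg s fun v => K.W v x)) := by
  have hadd : ∀ a b, (favg s fun h => K.W h (a + b)) =
      (favg s fun h => K.W h a) + favg s fun h => K.W h b := fun a b => by
    simp [favg, Finset.sum_add_distrib]
  have h1 : ‖fixProj K.W r‖ ≤ ‖favg s fun h => K.W h r‖ := by
    rw [← fixProj_favg K.W hs r]
    exact norm_invProj_le _ _ _
  have h2 : ‖fixProj K.W t‖ ≤ η := (norm_invProj_le _ _ _).trans ht
  have h3 : ‖favg s fun h => K.W h t‖ ≤ η := (norm_favg_apply_le _ _ _).trans ht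
  set z := (favg s fun v => K.W v x) - fixProj K.W x with hz
  have h4 : ‖z‖ ≤ 3 * η + 2 * ‖favg s fun h => K.W h r‖ := by
    have : z = ((favg s fun h => K.W h d) - fixProj K.W d) + (favg s fun h => K.W h r) -
        fixProj K.W r + (favg s fun h => K.W h t) - fixProj K.W t := by
      rw [hz, hx, hadd, hadd, map_add, map_add]
      abel
    rw [this]
    refine (norm_sub_le _ _).trans ?_
    have := norm_add_le (((favg s fun h => K.W h d) - fixProj K.W d) +
      (favg s fun h => K.W h r) - fixProj K.W r) (favg s fun h => K.W h t)
    have := norm_sub_le (((favg s fun h => K.W h d) - fixProj K.W d) +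
      (favg s fun h => K.W h r)) (fixProj K.W r)
    have := norm_add_le ((favg s fun h => K.W h d) - fixProj K.W d) (favg s fun h => K.W h r)
    linarith
  have h5 : K.W h (favg s fun v => K.W v x) = fixProj K.W x + K.W h z := by
    rw [hz, map_sub, apply_fixProj, add_sub_cancel]
  have h6 := neg_le_of_abs_le (abs_real_inner_le_norm x (K.W h z))
  rw [(K.W h).norm_map] at h6
  rw [h5, inner_add_right]
  nlinarith [norm_nonneg z]

variable [DecidableEq G] {Φ : ℕ → Finset G}

theorem sq_inner_le_mean (hΦ : IsLeftFolner Φ) :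
    inner ℝ K.e (K.P K.e) ^ 2 ≤ M.val fun γ => inner ℝ K.e (K.P (K.U γ.1 (K.P K.e))) := by
  have hb := K.bdd_inner_PU K.e (K.P K.e)
  set f := K.P K.e
  have hf : ∀ x, inner ℝ K.e (K.P x) = inner ℝ f x := fun x => (K.inner_P_left _ _).symm
  have hlim : Tendsto (fun n => inner ℝ f (fixProj K.U f) -
      ‖f‖ * ‖(favg (Φ n) fun v => K.U v f) - fixProj K.U f‖) atTop
      (nhds (inner ℝ f (fixProj K.U f))) := by
    have := ((tendsto_iff_norm_sub_tendsto_zero.1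
      (hΦ.tendsto_favg_invProj LinearIsometry.id K.U_mul f)).const_mul ‖f‖).const_sub
      (inner ℝ f (fixProj K.U f))
    simpa using this
  refine (sq_inner_le_inner_fixProj K.U K.U_e K.norm_e f).trans (le_of_tendsto' hlim fun n => ?_)
  rw [← M.val_favg (hΦ.1 n) (fun v => (v, 1)) hb, ← M.const (_ - _)]
  have heq : ∀ γ : G × G, (favg (Φ n) fun v => inner ℝ K.e (K.P (K.U ((v, (1 : G)) * γ).1 f))) =
      inner ℝ f (K.U γ.1 (favg (Φ n) fun v => K.U v f)) := fun γ => by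
    simp only [Prod.fst_mul, K.U_mul, hf]
    exact (map_favg (innerₗ V f ∘ₗ (K.U γ.1).toLinearMap) _ _).symm
  simp only [heq]
  refine M.mono (Bdd.const _) ?_ fun γ => ?_
  · refine ⟨‖f‖ * ‖favg (Φ n) fun v => K.U v f‖, fun γ => (abs_real_inner_le_norm _ _).trans ?_⟩
    rw [(K.U γ.1).norm_map]
  · have h1 : inner ℝ f (K.U γ.1 (favg (Φ n) fun v => K.U v f)) = inner ℝ f (fixProj K.U f) +
        inner ℝ f (K.U γ.1 ((favg (Φ n) fun v => K.U v f) - fixProj K.U f)) := by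
      rw [map_sub, apply_fixProj, inner_sub_right]
      ring
    have h2 := neg_le_of_abs_le (abs_real_inner_le_norm f
      (K.U γ.1 ((favg (Φ n) fun v => K.U v f) - fixProj K.U f)))
    rw [(K.U γ.1).norm_map] at h2
    linarith

/-- Decomposition of a vector into a part with uniformly convergent averages, a part whose
averages are small in mean, and a small error. -/
theorem exists_decomposition (hΦ : IsTwoSidedFolner Φ) (f : V) {η : ℝ} (hη : 0 < η) :
    ∃ j d k₀, ‖f - d - k₀‖ ≤ η ∧ ‖favg (Φ j) fun v => K.famW M v (K.fam M k₀)‖ ≤ η ∧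
      ∀ w, ‖(favg (Φ j) fun h => K.W h (K.P (K.U w d))) - fixProj K.W (K.P (K.U w d))‖ ≤ η := by
  obtain ⟨y, hy, k₀, hk₀, hf⟩ :=
    (LinearMap.range (K.dual M).toLinearMap).topologicalClosure.exists_add_mem_mem_orthogonal f
  have hy' : y ∈ closure (K.dual M '' {k : V | ∃ C : ℝ, 0 ≤ C ∧
      ∀ w g (s : Finset G) l, ∃ q : V, ‖q‖ ≤ C * ‖l‖ ∧
        ∀ h, inner ℝ (K.W h (K.P (K.U g (K.P (K.W h⁻¹ l)))))
          (favg s fun v => K.W v (K.P (K.U g (K.U w k)))) =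
            inner ℝ (K.W h (K.P (K.U g (K.P K.e)))) q}) := by
    refine closure_minimal ?_ isClosed_closure hy
    rintro _ ⟨k, rfl⟩
    exact image_closure_subset_closure_image (K.dual M).continuous ⟨k, K.dense_bdd k, rfl⟩
  obtain ⟨_, ⟨k, ⟨C, hC, hk⟩, rfl⟩, hyk⟩ := Metric.mem_closure_iff.1 hy' η hη
  obtain ⟨N, hN⟩ := K.exists_norm_favg_sub_fixProj_le M hΦ hC hk hη
  have hzero : K.famProj M (K.famCompl M k₀) = 0 := by
    rw [← norm_eq_zero, ← sq_eq_zero_iff, ← inner_dual_self, real_inner_comm]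
    exact (Submodule.mem_orthogonal _ _).1 hk₀ _ (Submodule.le_topologicalClosure _ ⟨k₀, rfl⟩)
  have hlim := (hΦ.1.tendsto_favg_invProj UniformSpace.Completion.toComplₗᵢ (K.famW_mul M)
    (K.fam M k₀)).norm
  simp only [LinearIsometry.norm_map] at hlim
  rw [show invProj UniformSpace.Completion.toComplₗᵢ (K.famW M)
    (UniformSpace.Completion.toComplₗᵢ (K.fam M k₀)) = 0 from hzero, norm_zero] at hlim
  obtain ⟨j, hj, hjN⟩ := ((hlim.eventually (ge_mem_nhds hη)).and (eventually_ge_atTop N)).exists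
  refine ⟨j, K.dual M k, k₀, ?_, hj, hN j hjN⟩
  rw [dist_eq_norm] at hyk
  rw [hf, sub_right_comm, add_sub_cancel_right]
  exact hyk.le

/-- The mean of `⟪P (U g f), W h (P (U g f))⟫`, where `f = P e`, is at least `⟪e, f⟫ ^ 4`. -/
theorem inner_pow_four_le_mean (hΦ : IsTwoSidedFolner Φ) :
    inner ℝ K.e (K.P K.e) ^ 4 ≤ M.val fun γ =>
      inner ℝ (K.P (K.U γ.1 (K.P K.e))) (K.W γ.2 (K.P (K.U γ.1 (K.P K.e)))) := by
  have hp := K.sq_inner_le_mean M hΦ.1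
  have hbe := K.bdd_inner_PU K.e (K.P K.e)
  set f := K.P K.e with hf
  set p := inner ℝ K.e f
  refine le_of_forall_pos_le_add fun ε hε => ?_
  obtain ⟨η, hη, rfl⟩ : ∃ η, 0 < η ∧ 5 * η = ε := ⟨ε / 5, by positivity, by ring⟩
  obtain ⟨j, d, k₀, hfd, hk₀, hd⟩ := K.exists_decomposition M hΦ f hη
  rw [← K.mean_inner_WPU_eq M (hΦ.1.1 j)]
  set H : BddFam M V := favg (Φ j) fun v => K.famW M v (K.fam M k₀) with hH
  have hHb := H.bdd_norm_sq
  have hHM : (M.val fun γ => ‖BddFam.eval γ H‖ ^ 2) ≤ η ^ 2 := by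
    rw [← BddFam.norm_sq]
    gcongr
  have hpt : ∀ γ : G × G, 2 * p ^ 2 * inner ℝ K.e (K.P (K.U γ.1 f)) +
      (-(p ^ 4 + 4 * η) + -η⁻¹ * ‖BddFam.eval γ H‖ ^ 2) ≤ inner ℝ (K.P (K.U γ.1 f))
        (K.W γ.2 (favg (Φ j) fun v => K.W v (K.P (K.U γ.1 f)))) := fun γ => by
    have h1 := K.inner_fixProj_sub_le (hΦ.1.1 j) (x := K.P (K.U γ.1 f))
      (d := K.P (K.U γ.1 d)) (r := K.P (K.U γ.1 k₀)) (t := K.P (K.U γ.1 (f - d - k₀)))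
      (by simp only [map_sub]; abel) ((K.norm_PU_le _ _).trans K.norm_P_e_le)
      ((K.norm_PU_le _ _).trans hfd) (hd γ.1) γ.2
    have h2 := sq_inner_le_inner_fixProj K.W K.W_e K.norm_e (K.P (K.U γ.1 f))
    have h3 : BddFam.eval γ H = favg (Φ j) fun v => K.W v (K.P (K.U γ.1 k₀)) :=
      K.eval_favg M _ _ _
    rw [← h3] at h1
    have h4 : 2 * ‖BddFam.eval γ H‖ ≤ η⁻¹ * ‖BddFam.eval γ H‖ ^ 2 + η := by
      have : η⁻¹ * ‖BddFam.eval γ H‖ ^ 2 + η - 2 * ‖BddFam.eval γ H‖ =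
          η⁻¹ * (‖BddFam.eval γ H‖ - η) ^ 2 := by
        field_simp
        ring
      have : 0 ≤ η⁻¹ * (‖BddFam.eval γ H‖ - η) ^ 2 := by positivity
      linarith
    nlinarith [sq_nonneg (inner ℝ K.e (K.P (K.U γ.1 f)) - p ^ 2)]
  have hb1 := (Bdd.const (-(p ^ 4 + 4 * η))).add (hHb.const_mul (-η⁻¹))
  have hb2 := (hbe.const_mul (2 * p ^ 2)).add hb1
  have hb3 : Bdd fun γ : G × G => inner ℝ (K.P (K.U γ.1 f))
      (K.W γ.2 (favg (Φ j) fun v => K.W v (K.P (K.U γ.1 f)))) :=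
    ⟨‖f‖ * ‖f‖, fun γ => (abs_real_inner_le_norm _ _).trans (mul_le_mul (K.norm_PU_le _ _)
      (((K.W γ.2).norm_map _).trans_le ((norm_favg_apply_le _ _ _).trans (K.norm_PU_le _ _)))
      (norm_nonneg _) (norm_nonneg _))⟩
  have hmain := M.mono hb2 hb3 hpt
  rw [M.add (hbe.const_mul _) hb1, M.add (Bdd.const _) (hHb.const_mul _), M.smul _ hbe, M.const,
    M.smul _ hHb] at hmain
  have h5 : η⁻¹ * (M.val fun γ => ‖BddFam.eval γ H‖ ^ 2) ≤ η := by
    rw [inv_mul_le_iff₀ hη, ← sq]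
    exact hHM
  nlinarith [sq_nonneg p]

end KoopmanSystem

section Concrete

variable {X : Type*} [MeasurableSpace X] {μ : Measure X}

/-- Multiplication by the indicator function of `A`, as an operator on `L²`. -/
noncomputable def indicatorCLM (μ : Measure X) {A : Set X} (hA : MeasurableSet A) :
    Lp ℝ 2 μ →L[ℝ] Lp ℝ 2 μ :=
  LinearMap.mkContinuous
    { toFun := fun x => ((Lp.memLp x).indicator hA).toLp
      map_add' := fun x y => by
        rw [← MemLp.toLp_add]
        refine MemLp.toLp_congr _ _ ?_
        filter_upwards [Lp.coeFn_add x y] with a ha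
        by_cases h : a ∈ A
        · simpa [h] using ha
        · simp [h]
      map_smul' := fun c x => by
        rw [RingHom.id_apply, ← MemLp.toLp_const_smul]
        refine MemLp.toLp_congr _ _ ?_
        filter_upwards [Lp.coeFn_smul c x] with a ha
        by_cases h : a ∈ A
        · simpa [h] using ha
        · simp [h] }
    1 fun x => by
      rw [one_mul]
      refine Lp.norm_le_norm_of_ae_le ?_
      filter_upwards [((Lp.memLp x).indicator hA).coeFn_toLp] with a ha
      exact (congrArg _ ha).trans_le (norm_indicator_le_norm_self _ _)

theorem coeFn_indicatorCLM {A : Set X} (hA : MeasurableSet A) (x : Lp ℝ 2 μ) :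
    indicatorCLM μ hA x =ᵐ[μ] A.indicator x :=
  ((Lp.memLp x).indicator hA).coeFn_toLp

theorem norm_indicatorCLM_le {A : Set X} (hA : MeasurableSet A) (x : Lp ℝ 2 μ) :
    ‖indicatorCLM μ hA x‖ ≤ ‖x‖ := by
  refine Lp.norm_le_norm_of_ae_le ?_
  filter_upwards [coeFn_indicatorCLM hA x] with a ha
  rw [ha]
  exact norm_indicator_le_norm_self _ _

theorem inner_indicatorCLM_left {A : Set X} (hA : MeasurableSet A) (x y : Lp ℝ 2 μ) :
    inner ℝ (indicatorCLM μ hA x) y = inner ℝ x (indicatorCLM μ hA y) := by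
  rw [L2.inner_def, L2.inner_def]
  refine integral_congr_ae ?_
  filter_upwards [coeFn_indicatorCLM hA x, coeFn_indicatorCLM hA y] with a hx hy
  by_cases h : a ∈ A <;> simp [h, hx, hy]

/-- The Koopman operator of a measure-preserving map. -/
noncomputable def koopman {τ : X → X} (hτ : MeasurePreserving τ μ μ) :
    Lp ℝ 2 μ →ₗᵢ[ℝ] Lp ℝ 2 μ :=
  Lp.compMeasurePreservingₗᵢ ℝ τ hτ

theorem coeFn_koopman {τ : X → X} (hτ : MeasurePreserving τ μ μ) (x : Lp ℝ 2 μ) :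
    koopman hτ x =ᵐ[μ] x ∘ τ :=
  Lp.coeFn_compMeasurePreserving x hτ

theorem koopman_koopman {τ σ ρ : X → X} (hτ : MeasurePreserving τ μ μ)
    (hσ : MeasurePreserving σ μ μ) (hρ : MeasurePreserving ρ μ μ) (h : ∀ x, ρ x = τ (σ x))
    (x : Lp ℝ 2 μ) : koopman hσ (koopman hτ x) = koopman hρ x := by
  refine Lp.ext ?_
  filter_upwards [coeFn_koopman hσ (koopman hτ x), coeFn_koopman hρ x,
    hσ.quasiMeasurePreserving.ae (coeFn_koopman hτ x)] with a h1 h2 h3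
  rw [h1, h2, Function.comp_apply, h3, Function.comp_apply, Function.comp_apply, h]

theorem koopman_comm {τ σ : X → X} (hτ : MeasurePreserving τ μ μ) (hσ : MeasurePreserving σ μ μ)
    (h : ∀ x, τ (σ x) = σ (τ x)) (x : Lp ℝ 2 μ) :
    koopman hσ (koopman hτ x) = koopman hτ (koopman hσ x) :=
  (koopman_koopman hτ hσ (hτ.comp hσ) (fun _ => rfl) x).trans
    (koopman_koopman hσ hτ (hτ.comp hσ) h x).symm

theorem koopman_one {G : Type*} [Group G] {T : G → X → X} (hTm : ∀ g, MeasurePreserving (T g) μ μ)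
    (hTact : ∀ g h x, T (g * h) x = T g (T h x)) (x : Lp ℝ 2 μ) : koopman (hTm 1) x = x :=
  (koopman (hTm 1)).injective
    (koopman_koopman (hTm 1) (hTm 1) (hTm 1) (fun y => by rw [← hTact, one_mul]) x)

theorem koopman_mul_eq {τ : X → X} (hτ : MeasurePreserving τ μ μ) {a b c : Lp ℝ 2 μ}
    (h : c =ᵐ[μ] a * b) : koopman hτ c =ᵐ[μ] koopman hτ a * koopman hτ b := by
  filter_upwards [coeFn_koopman hτ a, coeFn_koopman hτ b, coeFn_koopman hτ c,
    hτ.quasiMeasurePreserving.ae h] with x h1 h2 h3 h4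
  rw [Pi.mul_apply, h1, h2, h3, Function.comp_apply, h4]
  rfl

theorem indicatorCLM_mul_eq {A : Set X} (hA : MeasurableSet A) {a b c : Lp ℝ 2 μ}
    (h : c =ᵐ[μ] a * b) : indicatorCLM μ hA c =ᵐ[μ] indicatorCLM μ hA a * b := by
  filter_upwards [coeFn_indicatorCLM hA a, coeFn_indicatorCLM hA c, h] with x h1 h2 h3
  rw [Pi.mul_apply, h1, h2]
  by_cases hx : x ∈ A <;> simp [hx, h3]

theorem ae_abs_koopman_le {τ : X → X} (hτ : MeasurePreserving τ μ μ) {a : Lp ℝ 2 μ} {C : ℝ}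
    (h : ∀ᵐ x ∂μ, |a x| ≤ C) : ∀ᵐ x ∂μ, |koopman hτ a x| ≤ C := by
  filter_upwards [coeFn_koopman hτ a, hτ.quasiMeasurePreserving.ae h] with x h1 h2
  rwa [h1]

theorem ae_abs_indicatorCLM_le {A : Set X} (hA : MeasurableSet A) {a : Lp ℝ 2 μ} {C : ℝ}
    (h : ∀ᵐ x ∂μ, |a x| ≤ C) : ∀ᵐ x ∂μ, |indicatorCLM μ hA a x| ≤ C := by
  filter_upwards [coeFn_indicatorCLM hA a, h] with x h1 h2
  rw [h1]
  exact (norm_indicator_le_norm_self (a : X → ℝ) x).trans h2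

theorem ae_abs_favg_le {ι : Type*} (s : Finset ι) {a : ι → Lp ℝ 2 μ} {C : ℝ} (hC : 0 ≤ C)
    (h : ∀ i, ∀ᵐ x ∂μ, |a i x| ≤ C) : ∀ᵐ x ∂μ, |favg s a x| ≤ C := by
  have hs : ⇑(∑ i ∈ s, a i) =ᵐ[μ] ∑ i ∈ s, ⇑(a i) := by
    classical
    induction s using Finset.induction_on with
    | empty => simpa using Lp.coeFn_zero ℝ 2 μ
    | insert i s hi ih =>
      rw [Finset.sum_insert hi, Finset.sum_insert hi]
      exact (Lp.coeFn_add _ _).trans (EventuallyEq.rfl.add ih)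
  have hall : ∀ᵐ x ∂μ, ∀ i ∈ s, |a i x| ≤ C := (ae_ball_iff s.countable_toSet).2 fun i _ => h i
  filter_upwards [Lp.coeFn_smul (s.card : ℝ)⁻¹ (∑ i ∈ s, a i), hs, hall] with x h1 h2 h3
  have : favg s a x = favg s fun i => a i x := by
    rw [favg, h1, Pi.smul_apply, h2, Finset.sum_apply, favg]
  rw [this]
  exact norm_favg_le (φ := fun i => a i x) hC h3

theorem dense_ae_bounded (μ : Measure X) :
    Dense {k : Lp ℝ 2 μ | ∃ C, 0 ≤ C ∧ ∀ᵐ x ∂μ, |k x| ≤ C} := by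
  refine (Lp.simpleFunc.denseRange (p := 2) (μ := μ) (E := ℝ) (by simp)).mono ?_
  rintro _ ⟨k, rfl⟩
  obtain ⟨C, hC⟩ := (Lp.simpleFunc.toSimpleFunc k).exists_forall_norm_le
  refine ⟨|C|, abs_nonneg C, ?_⟩
  filter_upwards [Lp.simpleFunc.toSimpleFunc_eq_toFun k] with x hx
  rw [← hx]
  exact (hC x).trans (le_abs_self C)

theorem exists_mul_bounded {y z : Lp ℝ 2 μ} {C : ℝ} (hz : ∀ᵐ x ∂μ, |z x| ≤ C) :
    ∃ q : Lp ℝ 2 μ, ‖q‖ ≤ C * ‖y‖ ∧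
      ∀ a c : Lp ℝ 2 μ, c =ᵐ[μ] a * y → inner ℝ c z = inner ℝ a q := by
  have hb : ∀ᵐ x ∂μ, ‖(y * z : X → ℝ) x‖ ≤ C * ‖y x‖ := by
    filter_upwards [hz] with x hx
    rw [Pi.mul_apply, norm_mul, mul_comm]
    exact mul_le_mul_of_nonneg_right hx (norm_nonneg _)
  have hq : MemLp (y * z : X → ℝ) 2 μ := (Lp.memLp y).of_le_mul
    ((Lp.aestronglyMeasurable y).mul (Lp.aestronglyMeasurable z)) hb
  refine ⟨hq.toLp, Lp.norm_le_mul_norm_of_ae_le_mul ?_, fun a c hc => ?_⟩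
  · filter_upwards [hq.coeFn_toLp, hb] with x h1 h2
    rwa [h1]
  · rw [L2.inner_def, L2.inner_def]
    refine integral_congr_ae ?_
    filter_upwards [hq.coeFn_toLp, hc] with x h1 h2
    simp only [h1, h2, Pi.mul_apply, RCLike.inner_apply, conj_trivial]
    ring

theorem coeFn_indicatorCLM_of_eq_indicator {A B : Set X} (hA : MeasurableSet A) {x : Lp ℝ 2 μ}
    (h : x =ᵐ[μ] B.indicator 1) : indicatorCLM μ hA x =ᵐ[μ] (A ∩ B).indicator 1 := by
  filter_upwards [coeFn_indicatorCLM hA x, h] with a h1 h2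
  rw [h1, ← Set.indicator_indicator]
  by_cases ha : a ∈ A <;> simp [ha, h2]

theorem coeFn_koopman_of_eq_indicator {B : Set X} {τ : X → X} (hτ : MeasurePreserving τ μ μ)
    {x : Lp ℝ 2 μ} (h : x =ᵐ[μ] B.indicator 1) : koopman hτ x =ᵐ[μ] (τ ⁻¹' B).indicator 1 := by
  filter_upwards [coeFn_koopman hτ x, hτ.quasiMeasurePreserving.ae h] with a h1 h2
  rw [h1, Function.comp_apply, h2]
  rfl

theorem inner_eq_measure_inter {B C : Set X} (hB : MeasurableSet B) (hC : MeasurableSet C)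
    {x y : Lp ℝ 2 μ} (hx : x =ᵐ[μ] B.indicator 1) (hy : y =ᵐ[μ] C.indicator 1) :
    inner ℝ x y = (μ (B ∩ C)).toReal := by
  rw [L2.inner_def, ← Measure.real, ← integral_indicator_one (hB.inter hC)]
  refine integral_congr_ae ?_
  filter_upwards [hx, hy] with a h1 h2
  rw [h1, h2]
  by_cases hb : a ∈ B <;> by_cases hc : a ∈ C <;> simp [hb, hc]

theorem ae_act_one_mem_iff [IsFiniteMeasure μ] {G : Type*} [Group G] {T : G → X → X}
    (hTm : ∀ g, MeasurePreserving (T g) μ μ) (hTact : ∀ g h x, T (g * h) x = T g (T h x))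
    {A : Set X} (hA : MeasurableSet A) : ∀ᵐ x ∂μ, T 1 x ∈ A ↔ x ∈ A := by
  have h : indicatorConstLp 2 hA (measure_ne_top μ A) (1 : ℝ) =ᵐ[μ] A.indicator 1 :=
    indicatorConstLp_coeFn
  have h' := coeFn_koopman_of_eq_indicator (hTm 1) h
  rw [koopman_one hTm hTact] at h'
  filter_upwards [h, h'] with x h1 h2
  rw [h1] at h2
  by_cases hx : x ∈ A <;> by_cases hTx : T 1 x ∈ A <;> simp [hx, hTx] at h2 ⊢

theorem measure_returns_inv [IsFiniteMeasure μ] {G : Type*} [Group G] {T S : G → X → X}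
    (hTm : ∀ g, MeasurePreserving (T g) μ μ) (hSm : ∀ g, MeasurePreserving (S g) μ μ)
    (hTact : ∀ g h x, T (g * h) x = T g (T h x)) (hSact : ∀ g h x, S (g * h) x = S g (S h x))
    (hcomm : ∀ g h x, T g (S h x) = S h (T g x)) {A : Set X} (hA : MeasurableSet A) (g h : G) :
    μ ((A ∩ T g⁻¹ ⁻¹' A) ∩ S h⁻¹ ⁻¹' (A ∩ T g⁻¹ ⁻¹' A)) =
      μ ((A ∩ T g ⁻¹' A) ∩ S h ⁻¹' (A ∩ T g ⁻¹' A)) := by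
  have hB : ∀ a, MeasurableSet (A ∩ T a ⁻¹' A) := fun a => hA.inter ((hTm a).measurable hA)
  rw [← ((hTm g).comp (hSm h)).measure_preimage
    ((hB _).inter ((hSm _).measurable (hB _))).nullMeasurableSet]
  refine measure_congr ?_
  have hT1 := ae_act_one_mem_iff hTm hTact hA
  have hS1 := ae_act_one_mem_iff hSm hSact hA
  filter_upwards [hS1, (hSm h).quasiMeasurePreserving.ae hT1, (hTm g).quasiMeasurePreserving.ae hS1,
    (hSm 1).quasiMeasurePreserving.ae hT1] with x h1 h2 h3 h4
  have e1 : T g⁻¹ (T g (S h x)) = T 1 (S h x) := by rw [← hTact, inv_mul_cancel]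
  have e2 : S h⁻¹ (T g (S h x)) = S 1 (T g x) := by rw [hcomm, ← hSact, inv_mul_cancel]
  have e3 : T g⁻¹ (S 1 (T g x)) = T 1 (S 1 x) := by
    rw [← hcomm, ← hTact, inv_mul_cancel]
  refine propext ?_
  change ((T g (S h x) ∈ A ∧ T g⁻¹ (T g (S h x)) ∈ A) ∧ S h⁻¹ (T g (S h x)) ∈ A ∧
    T g⁻¹ (S h⁻¹ (T g (S h x))) ∈ A) ↔ ((x ∈ A ∧ T g x ∈ A) ∧ S h x ∈ A ∧ T g (S h x) ∈ A)
  rw [e2, e1, e3, h4, h3, h2, h1]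
  tauto

variable {G : Type*} [Group G] [IsProbabilityMeasure μ] {T S : G → X → X}

/-- The Hilbert space data of two commuting measure-preserving actions and a measurable set. -/
noncomputable def koopmanSystem
    (hTm : ∀ g, MeasurePreserving (T g) μ μ) (hSm : ∀ g, MeasurePreserving (S g) μ μ)
    (hTact : ∀ g h x, T (g * h) x = T g (T h x)) (hSact : ∀ g h x, S (g * h) x = S g (S h x))
    (hcomm : ∀ g h x, T g (S h x) = S h (T g x)) {A : Set X} (hA : MeasurableSet A) :
    KoopmanSystem G (Lp ℝ 2 μ) where
  U g := koopman (hTm g)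
  W g := koopman (hSm g)
  P := indicatorCLM μ hA
  e := Lp.const 2 μ 1
  U_mul a b x := (koopman_koopman _ _ _ (hTact a b) x).symm
  W_mul a b x := (koopman_koopman _ _ _ (hSact a b) x).symm
  U_one := koopman_one hTm hTact
  W_one := koopman_one hSm hSact
  inner_P_left := inner_indicatorCLM_left hA
  norm_P_le := norm_indicatorCLM_le hA
  U_e g := rfl
  W_e g := rfl
  norm_e := by simp [Lp.norm_const']
  dense_bdd := by
    refine (dense_ae_bounded μ).mono ?_
    rintro k ⟨C, hC, hk⟩
    refine ⟨C, hC, fun w g s l => ?_⟩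
    have hz : ∀ᵐ x ∂μ, |(favg s fun v => koopman (hSm v)
        (indicatorCLM μ hA (koopman (hTm g) (koopman (hTm w) k)))) x| ≤ C :=
      ae_abs_favg_le s hC fun v => ae_abs_koopman_le _ <| ae_abs_indicatorCLM_le _ <|
        ae_abs_koopman_le _ <| ae_abs_koopman_le _ hk
    obtain ⟨q, hq, hqi⟩ := exists_mul_bounded (y := koopman (hTm g) l) hz
    rw [(koopman (hTm g)).norm_map] at hq
    refine ⟨q, hq, fun h => hqi _ _ ?_⟩
    have h1 : koopman (hSm h) (koopman (hTm g) (koopman (hSm h⁻¹) l)) = koopman (hTm g) l := by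
      rw [koopman_comm (hTm g) (hSm h) (hcomm g h),
        koopman_koopman (hSm h⁻¹) (hSm h) (hSm 1) (fun x => by rw [← hSact, inv_mul_cancel]),
        koopman_one hSm hSact]
    conv_rhs => rw [← h1]
    refine koopman_mul_eq _ (indicatorCLM_mul_eq hA (koopman_mul_eq _ ?_))
    set y := koopman (hSm h⁻¹) l
    have h3 : y =ᵐ[μ] (Lp.const 2 μ (1 : ℝ) : Lp ℝ 2 μ) * y := by
      filter_upwards [Lp.coeFn_const 2 μ (1 : ℝ)] with x hx
      rw [Pi.mul_apply, hx, Function.const_apply, one_mul]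
    exact indicatorCLM_mul_eq hA h3

theorem inner_koopmanSystem
    (hTm : ∀ g, MeasurePreserving (T g) μ μ) (hSm : ∀ g, MeasurePreserving (S g) μ μ)
    (hTact : ∀ g h x, T (g * h) x = T g (T h x)) (hSact : ∀ g h x, S (g * h) x = S g (S h x))
    (hcomm : ∀ g h x, T g (S h x) = S h (T g x)) {A : Set X} (hA : MeasurableSet A) :
    let K := koopmanSystem hTm hSm hTact hSact hcomm hA
    inner ℝ K.e (K.P K.e) = (μ A).toReal ∧ ∀ g h,
      inner ℝ (K.P (K.U g (K.P K.e))) (K.W h (K.P (K.U g (K.P K.e)))) =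
        (μ ((A ∩ T g ⁻¹' A) ∩ S h ⁻¹' (A ∩ T g ⁻¹' A))).toReal := by
  intro K
  have he : K.e =ᵐ[μ] Set.univ.indicator 1 := by
    filter_upwards [Lp.coeFn_const 2 μ (1 : ℝ)] with x hx
    rw [Set.indicator_univ]
    exact hx
  have hf : K.P K.e =ᵐ[μ] A.indicator 1 := by
    have := coeFn_indicatorCLM_of_eq_indicator hA he
    rwa [Set.inter_univ] at this
  have hF : ∀ g, K.P (K.U g (K.P K.e)) =ᵐ[μ] (A ∩ T g ⁻¹' A).indicator 1 := fun g =>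
    coeFn_indicatorCLM_of_eq_indicator hA (coeFn_koopman_of_eq_indicator (hTm g) hf)
  have hB : ∀ g, MeasurableSet (A ∩ T g ⁻¹' A) := fun g => hA.inter ((hTm g).measurable hA)
  refine ⟨?_, fun g h => ?_⟩
  · rw [inner_eq_measure_inter MeasurableSet.univ hA he hf, Set.univ_inter]
  · exact inner_eq_measure_inter (hB g) ((hSm h).measurable (hB g)) (hF g)
      (coeFn_koopman_of_eq_indicator (hSm h) (hF g))

end Concrete

section Syndetic

variable {Γ : Type*} [Group Γ]

theorem leftSyndetic_of_le_mean [DecidableEq Γ] {Ψ : ℕ → Finset Γ} (hΨ : IsLeftFolner Ψ)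
    {ψ : Γ → ℝ} (hψ : Bdd ψ) {c : ℝ} (h : ∀ M : LeftMean Γ, c ≤ M.val ψ) {ε : ℝ} (hε : 0 < ε) :
    LeftSyndetic {x | c - ε < ψ x} := by
  by_contra hS
  have hS' : ∀ n, ∃ x, ∀ g ∈ Ψ n, ψ (g * x) ≤ c - ε := fun n => by
    by_contra! hn
    refine hS ⟨(Ψ n).image (·⁻¹), fun x => ?_⟩
    obtain ⟨g, hg, hgx⟩ := hn x
    exact ⟨g⁻¹, Finset.mem_image_of_mem _ hg, by simpa using hgx⟩
  choose x hx using hS'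
  obtain ⟨M, hM⟩ := exists_leftMean hΨ x
  linarith [hM ψ _ hψ hx, h M]

theorem LeftSyndetic.rightSyndetic_of_inv_mem {S : Set Γ} (hS : LeftSyndetic S)
    (hinv : ∀ x ∈ S, x⁻¹ ∈ S) : RightSyndetic S := by
  classical
  obtain ⟨F, hF⟩ := hS
  refine ⟨F.image (·⁻¹), fun x => ?_⟩
  obtain ⟨g, hg, hgx⟩ := hF x⁻¹
  refine ⟨g⁻¹, Finset.mem_image_of_mem _ hg, ?_⟩
  simpa using hinv _ hgx

end Syndetic


/-- Corollary 4.10. For commuting measure-preserving actions `T, S` of a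
countable group `G` admitting a two-sided Følner sequence, on a standard probability space,
any measurable `A`, and any `ε > 0`, the set
`{(g,h) : μ((A ∩ T_g⁻¹A) ∩ S_h⁻¹(A ∩ T_g⁻¹A)) > μ(A)⁴ − ε}` is both left and right
syndetic in `G × G`. -/
theorem syndetic_multiple_recurrence
    {G : Type*} [Group G] [Countable G] [DecidableEq G]
    (hFol : ∃ Φ : ℕ → Finset G, IsTwoSidedFolner Φ)
    {X : Type*} [MeasurableSpace X] [StandardBorelSpace X]
    (μ : Measure X) [IsProbabilityMeasure μ]
    (T S : G → X → X)
    (hTm : ∀ g, MeasurePreserving (T g) μ μ)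
    (hSm : ∀ g, MeasurePreserving (S g) μ μ)
    (hTact : ∀ g h x, T (g * h) x = T g (T h x))
    (hSact : ∀ g h x, S (g * h) x = S g (S h x))
    (hcomm : ∀ g h x, T g (S h x) = S h (T g x))
    (A : Set X) (hA : MeasurableSet A) :
    ∀ ε : ℝ, 0 < ε →
      LeftSyndetic {p : G × G |
          (μ A).toReal ^ 4 - ε <
            (μ ((A ∩ T p.1 ⁻¹' A) ∩ S p.2 ⁻¹' (A ∩ T p.1 ⁻¹' A))).toReal} ∧
      RightSyndetic {p : G × G |
          (μ A).toReal ^ 4 - ε <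
            (μ ((A ∩ T p.1 ⁻¹' A) ∩ S p.2 ⁻¹' (A ∩ T p.1 ⁻¹' A))).toReal} := by
  intro ε hε
  obtain ⟨Φ, hΦ⟩ := hFol
  set ψ : G × G → ℝ := fun p =>
    (μ ((A ∩ T p.1 ⁻¹' A) ∩ S p.2 ⁻¹' (A ∩ T p.1 ⁻¹' A))).toReal
  obtain ⟨hA1, hA2⟩ := inner_koopmanSystem hTm hSm hTact hSact hcomm hA
  set K := koopmanSystem hTm hSm hTact hSact hcomm hA
  have hbdd : Bdd ψ := ⟨1, fun p => by
    rw [abs_of_nonneg ENNReal.toReal_nonneg]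
    exact measureReal_le_one⟩
  have hleft : LeftSyndetic {p : G × G | (μ A).toReal ^ 4 - ε < ψ p} := by
    refine leftSyndetic_of_le_mean (hΦ.1.prod hΦ.1) hbdd (fun M => ?_) hε
    have h := K.inner_pow_four_le_mean M hΦ
    simp only [hA1, hA2] at h
    exact h
  refine ⟨hleft, hleft.rightSyndetic_of_inv_mem fun p hp => ?_⟩
  have h : ψ p⁻¹ = ψ p :=
    congrArg ENNReal.toReal (measure_returns_inv hTm hSm hTact hSact hcomm hA p.1 p.2)
  exact lt_of_lt_of_eq hp h.symm
end

section
/- Let G be a countable group admitting a two-sided Følner sequence, let r ∈ ℕ, and suppose G × G × G = ⋃_{i=1}^r C_i. For (g, h, k) ∈ G³ and a = (a₁, a₂, a₃) ∈ G³, let (g,h,k)·a denote the eight-element configuration {(a₁,a₂,a₃), (ga₁,a₂,a₃), (a₁,ha₂,a₃), (a₁,a₂,ka₃), (ga₁,ha₂,a₃), (ga₁,a₂,ka₃), (a₁,ha₂,ka₃), (ga₁,ha₂,ka₃)}. Then the set {(g, h, k) ∈ G³ : there exist i with 1 ≤ i ≤ r and a ∈ G³ such that (g,h,k)·a ⊆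 C_i} is both left syndetic and right syndetic in G × G × G. -/
open MeasureTheory Filter

open scoped BigOperators

/-- The average of `q` over all products `k * l⁻¹` with `k, l ∈ K`. -/
noncomputable def energy {H : Type*} [Group H] (K : Finset H) (q : H → ℝ) : ℝ :=
  𝔼 p ∈ K ×ˢ K, q (p.1 * p.2⁻¹)

/-- The average of `q` over the right translate of `K` by `x`. -/
noncomputable def translateAvg {H : Type*} [Group H] (K : Finset H) (x : H) (q : H → ℝ) : ℝ :=
  𝔼 k ∈ K, q (k * x)

/-- The bilinear form on finitely supported weights with kernel `ψ (k * l⁻¹)`. -/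
noncomputable def kernelForm {G : Type*} [Group G] (ψ : G → ℝ) :
    (G →₀ ℝ) →ₗ[ℝ] (G →₀ ℝ) →ₗ[ℝ] ℝ :=
  Finsupp.linearCombination ℝ fun k => Finsupp.linearCombination ℝ fun l => ψ (k * l⁻¹)

/-- Real positive definite functions on `G` bounded by `1`. -/
def posDefFunctions (G : Type*) [Group G] : Set (G → ℝ) :=
  {ψ | (∀ g, |ψ g| ≤ 1) ∧ (∀ g, ψ g⁻¹ = ψ g) ∧ ∀ σ, 0 ≤ kernelForm ψ σ σ}

/-- Functions on `G × H` which are positive definite in the first variable and belong to `𝒬` in the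
second one. -/
def prodClass (G : Type*) [Group G] {H : Type*} (𝒬 : Set (H → ℝ)) : Set (G × H → ℝ) :=
  {Ψ | (∀ y, (fun g => Ψ (g, y)) ∈ posDefFunctions G) ∧ ∀ g, (fun y => Ψ (g, y)) ∈ 𝒬}

/-- The averages of `q` over translates of the sets `K i` converge along `l`, uniformly in the
translate, to the infimum of the energies of `q`. -/
def AveragesToEnergyInf {H ι : Type*} [Group H] (l : Filter ι) (K : ι → Finset H) (q : H → ℝ) :
    Prop :=
  ∃ c, (∀ i, c ≤ energy (K i) q) ∧ (∀ ε > 0, ∃ i, energy (K i) q < c + ε) ∧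
    ∀ ε > 0, ∀ᶠ i in l, ∀ x, |translateAvg (K i) x q - c| < ε

section kernelForm

variable {G : Type*} [Group G]

lemma kernelForm_single (ψ : G → ℝ) (k l : G) (a b : ℝ) :
    kernelForm ψ (Finsupp.single k a) (Finsupp.single l b) = a * (b * ψ (k * l⁻¹)) := by
  simp [kernelForm]

lemma kernelForm_apply (ψ : G → ℝ) (σ τ : G →₀ ℝ) :
    kernelForm ψ σ τ = ∑ k ∈ σ.support, ∑ l ∈ τ.support, σ k * (τ l * ψ (k * l⁻¹)) := by
  simp [kernelForm, Finsupp.linearCombination_apply, Finsupp.sum, LinearMap.sum_apply,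
    Finset.mul_sum]

lemma kernelForm_comm {ψ : G → ℝ} (hψ : ∀ g, ψ g⁻¹ = ψ g) (σ τ : G →₀ ℝ) :
    kernelForm ψ σ τ = kernelForm ψ τ σ := by
  rw [kernelForm_apply, kernelForm_apply, Finset.sum_comm]
  refine Finset.sum_congr rfl fun l _ => Finset.sum_congr rfl fun k _ => ?_
  rw [← hψ (k * l⁻¹), mul_inv_rev, inv_inv]
  ring

lemma kernelForm_mapDomain_mul_right (ψ : G → ℝ) (c d : G) (σ τ : G →₀ ℝ) :
    kernelForm ψ (σ.mapDomain (· * c)) (τ.mapDomain (· * d)) =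
      ∑ k ∈ σ.support, ∑ l ∈ τ.support, σ k * (τ l * ψ (k * c * (l * d)⁻¹)) := by
  rw [kernelForm, Finsupp.linearCombination_mapDomain, Finsupp.linearCombination_apply,
    Finsupp.sum, LinearMap.sum_apply]
  refine Finset.sum_congr rfl fun k _ => ?_
  rw [LinearMap.smul_apply, Function.comp_apply, Finsupp.linearCombination_mapDomain]
  simp [Finsupp.linearCombination_apply, Finsupp.sum, Finset.mul_sum]

lemma kernelForm_mapDomain_mul_right_self (ψ : G → ℝ) (c : G) (σ τ : G →₀ ℝ) :
    kernelForm ψ (σ.mapDomain (· * c)) (τ.mapDomain (· * c)) = kernelForm ψ σ τ := by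
  rw [kernelForm_mapDomain_mul_right, kernelForm_apply]
  refine Finset.sum_congr rfl fun k _ => Finset.sum_congr rfl fun l _ => ?_
  congr 3
  group

lemma kernelForm_le_half_add {ψ : G → ℝ} (hψ : ψ ∈ posDefFunctions G) (σ τ : G →₀ ℝ) :
    kernelForm ψ σ τ ≤ (kernelForm ψ σ σ + kernelForm ψ τ τ) / 2 := by
  have := hψ.2.2 (σ - τ)
  simp only [map_sub, LinearMap.sub_apply] at this
  rw [kernelForm_comm hψ.2.1 τ σ] at this
  linarith

lemma isClosed_posDefFunctions : IsClosed (posDefFunctions G) := by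
  simp only [posDefFunctions, Set.ofPred_and, Set.ofPred_forall, kernelForm_apply]
  refine .inter (isClosed_iInter fun g => isClosed_le (by fun_prop) (by fun_prop))
    (.inter (isClosed_iInter fun g => isClosed_eq (by fun_prop) (by fun_prop))
      (isClosed_iInter fun σ => isClosed_le (by fun_prop) (by fun_prop)))

lemma kernelForm_add_smul (ψ φ : G → ℝ) (a b : ℝ) (σ τ : G →₀ ℝ) :
    kernelForm (a • ψ + b • φ) σ τ = a * kernelForm ψ σ τ + b * kernelForm φ σ τ := by
  simp only [kernelForm_apply, Finset.mul_sum, ← Finset.sum_add_distrib]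
  refine Finset.sum_congr rfl fun l _ => Finset.sum_congr rfl fun k _ => ?_
  simp only [Pi.add_apply, Pi.smul_apply, smul_eq_mul]
  ring

lemma convex_posDefFunctions : Convex ℝ (posDefFunctions G) := by
  rintro ψ ⟨hψ1, hψ2, hψ3⟩ φ ⟨hφ1, hφ2, hφ3⟩ a b ha hb hab
  refine ⟨fun g => ?_, fun g => by simp [hψ2, hφ2], fun σ => ?_⟩
  · have h1 := abs_le.1 (hψ1 g)
    have h2 := abs_le.1 (hφ1 g)
    simp only [Pi.add_apply, Pi.smul_apply, smul_eq_mul]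
    rw [abs_le]
    constructor <;> nlinarith
  · rw [kernelForm_add_smul]
    have := hψ3 σ
    have := hφ3 σ
    positivity

lemma isClosed_prodClass {H : Type*} {𝒬 : Set (H → ℝ)} (h𝒬 : IsClosed 𝒬) :
    IsClosed (prodClass G 𝒬) := by
  simp only [prodClass, Set.ofPred_and, Set.ofPred_forall]
  exact .inter (isClosed_iInter fun y => isClosed_posDefFunctions.preimage (by fun_prop))
    (isClosed_iInter fun g => h𝒬.preimage (by fun_prop))

lemma convex_prodClass {H : Type*} {𝒬 : Set (H → ℝ)} (h𝒬 : Convex ℝ 𝒬) :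
    Convex ℝ (prodClass G 𝒬) := fun _ hΨ _ hΦ _ _ ha hb hab =>
  ⟨fun y => convex_posDefFunctions (hΨ.1 y) (hΦ.1 y) ha hb hab,
    fun g => h𝒬 (hΨ.2 g) (hΦ.2 g) ha hb hab⟩

end kernelForm

section averages

lemma Convex.expect_apply_mem {ι H : Type*} {𝒬 : Set (H → ℝ)} (h𝒬 : Convex ℝ 𝒬) {s : Finset ι}
    (hs : s.Nonempty) {q : ι → H → ℝ} (hq : ∀ i ∈ s, q i ∈ 𝒬) :
    (fun y => 𝔼 i ∈ s, q i y) ∈ 𝒬 := by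
  have hs' : (s.card : ℝ) ≠ 0 := by exact_mod_cast hs.card_ne_zero
  convert h𝒬.sum_mem (t := s) (w := fun _ => (s.card : ℝ)⁻¹) (z := q) (fun _ _ => by positivity)
    (by simp [hs']) hq using 1
  ext y
  simp [Finset.expect_eq_sum_div_card, Finset.sum_apply, ← Finset.mul_sum, div_eq_inv_mul]

lemma sq_expect_le_expect_sq {ι : Type*} (s : Finset ι) (f : ι → ℝ) :
    (𝔼 i ∈ s, f i) ^ 2 ≤ 𝔼 i ∈ s, f i ^ 2 := by
  simp only [Finset.expect_eq_sum_div_card]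
  exact sum_div_card_sq_le_sum_sq_div_card

variable {G H : Type*} [Group G] [Group H]

lemma energy_mono {K : Finset H} {p q : H → ℝ} (h : ∀ y, p y ≤ q y) : energy K p ≤ energy K q :=
  Finset.expect_le_expect fun _ _ => h _

lemma energy_product (K : Finset G) (L : Finset H) (Ψ : G × H → ℝ) :
    energy (K ×ˢ L) Ψ = energy L fun y => energy K fun g => Ψ (g, y) := by
  simp only [energy, Finset.expect_product, Prod.mk_mul_mk,
    Prod.inv_mk]
  rw [Finset.expect_comm]
  refine Finset.expect_congr rfl fun l _ => ?_
  rw [Finset.expect_congr rfl fun k _ => Finset.expect_comm K L _, Finset.expect_comm]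

lemma translateAvg_product (K : Finset G) (L : Finset H) (x : G × H) (Ψ : G × H → ℝ) :
    translateAvg (K ×ˢ L) x Ψ =
      translateAvg L x.2 fun y => translateAvg K x.1 fun g => Ψ (g, y) := by
  simp only [translateAvg, Finset.expect_product]
  rw [Finset.expect_comm]
  rfl

end averages

section folner

variable {G : Type*} [Group G] [DecidableEq G]

lemma abs_expect_mul_left_sub_le {Φ : Finset G} (hΦ : Φ.Nonempty) {φ : G → ℝ} {M : ℝ}
    (hφ : ∀ g, |φ g| ≤ M) (k : G) :
    |𝔼 c ∈ Φ, φ (k * c) - 𝔼 c ∈ Φ, φ c| ≤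
      2 * M * (1 - ((Φ ∩ Φ.image (k * ·)).card : ℝ) / (Φ.card : ℝ)) := by
  have hpos : (0 : ℝ) < Φ.card := by exact_mod_cast hΦ.card_pos
  have hinj : Function.Injective (k * ·) := mul_right_injective k
  set Ψ := Φ.image (k * ·)
  have hcard : Ψ.card = Φ.card := Finset.card_image_of_injective _ hinj
  have hsum : ∑ c ∈ Φ, φ (k * c) = ∑ c ∈ Ψ, φ c := by
    rw [Finset.sum_image hinj.injOn]
  have h1 := Finset.sum_inter_add_sum_sdiff Φ Ψ φ
  have h2 := Finset.sum_inter_add_sum_sdiff Ψ Φ φ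
  have c1 := Finset.card_inter_add_card_sdiff Φ Ψ
  have c2 := Finset.card_inter_add_card_sdiff Ψ Φ
  rw [Finset.inter_comm] at h2 c2
  have b (s : Finset G) : |∑ c ∈ s, φ c| ≤ s.card * M := by
    refine (Finset.abs_sum_le_sum_abs _ _).trans ?_
    simpa using Finset.sum_le_card_nsmul s _ M fun c _ => hφ c
  have b1 := b (Φ \ Ψ)
  have b2 := b (Ψ \ Φ)
  have c1' : ((Φ ∩ Ψ).card : ℝ) + (Φ \ Ψ).card = Φ.card := by exact_mod_cast c1
  have c2' : ((Φ ∩ Ψ).card : ℝ) + (Ψ \ Φ).card = Φ.card := by exact_mod_cast c2.trans hcard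
  rw [Finset.expect_eq_sum_div_card, Finset.expect_eq_sum_div_card, hsum, ← sub_div, abs_div,
    abs_of_pos hpos, div_le_iff₀ hpos, ← h1, ← h2, add_sub_add_left_eq_sub]
  have e : 2 * M * (1 - ((Φ ∩ Ψ).card : ℝ) / Φ.card) * Φ.card =
      (Ψ \ Φ).card * M + (Φ \ Ψ).card * M := by
    field_simp
    linear_combination (-M) * c1' - M * c2'
  rw [e]
  exact (abs_sub _ _).trans (add_le_add b2 b1)

lemma IsLeftFolner.tendsto_defect {Φ : ℕ → Finset G} (hΦ : IsLeftFolner Φ) (M : ℝ) (k : G) :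
    Tendsto (fun n => 2 * M * (1 - ((Φ n ∩ (Φ n).image (k * ·)).card : ℝ) / ((Φ n).card : ℝ)))
      atTop (nhds 0) := by
  simpa using ((hΦ.2 k).const_sub 1).const_mul (2 * M)

lemma abs_expect_le_of_forall {ι : Type*} {s : Finset ι} (hs : s.Nonempty) {f : ι → ℝ} {M : ℝ}
    (hf : ∀ i, |f i| ≤ M) : |𝔼 i ∈ s, f i| ≤ M :=
  (Finset.abs_expect_le _ _).trans (Finset.expect_le hs fun i _ => hf i)

lemma IsLeftFolner.tendsto_expect_expect_sub_energy {Φ : ℕ → Finset G} (hΦ : IsLeftFolner Φ)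
    {ψ : G → ℝ} (hψ : ∀ g, |ψ g| ≤ 1) (k l : G) :
    Tendsto (fun n => 𝔼 c ∈ Φ n, 𝔼 d ∈ Φ n, ψ (k * c * (l * d)⁻¹) - energy (Φ n) ψ)
      atTop (nhds 0) := by
  have hlim := (hΦ.tendsto_defect 1 k).add (hΦ.tendsto_defect 1 l)
  rw [add_zero] at hlim
  refine squeeze_zero_norm (fun n => ?_) hlim
  have h1 := abs_expect_mul_left_sub_le (hΦ.1 n) (φ := fun c => 𝔼 d ∈ Φ n, ψ (c * (l * d)⁻¹))
    (M := 1) (fun c => abs_expect_le_of_forall (hΦ.1 n) fun d => hψ _) k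
  have h2 := abs_expect_mul_left_sub_le (hΦ.1 n) (φ := fun d => 𝔼 c ∈ Φ n, ψ (c * d⁻¹))
    (M := 1) (fun c => abs_expect_le_of_forall (hΦ.1 n) fun d => hψ _) l
  rw [Finset.expect_comm (Φ n) (Φ n) fun c d => ψ (c * (l * d)⁻¹)] at h1
  rw [energy, Finset.expect_product, Finset.expect_comm (Φ n) (Φ n) fun c d => ψ (c * d⁻¹),
    Real.norm_eq_abs]
  exact (abs_sub_le _ _ _).trans (add_le_add h1 h2)

lemma IsLeftFolner.eventually_energy_lt {Φ : ℕ → Finset G} (hΦ : IsLeftFolner Φ) {ψ : G → ℝ}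
    (hψ : ψ ∈ posDefFunctions G) {σ : G →₀ ℝ} (hσ : ∑ k ∈ σ.support, σ k = 1) {ε : ℝ}
    (hε : 0 < ε) : ∀ᶠ n in atTop, energy (Φ n) ψ < kernelForm ψ σ σ + ε := by
  have hlim : Tendsto (fun n => ∑ k ∈ σ.support, ∑ l ∈ σ.support, σ k * (σ l *
      (𝔼 c ∈ Φ n, 𝔼 d ∈ Φ n, ψ (k * c * (l * d)⁻¹) - energy (Φ n) ψ))) atTop (nhds 0) := by
    have := tendsto_finsetSum σ.support fun k _ => tendsto_finsetSum σ.support fun l _ =>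
      ((hΦ.tendsto_expect_expect_sub_energy hψ.1 k l).const_mul (σ l)).const_mul (σ k)
    simpa using this
  filter_upwards [hlim.eventually (lt_mem_nhds (neg_lt_zero.2 hε))] with n hn
  have hle : 𝔼 c ∈ Φ n, 𝔼 d ∈ Φ n,
      kernelForm ψ (σ.mapDomain (· * c)) (σ.mapDomain (· * d)) ≤ kernelForm ψ σ σ := by
    refine Finset.expect_le (hΦ.1 n) fun c _ => Finset.expect_le (hΦ.1 n) fun d _ => ?_
    refine (kernelForm_le_half_add hψ _ _).trans_eq ?_
    simp only [kernelForm_mapDomain_mul_right_self, add_self_div_two]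
  simp only [kernelForm_mapDomain_mul_right, Finset.expect_sum_comm, ← Finset.mul_expect] at hle
  simp only [mul_sub, Finset.sum_sub_distrib] at hn
  have : ∑ k ∈ σ.support, ∑ l ∈ σ.support, σ k * (σ l * energy (Φ n) ψ) = energy (Φ n) ψ := by
    simp only [← Finset.mul_sum, ← Finset.sum_mul, hσ, one_mul]
  linarith

lemma IsLeftFolner.exists_energy_inf {Φ : ℕ → Finset G} (hΦ : IsLeftFolner Φ) {ψ : G → ℝ}
    (hψ : ψ ∈ posDefFunctions G) :
    ∃ c, (∀ n, c ≤ energy (Φ n) ψ) ∧ Tendsto (fun n => energy (Φ n) ψ) atTop (nhds c) ∧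
      ∀ n x t, 0 < t →
        |translateAvg (Φ n) x ψ - c| ≤ (energy (Φ n) ψ - c) * (1 / (2 * t) + 1) + 2 * t := by
  let mass : (G →₀ ℝ) →ₗ[ℝ] ℝ := Finsupp.linearCombination ℝ fun _ => (1 : ℝ)
  have hmass (σ : G →₀ ℝ) : mass σ = ∑ k ∈ σ.support, σ k := by
    simp [mass, Finsupp.linearCombination_apply, Finsupp.sum]
  let w (n : ℕ) (x : G) : G →₀ ℝ := ((Φ n).card : ℝ)⁻¹ • ∑ k ∈ Φ n, Finsupp.single (k * x) 1
  have hcard (n : ℕ) : ((Φ n).card : ℝ) ≠ 0 := by exact_mod_cast (hΦ.1 n).card_ne_zero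
  have hw (n : ℕ) (x : G) : mass (w n x) = 1 := by simp [mass, w, hcard]
  have hww (n : ℕ) (x : G) : kernelForm ψ (w n x) (w n x) = energy (Φ n) ψ := by
    simp [w, kernelForm_single, energy, Finset.expect_eq_sum_div_card,
      LinearMap.sum_apply, div_eq_inv_mul, Finset.mul_sum, Finset.sum_product, mul_assoc]
    exact Finset.sum_comm
  have hw1 (n : ℕ) (x : G) :
      kernelForm ψ (w n x) (Finsupp.single 1 1) = translateAvg (Φ n) x ψ := by
    simp [w, kernelForm_single, translateAvg, Finset.expect_eq_sum_div_card,
      LinearMap.sum_apply, div_eq_inv_mul]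
  clear_value w
  let S : Set ℝ := (fun σ => kernelForm ψ σ σ) '' {σ | mass σ = 1}
  have hbdd : BddBelow S := ⟨0, by rintro _ ⟨σ, -, rfl⟩; exact hψ.2.2 σ⟩
  have hne : S.Nonempty := ⟨_, w 0 1, hw 0 1, rfl⟩
  have hinf (σ : G →₀ ℝ) (hσ : mass σ = 1) : sInf S ≤ kernelForm ψ σ σ :=
    csInf_le hbdd ⟨σ, hσ, rfl⟩
  have hle (n : ℕ) : sInf S ≤ energy (Φ n) ψ := hww n 1 ▸ hinf _ (hw n 1)
  refine ⟨sInf S, hle, ?_, fun n x t ht => ?_⟩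
  · refine tendsto_order.2 ⟨fun a ha => .of_forall fun n => ha.trans_le (hle n), fun a ha => ?_⟩
    obtain ⟨_, ⟨σ, hσ, rfl⟩, hσa⟩ := exists_lt_of_csInf_lt hne ha
    filter_upwards [hΦ.eventually_energy_lt hψ ((hmass σ).symm.trans hσ) (sub_pos.2 hσa)]
      with n hn
    linarith
  · have key (s : ℝ) : sInf S ≤ (1 - s) ^ 2 * energy (Φ n) ψ +
        2 * s * (1 - s) * translateAvg (Φ n) x ψ + s ^ 2 * ψ 1 := by
      have h := hinf ((1 - s) • w n x + s • Finsupp.single 1 1)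
        (by rw [map_add, map_smul, map_smul, hw]; simp [mass])
      simp only [map_add, map_smul, LinearMap.add_apply, LinearMap.smul_apply, smul_eq_mul] at h
      rw [hww, kernelForm_comm hψ.2.1 (Finsupp.single 1 1), hw1, kernelForm_single, mul_inv_cancel]
        at h
      linarith
    have b1 : |energy (Φ n) ψ| ≤ 1 :=
      abs_expect_le_of_forall ((hΦ.1 n).product (hΦ.1 n)) fun p => hψ.1 _
    have b2 : |translateAvg (Φ n) x ψ| ≤ 1 := abs_expect_le_of_forall (hΦ.1 n) fun p => hψ.1 _
    have b3 := hψ.1 1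
    rw [abs_le] at b1 b2 b3
    have hb : energy (Φ n) ψ - 2 * translateAvg (Φ n) x ψ + ψ 1 ≤ 4 := by linarith
    have hb' := mul_le_mul_of_nonneg_left hb (sq_nonneg t)
    have k1 := key t
    have k2 := key (-t)
    have hD : (energy (Φ n) ψ - sInf S) * (1 / (2 * t) + 1) + 2 * t =
        ((energy (Φ n) ψ - sInf S) + 4 * t ^ 2) / (2 * t) + (energy (Φ n) ψ - sInf S) := by
      field_simp
      ring
    rw [hD]
    have h1 : energy (Φ n) ψ - translateAvg (Φ n) x ψ ≤
        ((energy (Φ n) ψ - sInf S) + 4 * t ^ 2) / (2 * t) := by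
      rw [le_div_iff₀ (by positivity)]
      nlinarith
    have h2 : translateAvg (Φ n) x ψ - energy (Φ n) ψ ≤
        ((energy (Φ n) ψ - sInf S) + 4 * t ^ 2) / (2 * t) := by
      rw [le_div_iff₀ (by positivity)]
      nlinarith
    have := hle n
    rw [abs_le]
    constructor <;> linarith

end folner

section product

lemma IsLeftFolner.averagesToEnergyInf {G : Type*} [Group G] [DecidableEq G] {Φ : ℕ → Finset G}
    (hΦ : IsLeftFolner Φ) {ψ : G → ℝ} (hψ : ψ ∈ posDefFunctions G) :
    AveragesToEnergyInf atTop Φ ψ := by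
  obtain ⟨c, hle, hlim, hest⟩ := hΦ.exists_energy_inf hψ
  refine ⟨c, hle, fun ε hε => (hlim.eventually_lt_const (by linarith)).exists, fun ε hε => ?_⟩
  have hlim' : Tendsto (fun n => (energy (Φ n) ψ - c) * (1 / (2 * (ε / 4)) + 1) + 2 * (ε / 4))
      atTop (nhds ((c - c) * (1 / (2 * (ε / 4)) + 1) + 2 * (ε / 4))) :=
    ((hlim.sub_const c).mul_const _).add_const _
  filter_upwards [hlim'.eventually_lt_const (show _ < ε by linarith)] with n hn x
  exact (hest n x _ (by positivity)).trans_lt hn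

lemma translateAvg_mono {H : Type*} [Group H] {K : Finset H} {x : H} {p q : H → ℝ}
    (h : ∀ y, p y ≤ q y) : translateAvg K x p ≤ translateAvg K x q :=
  Finset.expect_le_expect fun _ _ => h _

lemma le_of_translateAvg_approx {H ι : Type*} [Group H] {l : Filter ι} [l.NeBot]
    {K : ι → Finset H} {p q : H → ℝ} {c d : ℝ}
    (hp : ∀ ε > 0, ∀ᶠ i in l, ∀ x, |translateAvg (K i) x p - c| < ε)
    (hq : ∀ ε > 0, ∀ᶠ i in l, ∀ x, |translateAvg (K i) x q - d| < ε) (h : ∀ y, p y ≤ q y) :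
    c ≤ d := by
  refine le_of_forall_pos_le_add fun ε hε => ?_
  obtain ⟨i, hi, hi'⟩ := ((hp (ε / 2) (by positivity)).and (hq (ε / 2) (by positivity))).exists
  have h1 := (abs_lt.1 (hi 1)).1
  have h2 := (abs_lt.1 (hi' 1)).2
  have h3 := translateAvg_mono (K := K i) (x := 1) h
  linarith

lemma tendsto_energy {H : Type*} [Group H] (K : Finset H) {q : ℕ → H → ℝ} {p : H → ℝ}
    (h : ∀ y, Tendsto (fun n => q n y) atTop (nhds (p y))) :
    Tendsto (fun n => energy K (q n)) atTop (nhds (energy K p)) := by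
  simp only [energy, Finset.expect_eq_sum_div_card]
  exact (tendsto_finsetSum _ fun _ _ => h _).div_const _

lemma abs_translateAvg_sub_le {H : Type*} [Group H] {K : Finset H} (hK : K.Nonempty) {x : H}
    {A p q : H → ℝ} {B t : ℝ} (h : ∀ y, |A y - p y| ≤ (q y - p y) * B + t) :
    |translateAvg K x A - translateAvg K x p| ≤
      (translateAvg K x q - translateAvg K x p) * B + t := by
  simp only [translateAvg, ← Finset.expect_sub_distrib]
  refine (Finset.abs_expect_le _ _).trans
    ((Finset.expect_le_expect fun k _ => h (k * x)).trans_eq ?_)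
  rw [Finset.expect_add_distrib, Finset.expect_const hK, Finset.expect_mul]

lemma IsLeftFolner.averagesToEnergyInf_product {G H ι : Type*} [Group G] [DecidableEq G] [Group H]
    {Φ : ℕ → Finset G} (hΦ : IsLeftFolner Φ) {l : Filter ι} [l.NeBot] {K : ι → Finset H}
    (hK : ∀ i, (K i).Nonempty) {𝒬 : Set (H → ℝ)} (hcl : IsClosed 𝒬) (hcv : Convex ℝ 𝒬)
    (h𝒬 : ∀ q ∈ 𝒬, AveragesToEnergyInf l K q) {Ψ : G × H → ℝ} (hΨ : Ψ ∈ prodClass G 𝒬) :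
    AveragesToEnergyInf (atTop.curry l) (fun p : ℕ × ι => Φ p.1 ×ˢ K p.2) Ψ := by
  choose m hm_le hm_lim hm_est using fun y => hΦ.exists_energy_inf (hΨ.1 y)
  set N : ℕ → H → ℝ := fun n y => energy (Φ n) fun g => Ψ (g, y)
  have hN (n : ℕ) : N n ∈ 𝒬 :=
    hcv.expect_apply_mem ((hΦ.1 n).product (hΦ.1 n)) fun p _ => hΨ.2 (p.1 * p.2⁻¹)
  have hm : m ∈ 𝒬 := hcl.mem_of_tendsto (tendsto_pi_nhds.2 hm_lim) (.of_forall hN)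
  obtain ⟨c, hc_le, hc_lt, hc⟩ := h𝒬 m hm
  choose d hd_le hd_lt hd using fun n => h𝒬 _ (hN n)
  have hcd (n : ℕ) : c ≤ d n := le_of_translateAvg_approx hc (hd n) fun y => hm_le y n
  have hev (η : ℝ) (hη : 0 < η) : ∃ i, ∀ᶠ n in atTop, energy (K i) (N n) < c + η := by
    obtain ⟨i, hi⟩ := hc_lt η hη
    exact ⟨i, (tendsto_energy (K i) hm_lim).eventually_lt_const hi⟩
  refine ⟨c, fun p => ?_, fun ε hε => ?_, fun ε hε => ?_⟩
  · rw [energy_product]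
    exact (hcd p.1).trans (hd_le p.1 p.2)
  · obtain ⟨i, hi⟩ := hev ε hε
    obtain ⟨n, hn⟩ := hi.exists
    exact ⟨(n, i), by rwa [energy_product]⟩
  · set B : ℝ := 1 / (2 * (ε / 8)) + 1
    have hB : 0 < B := by positivity
    obtain ⟨η, hη, hηε⟩ : ∃ η > 0, 3 * η * B + η = ε / 2 :=
      ⟨ε / 2 / (3 * B + 1), by positivity, by field_simp⟩
    rw [eventually_curry_iff]
    obtain ⟨j, hj⟩ := hev η hη
    filter_upwards [hj] with n hn
    filter_upwards [hd n η hη, hc η hη] with i hi hi' x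
    rw [translateAvg_product]
    have h1 := abs_translateAvg_sub_le (hK i) (x := x.2) fun y =>
      hm_est y n x.1 (ε / 8) (by positivity)
    have h2 := abs_lt.1 (hi x.2)
    have h3 := abs_lt.1 (hi' x.2)
    have h4 := hd_le n j
    have h5 : (translateAvg (K i) x.2 (N n) - translateAvg (K i) x.2 m) * B ≤ 3 * η * B :=
      mul_le_mul_of_nonneg_right (by linarith) hB.le
    have h6 := abs_le.1 (h1.trans (add_le_add_left h5 _))
    rw [abs_lt]
    constructor <;> linarith

end product

section mean

variable {X : Type*}

/-- The linear functional `m` sends every bounded function to the limit along `U` of its averages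
over the sets `S n`. -/
def IsMeanAlong (U : Ultrafilter ℕ) (S : ℕ → Finset X) (m : (X → ℝ) →ₗ[ℝ] ℝ) : Prop :=
  ∀ f M, (∀ x, |f x| ≤ M) → Tendsto (fun n => 𝔼 x ∈ S n, f x) U (nhds (m f))

lemma map_expect_apply (m : (X → ℝ) →ₗ[ℝ] ℝ) {ι : Type*} (s : Finset ι) (F : ι → X → ℝ) :
    m (fun x => 𝔼 i ∈ s, F i x) = 𝔼 i ∈ s, m (F i) := by
  have : (fun x => 𝔼 i ∈ s, F i x) = (s.card : ℝ)⁻¹ • ∑ i ∈ s, F i := by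
    ext x
    simp [Finset.expect_eq_sum_div_card, div_eq_inv_mul]
  rw [this, map_smul, map_sum, smul_eq_mul, Finset.expect_eq_sum_div_card, div_eq_inv_mul]

lemma exists_tendsto_expect (U : Ultrafilter ℕ) {S : ℕ → Finset X} (hS : ∀ n, (S n).Nonempty)
    {f : X → ℝ} {M : ℝ} (hf : ∀ x, |f x| ≤ M) :
    ∃ a, Tendsto (fun n => 𝔼 x ∈ S n, f x) U (nhds a) := by
  obtain ⟨a, -, ha⟩ := (isCompact_Icc (a := -M) (b := M)).ultrafilter_le_nhds
    (U.map fun n => 𝔼 x ∈ S n, f x) (by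
      rw [le_principal_iff, Ultrafilter.coe_map, Filter.mem_map]
      exact Filter.univ_mem' fun n => abs_le.1 (abs_expect_le_of_forall (hS n) hf))
  exact ⟨a, ha⟩

lemma exists_isMeanAlong (U : Ultrafilter ℕ) {S : ℕ → Finset X} (hS : ∀ n, (S n).Nonempty) :
    ∃ m, IsMeanAlong U S m := by
  let V : Submodule ℝ (X → ℝ) :=
    { carrier := {f | ∃ M, ∀ x, |f x| ≤ M}
      zero_mem' := ⟨0, by simp⟩
      add_mem' := by
        rintro f g ⟨M, hM⟩ ⟨N, hN⟩
        exact ⟨M + N, fun x => (abs_add_le _ _).trans (add_le_add (hM x) (hN x))⟩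
      smul_mem' := by
        rintro a f ⟨M, hM⟩
        refine ⟨|a| * M, fun x => ?_⟩
        rw [Pi.smul_apply, smul_eq_mul, abs_mul]
        exact mul_le_mul_of_nonneg_left (hM x) (abs_nonneg a) }
  choose L hL using fun f : V => exists_tendsto_expect U hS f.2.choose_spec
  let m₀ : V →ₗ[ℝ] ℝ :=
    { toFun := L
      map_add' := fun f g => tendsto_nhds_unique (hL (f + g)) (by
        simpa [Finset.expect_add_distrib] using (hL f).add (hL g))
      map_smul' := fun a f => tendsto_nhds_unique (hL (a • f)) (by
        simpa [← Finset.mul_expect] using (hL f).const_mul a) }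
  obtain ⟨m, hm⟩ := m₀.exists_extend
  refine ⟨m, fun f M hf => ?_⟩
  have : m f = L ⟨f, M, hf⟩ := LinearMap.congr_fun hm ⟨f, M, hf⟩
  exact this ▸ hL ⟨f, M, hf⟩

namespace IsMeanAlong

variable {U : Ultrafilter ℕ} {S : ℕ → Finset X} {m : (X → ℝ) →ₗ[ℝ] ℝ}

lemma abs_le (hm : IsMeanAlong U S m) (hS : ∀ n, (S n).Nonempty) {f : X → ℝ} {M : ℝ}
    (hf : ∀ x, |f x| ≤ M) : |m f| ≤ M :=
  le_of_tendsto (hm f M hf).abs (.of_forall fun n => abs_expect_le_of_forall (hS n) hf)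

lemma mono (hm : IsMeanAlong U S m) {f g : X → ℝ} {M N : ℝ} (hf : ∀ x, |f x| ≤ M)
    (hg : ∀ x, |g x| ≤ N) (hfg : ∀ x, f x ≤ g x) : m f ≤ m g :=
  le_of_tendsto_of_tendsto' (hm f M hf) (hm g N hg) fun _ =>
    Finset.expect_le_expect fun x _ => hfg x

lemma map_one (hm : IsMeanAlong U S m) (hS : ∀ n, (S n).Nonempty) : m (fun _ => 1) = 1 := by
  refine tendsto_nhds_unique (hm (fun _ => 1) 1 (by simp)) ?_
  simp [Finset.expect_const (hS _)]

lemma sq_le (hm : IsMeanAlong U S m) {f : X → ℝ} {M : ℝ} (hf : ∀ x, |f x| ≤ M) :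
    m f ^ 2 ≤ m fun x => f x ^ 2 := by
  refine le_of_tendsto_of_tendsto' ((hm f M hf).pow 2) (hm (fun x => f x ^ 2) (M ^ 2) fun x => ?_)
    fun n => sq_expect_le_expect_sq _ _
  rw [abs_pow]
  exact pow_le_pow_left₀ (abs_nonneg _) (hf x) 2

lemma map_eq_of_tendsto (hm : IsMeanAlong U S m) {f g : X → ℝ} {M N : ℝ} (hf : ∀ x, |f x| ≤ M)
    (hg : ∀ x, |g x| ≤ N)
    (h : Tendsto (fun n => 𝔼 x ∈ S n, f x - 𝔼 x ∈ S n, g x) U (nhds 0)) : m f = m g :=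
  sub_eq_zero.1 (tendsto_nhds_unique ((hm f M hf).sub (hm g N hg)) h)

variable {G : Type*} [Group G] {T : G → X → X}

lemma correlation_mul_inv (hT : ∀ g h x, T (g * h) x = T g (T h x))
    (hinv : ∀ (g : G) (f : X → ℝ) (M : ℝ), (∀ x, |f x| ≤ M) → m (fun x => f (T g x)) = m f)
    {F : X → ℝ} (hF : ∀ x, |F x| ≤ 1) (k l : G) :
    m (fun x => F x * F (T (k * l⁻¹) x)) = m fun x => F (T l x) * F (T k x) := by
  rw [← hinv l (fun x => F x * F (T (k * l⁻¹) x)) 1 fun x => ?_]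
  · simp [← hT]
  · rw [abs_mul]
    exact mul_le_one₀ (hF _) (abs_nonneg _) (hF _)

lemma correlation_mem_posDefFunctions (hm : IsMeanAlong U S m) (hS : ∀ n, (S n).Nonempty)
    (hT1 : ∀ x, T 1 x = x) (hT : ∀ g h x, T (g * h) x = T g (T h x))
    (hinv : ∀ (g : G) (f : X → ℝ) (M : ℝ), (∀ x, |f x| ≤ M) → m (fun x => f (T g x)) = m f)
    {F : X → ℝ} (hF : ∀ x, |F x| ≤ 1) :
    (fun g : G => m fun x => F x * F (T g x)) ∈ posDefFunctions G := by
  refine ⟨fun g => hm.abs_le hS fun x => ?_, fun g => ?_, fun σ => ?_⟩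
  · rw [abs_mul]
    exact mul_le_one₀ (hF _) (abs_nonneg _) (hF _)
  · simpa [hT1, mul_comm] using correlation_mul_inv hT hinv hF 1 g
  · have hb (x : X) : |∑ k ∈ σ.support, σ k * F (T k x)| ≤ ∑ k ∈ σ.support, |σ k| := by
      refine (Finset.abs_sum_le_sum_abs _ _).trans (Finset.sum_le_sum fun k _ => ?_)
      rw [abs_mul]
      exact mul_le_of_le_one_right (abs_nonneg _) (hF _)
    refine (sq_nonneg _).trans ((hm.sq_le hb).trans_eq ?_)
    simp only [kernelForm_apply, correlation_mul_inv hT hinv hF, ← smul_eq_mul (a := σ _),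
      ← map_smul, ← map_sum]
    congr 1
    ext x
    simp only [sq, Finset.sum_mul_sum, Finset.sum_apply, Pi.smul_apply, smul_eq_mul]
    refine Finset.sum_congr rfl fun k _ => Finset.sum_congr rfl fun l _ => ?_
    ring

lemma sq_le_energy_correlation (hm : IsMeanAlong U S m)
    (hT : ∀ g h x, T (g * h) x = T g (T h x))
    (hinv : ∀ (g : G) (f : X → ℝ) (M : ℝ), (∀ x, |f x| ≤ M) → m (fun x => f (T g x)) = m f)
    {F : X → ℝ} (hF : ∀ x, |F x| ≤ 1) {K : Finset G} (hK : K.Nonempty) :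
    m F ^ 2 ≤ energy K fun g => m fun x => F x * F (T g x) := by
  have h1 : m F = m fun x => 𝔼 k ∈ K, F (T k x) := by
    rw [map_expect_apply, Finset.expect_congr rfl fun k _ => hinv k F 1 hF, Finset.expect_const hK]
  rw [h1]
  refine (hm.sq_le fun x => abs_expect_le_of_forall hK fun k => hF (T k x)).trans_eq ?_
  simp only [energy, correlation_mul_inv hT hinv hF]
  rw [← map_expect_apply]
  congr 1
  ext x
  simp only [sq, Finset.expect_mul_expect, Finset.expect_product]
  exact Finset.expect_congr rfl fun k _ => Finset.expect_congr rfl fun l _ => mul_comm _ _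

end IsMeanAlong

end mean

section coordinates

variable {G : Type*} [Group G]

lemma IsLeftFolner.tendsto_expect_expect_mul_left_sub [DecidableEq G] {Φ : ℕ → Finset G}
    (hΦ : IsLeftFolner Φ) {Y : Type*} {S : ℕ → Finset Y} (hS : ∀ n, (S n).Nonempty)
    {F : Y → G → ℝ} {M : ℝ} (hF : ∀ y c, |F y c| ≤ M) (g : G) :
    Tendsto (fun n => 𝔼 y ∈ S n, 𝔼 c ∈ Φ n, F y (g * c) - 𝔼 y ∈ S n, 𝔼 c ∈ Φ n, F y c)
      atTop (nhds 0) := by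
  refine squeeze_zero_norm (fun n => ?_) (hΦ.tendsto_defect M g)
  rw [← Finset.expect_sub_distrib]
  exact (Finset.abs_expect_le _ _).trans
    (Finset.expect_le (hS n) fun y _ => abs_expect_mul_left_sub_le (hΦ.1 n) (hF y) g)

/-- The product of the values of `f` at the eight corners of the parallelepiped with edges `p` and
base point `a`. -/
def cornerProd (f : G × G × G → ℝ) (p a : G × G × G) : ℝ :=
  f (a.1, a.2.1, a.2.2) * f (p.1 * a.1, a.2.1, a.2.2) * f (a.1, p.2.1 * a.2.1, a.2.2) *
    f (a.1, a.2.1, p.2.2 * a.2.2) * f (p.1 * a.1, p.2.1 * a.2.1, a.2.2) *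
    f (p.1 * a.1, a.2.1, p.2.2 * a.2.2) * f (a.1, p.2.1 * a.2.1, p.2.2 * a.2.2) *
    f (p.1 * a.1, p.2.1 * a.2.1, p.2.2 * a.2.2)

variable [DecidableEq G] {Φ : ℕ → Finset G} {U : Ultrafilter ℕ} {m : (G × G × G → ℝ) →ₗ[ℝ] ℝ}

lemma IsLeftFolner.mean_mul_fst (hΦ : IsLeftFolner Φ) (hU : (U : Filter ℕ) ≤ atTop)
    (hm : IsMeanAlong U (fun n => Φ n ×ˢ Φ n ×ˢ Φ n) m) (g : G) {f : G × G × G → ℝ} {M : ℝ}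
    (hf : ∀ x, |f x| ≤ M) : m (fun a => f (g * a.1, a.2)) = m f := by
  refine hm.map_eq_of_tendsto (fun a => hf _) hf ?_
  refine ((hΦ.tendsto_expect_expect_mul_left_sub (fun n => (hΦ.1 n).product (hΦ.1 n))
    (F := fun y c => f (c, y)) (fun _ _ => hf _) g).mono_left hU).congr fun n => ?_
  simp only [Finset.expect_product (Φ n) (Φ n ×ˢ Φ n)]
  rw [Finset.expect_comm, Finset.expect_comm (Φ n ×ˢ Φ n) (Φ n) fun y c => f (c, y)]

lemma IsLeftFolner.mean_mul_snd (hΦ : IsLeftFolner Φ) (hU : (U : Filter ℕ) ≤ atTop)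
    (hm : IsMeanAlong U (fun n => Φ n ×ˢ Φ n ×ˢ Φ n) m) (g : G) {f : G × G × G → ℝ} {M : ℝ}
    (hf : ∀ x, |f x| ≤ M) : m (fun a => f (a.1, g * a.2.1, a.2.2)) = m f := by
  refine hm.map_eq_of_tendsto (fun a => hf _) hf ?_
  refine ((hΦ.tendsto_expect_expect_mul_left_sub (fun n => (hΦ.1 n).product (hΦ.1 n))
    (F := fun y c => f (y.1, c, y.2)) (fun _ _ => hf _) g).mono_left hU).congr fun n => ?_
  simp only [Finset.expect_product]
  congr 1 <;> exact Finset.expect_congr rfl fun a _ => Finset.expect_comm _ _ _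

lemma IsLeftFolner.mean_mul_thd (hΦ : IsLeftFolner Φ) (hU : (U : Filter ℕ) ≤ atTop)
    (hm : IsMeanAlong U (fun n => Φ n ×ˢ Φ n ×ˢ Φ n) m) (g : G) {f : G × G × G → ℝ} {M : ℝ}
    (hf : ∀ x, |f x| ≤ M) : m (fun a => f (a.1, a.2.1, g * a.2.2)) = m f := by
  refine hm.map_eq_of_tendsto (fun a => hf _) hf ?_
  refine ((hΦ.tendsto_expect_expect_mul_left_sub (fun n => (hΦ.1 n).product (hΦ.1 n))
    (F := fun y c => f (y.1, y.2, c)) (fun _ _ => hf _) g).mono_left hU).congr fun n => ?_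
  simp only [Finset.expect_product]

lemma IsLeftFolner.mean_cornerProd_mem (hΦ : IsLeftFolner Φ) (hU : (U : Filter ℕ) ≤ atTop)
    (hm : IsMeanAlong U (fun n => Φ n ×ˢ Φ n ×ˢ Φ n) m) {f : G × G × G → ℝ}
    (hf : ∀ x, |f x| ≤ 1) :
    (fun p => m (cornerProd f p)) ∈ prodClass G (prodClass G (posDefFunctions G)) := by
  have hS (n : ℕ) : (Φ n ×ˢ Φ n ×ˢ Φ n).Nonempty :=
    (hΦ.1 n).product ((hΦ.1 n).product (hΦ.1 n))
  have hf4 (x y z w) : |f x * f y * f z * f w| ≤ 1 := by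
    simp only [abs_mul]
    exact mul_le_one₀ (mul_le_one₀ (mul_le_one₀ (hf _) (abs_nonneg _) (hf _)) (abs_nonneg _)
      (hf _)) (abs_nonneg _) (hf _)
  refine ⟨fun y => ?_, fun g => ⟨fun k => ?_, fun h => ?_⟩⟩
  · convert hm.correlation_mem_posDefFunctions hS (T := fun g a => (g * a.1, a.2))
      (fun _ => by simp) (fun _ _ _ => by simp [mul_assoc]) (fun g f M => hΦ.mean_mul_fst hU hm g)
      (F := fun a => f (a.1, a.2.1, a.2.2) * f (a.1, y.1 * a.2.1, a.2.2) *
        f (a.1, a.2.1, y.2 * a.2.2) * f (a.1, y.1 * a.2.1, y.2 * a.2.2))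
      (fun a => hf4 _ _ _ _) using 4 with g a
    simp only [cornerProd]
    ring
  · convert hm.correlation_mem_posDefFunctions hS (T := fun g a => (a.1, g * a.2.1, a.2.2))
      (fun _ => by simp) (fun _ _ _ => by simp [mul_assoc]) (fun g f M => hΦ.mean_mul_snd hU hm g)
      (F := fun a => f (a.1, a.2.1, a.2.2) * f (g * a.1, a.2.1, a.2.2) *
        f (a.1, a.2.1, k * a.2.2) * f (g * a.1, a.2.1, k * a.2.2))
      (fun a => hf4 _ _ _ _) using 4 with h a
    simp only [cornerProd]
    ring
  · convert hm.correlation_mem_posDefFunctions hS (T := fun g a => (a.1, a.2.1, g * a.2.2))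
      (fun _ => by simp) (fun _ _ _ => by simp [mul_assoc]) (fun g f M => hΦ.mean_mul_thd hU hm g)
      (F := fun a => f (a.1, a.2.1, a.2.2) * f (g * a.1, a.2.1, a.2.2) *
        f (a.1, h * a.2.1, a.2.2) * f (g * a.1, h * a.2.1, a.2.2))
      (fun a => hf4 _ _ _ _) using 4 with k a
    simp only [cornerProd]
    ring

lemma sq_energy_le_energy {H : Type*} [Group H] {K : Finset H} {p q : H → ℝ}
    (h : ∀ y, p y ^ 2 ≤ q y) : energy K p ^ 2 ≤ energy K q :=
  (sq_expect_le_expect_sq _ _).trans (energy_mono h)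

lemma IsLeftFolner.pow_eight_le_energy (hΦ : IsLeftFolner Φ) (hU : (U : Filter ℕ) ≤ atTop)
    (hm : IsMeanAlong U (fun n => Φ n ×ˢ Φ n ×ˢ Φ n) m) {f : G × G × G → ℝ}
    (hf : ∀ x, |f x| ≤ 1) {K₁ K₂ K₃ : Finset G} (hK₁ : K₁.Nonempty) (hK₂ : K₂.Nonempty)
    (hK₃ : K₃.Nonempty) :
    m f ^ 8 ≤ energy (K₁ ×ˢ K₂ ×ˢ K₃) fun p => m (cornerProd f p) := by
  have hf2 (x y) : |f x * f y| ≤ 1 := by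
    rw [abs_mul]
    exact mul_le_one₀ (hf _) (abs_nonneg _) (hf _)
  have hf4 (x y z w) : |f x * f y * (f z * f w)| ≤ 1 := by
    rw [abs_mul]
    exact mul_le_one₀ (hf2 _ _) (abs_nonneg _) (hf2 _ _)
  let f₁ (k : G) (a : G × G × G) : ℝ := f a * f (a.1, a.2.1, k * a.2.2)
  let f₂ (y : G × G) (a : G × G × G) : ℝ := f₁ y.2 a * f₁ y.2 (a.1, y.1 * a.2.1, a.2.2)
  have h1 : m f ^ 2 ≤ energy K₃ fun k => m (f₁ k) :=
    hm.sq_le_energy_correlation (T := fun g a => (a.1, a.2.1, g * a.2.2))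
      (fun _ _ _ => by simp [mul_assoc]) (fun g f M => hΦ.mean_mul_thd hU hm g) hf hK₃
  have h2 : (m f ^ 2) ^ 2 ≤ energy (K₂ ×ˢ K₃) fun y => m (f₂ y) := by
    rw [energy_product]
    refine (pow_le_pow_left₀ (sq_nonneg _) h1 2).trans (sq_energy_le_energy fun k => ?_)
    exact hm.sq_le_energy_correlation (T := fun g a => (a.1, g * a.2.1, a.2.2))
      (fun _ _ _ => by simp [mul_assoc]) (fun g f M => hΦ.mean_mul_snd hU hm g)
      (fun a => hf2 _ _) hK₂
  calc m f ^ 8 = ((m f ^ 2) ^ 2) ^ 2 := by ring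
    _ ≤ (energy (K₂ ×ˢ K₃) fun y => m (f₂ y)) ^ 2 := pow_le_pow_left₀ (sq_nonneg _) h2 2
    _ ≤ energy (K₁ ×ˢ K₂ ×ˢ K₃) fun p => m (cornerProd f p) := by
      rw [energy_product K₁]
      refine sq_energy_le_energy fun y => ?_
      convert hm.sq_le_energy_correlation (T := fun g a => (g * a.1, a.2))
        (fun _ _ _ => by simp [mul_assoc]) (fun g f M => hΦ.mean_mul_fst hU hm g)
        (F := f₂ y) (fun a => hf4 _ _ _ _) hK₁ using 5 with g a
      simp only [cornerProd, f₁, f₂]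
      ring

end coordinates

section syndetic

variable {G : Type*} [Group G]

lemma leftSyndetic_and_rightSyndetic_of_finset {R : Set G} (hR : ∀ p ∈ R, p⁻¹ ∈ R) {K : Finset G}
    (hK : ∀ x, ∃ k ∈ K, k * x ∈ R) : LeftSyndetic R ∧ RightSyndetic R := by
  classical
  refine ⟨⟨K.image (·⁻¹), fun x => ?_⟩, ⟨K, fun x => ?_⟩⟩
  · obtain ⟨k, hk, hkx⟩ := hK x
    exact ⟨k⁻¹, Finset.mem_image_of_mem _ hk, by rwa [inv_inv]⟩
  · obtain ⟨k, hk, hkx⟩ := hK x⁻¹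
    exact ⟨k, hk, by simpa using hR _ hkx⟩

lemma neBot_curry {α β : Type*} (l : Filter α) (l' : Filter β) [l.NeBot] [l'.NeBot] :
    (l.curry l').NeBot := by
  rw [← frequently_true_iff_neBot, frequently_curry_iff]
  simpa [Filter.frequently_const] using ‹l'.NeBot›

lemma IsLeftFolner.exists_finset_cornerProd_ne_zero [DecidableEq G] {Φ : ℕ → Finset G}
    (hΦ : IsLeftFolner Φ) {U : Ultrafilter ℕ} (hU : (U : Filter ℕ) ≤ atTop)
    {m : (G × G × G → ℝ) →ₗ[ℝ] ℝ} (hm : IsMeanAlong U (fun n => Φ n ×ˢ Φ n ×ˢ Φ n) m)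
    {f : G × G × G → ℝ} (hf : ∀ x, |f x| ≤ 1) (hpos : 0 < m f) :
    ∃ K : Finset (G × G × G), ∀ x, ∃ k ∈ K, ∃ a, cornerProd f (k * x) a ≠ 0 := by
  have := neBot_curry (atTop : Filter ℕ) (atTop : Filter ℕ)
  have := neBot_curry (atTop : Filter ℕ) ((atTop : Filter ℕ).curry (atTop : Filter ℕ))
  have h1 (q) (hq : q ∈ posDefFunctions G) : AveragesToEnergyInf atTop Φ q :=
    hΦ.averagesToEnergyInf hq
  have h2 (q) (hq : q ∈ prodClass G (posDefFunctions G)) :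
      AveragesToEnergyInf ((atTop : Filter ℕ).curry (atTop : Filter ℕ))
        (fun p : ℕ × ℕ => Φ p.1 ×ˢ Φ p.2) q :=
    hΦ.averagesToEnergyInf_product hΦ.1 isClosed_posDefFunctions convex_posDefFunctions h1 hq
  have hK (p : ℕ × ℕ) : (Φ p.1 ×ˢ Φ p.2).Nonempty := (hΦ.1 p.1).product (hΦ.1 p.2)
  have h3 : AveragesToEnergyInf
      ((atTop : Filter ℕ).curry ((atTop : Filter ℕ).curry (atTop : Filter ℕ)))
      (fun p : ℕ × ℕ × ℕ => Φ p.1 ×ˢ Φ p.2.1 ×ˢ Φ p.2.2) (fun p => m (cornerProd f p)) :=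
    hΦ.averagesToEnergyInf_product hK (isClosed_prodClass isClosed_posDefFunctions)
      (convex_prodClass convex_posDefFunctions) h2 (hΦ.mean_cornerProd_mem hU hm hf)
  obtain ⟨c, -, hc_lt, hc⟩ := h3
  have hc_pos : 0 < c := by
    refine (pow_pos hpos 8).trans_le (le_of_forall_pos_lt_add fun ε hε => ?_)
    obtain ⟨p, hp⟩ := hc_lt ε hε
    exact (hΦ.pow_eight_le_energy hU hm hf (hΦ.1 _) (hΦ.1 _) (hΦ.1 _)).trans_lt hp
  obtain ⟨p, hp⟩ := (hc c hc_pos).exists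
  refine ⟨Φ p.1 ×ˢ Φ p.2.1 ×ˢ Φ p.2.2, fun x => ?_⟩
  by_contra! h
  have h0 : translateAvg (Φ p.1 ×ˢ Φ p.2.1 ×ˢ Φ p.2.2) x (fun p => m (cornerProd f p)) = 0 := by
    refine Finset.expect_eq_zero fun k hk => ?_
    simp [show cornerProd f (k * x) = 0 from funext (h k hk)]
  have := hp x
  rw [h0, zero_sub, abs_neg, abs_of_pos hc_pos] at this
  exact this.false

lemma exists_indicator_pos {X ι : Type*} [Fintype ι] {C : ι → Set X} (hC : ⋃ i, C i = Set.univ)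
    {U : Ultrafilter ℕ} {S : ℕ → Finset X} (hS : ∀ n, (S n).Nonempty) {m : (X → ℝ) →ₗ[ℝ] ℝ}
    (hm : IsMeanAlong U S m) : ∃ i, 0 < m ((C i).indicator 1) := by
  by_contra! h
  have h1 : m (∑ i, (C i).indicator 1) ≤ 0 := by
    rw [map_sum]
    exact Finset.sum_nonpos fun i _ => h i
  have h01 (i : ι) (x : X) :
      0 ≤ (C i).indicator (1 : X → ℝ) x ∧ (C i).indicator (1 : X → ℝ) x ≤ 1 :=
    ⟨Set.indicator_nonneg (by simp) x, Set.indicator_le_self' (by simp) x⟩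
  have h2 : m (fun _ => 1) ≤ m (∑ i, (C i).indicator 1) := by
    refine hm.mono (M := 1) (N := Fintype.card ι) (by simp) (fun x => ?_) fun x => ?_
    · rw [Finset.sum_apply, abs_of_nonneg (Finset.sum_nonneg fun i _ => (h01 i x).1)]
      simpa using Finset.sum_le_card_nsmul Finset.univ _ (1 : ℝ) fun i _ => (h01 i x).2
    · obtain ⟨i, hi⟩ := Set.mem_iUnion.1 (hC.symm ▸ Set.mem_univ x : x ∈ ⋃ i, C i)
      rw [Finset.sum_apply]
      refine le_trans ?_ (Finset.single_le_sum (fun j _ => (h01 j x).1) (Finset.mem_univ i))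
      simp [hi]
  rw [hm.map_one hS] at h2
  linarith

end syndetic

/-- Corollary 5.4, partition result. If `G` is a countable group
admitting a two-sided Følner sequence and `G³ = C₁ ∪ ⋯ ∪ C_r`, then the set of
`(g,h,k) ∈ G³` for which some cell `Cᵢ` contains a parallelepiped-like configuration
`(g,h,k)·(a₁,a₂,a₃)` is both left and right syndetic in `G × G × G`. -/
theorem partition_parallelepipeds
    {G : Type*} [Group G] [Countable G] [DecidableEq G]
    (hFol : ∃ Φ : ℕ → Finset G, IsTwoSidedFolner Φ)
    (r : ℕ) (C : Fin r → Set (G × G × G))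
    (hcover : (⋃ i, C i) = Set.univ) :
    LeftSyndetic {p : G × G × G | ∃ i : Fin r, ∃ a : G × G × G,
        ({(a.1, a.2.1, a.2.2), (p.1 * a.1, a.2.1, a.2.2), (a.1, p.2.1 * a.2.1, a.2.2),
          (a.1, a.2.1, p.2.2 * a.2.2), (p.1 * a.1, p.2.1 * a.2.1, a.2.2),
          (p.1 * a.1, a.2.1, p.2.2 * a.2.2), (a.1, p.2.1 * a.2.1, p.2.2 * a.2.2),
          (p.1 * a.1, p.2.1 * a.2.1, p.2.2 * a.2.2)} : Set (G × G × G)) ⊆ C i} ∧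
    RightSyndetic {p : G × G × G | ∃ i : Fin r, ∃ a : G × G × G,
        ({(a.1, a.2.1, a.2.2), (p.1 * a.1, a.2.1, a.2.2), (a.1, p.2.1 * a.2.1, a.2.2),
          (a.1, a.2.1, p.2.2 * a.2.2), (p.1 * a.1, p.2.1 * a.2.1, a.2.2),
          (p.1 * a.1, a.2.1, p.2.2 * a.2.2), (a.1, p.2.1 * a.2.1, p.2.2 * a.2.2),
          (p.1 * a.1, p.2.1 * a.2.1, p.2.2 * a.2.2)} : Set (G × G × G)) ⊆ C i} := by
  obtain ⟨Φ, hΦ, -⟩ := hFol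
  have hS (n : ℕ) : (Φ n ×ˢ Φ n ×ˢ Φ n).Nonempty := (hΦ.1 n).product ((hΦ.1 n).product (hΦ.1 n))
  have hU : (hyperfilter ℕ : Filter ℕ) ≤ atTop := Nat.hyperfilter_le_atTop
  obtain ⟨m, hm⟩ := exists_isMeanAlong (hyperfilter ℕ) hS
  obtain ⟨i, hi⟩ := exists_indicator_pos hcover hS hm
  obtain ⟨K, hK⟩ := hΦ.exists_finset_cornerProd_ne_zero hU hm (fun x => by
    by_cases hx : x ∈ C i <;> simp [hx]) hi
  refine leftSyndetic_and_rightSyndetic_of_finset ?_ (K := K) fun x => ?_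
  · rintro p ⟨j, a, ha⟩
    refine ⟨j, (p.1 * a.1, p.2.1 * a.2.1, p.2.2 * a.2.2), ?_⟩
    simp only [Set.insert_subset_iff, Set.singleton_subset_iff, Prod.fst_inv, Prod.snd_inv,
      inv_mul_cancel_left] at ha ⊢
    tauto
  · obtain ⟨k, hk, a, ha⟩ := hK x
    refine ⟨k, hk, i, a, ?_⟩
    simp only [cornerProd, ne_eq, mul_eq_zero, not_or, Set.indicator_apply_eq_zero, Pi.one_apply,
      one_ne_zero, imp_false, not_not] at ha
    simp only [Set.insert_subset_iff, Set.singleton_subset_iff]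
    tauto
end

section
/- Let G be a countable group admitting a two-sided Følner sequence, and let R, S, T be pairwise commuting actions of G by homeomorphisms on a compact metric space (X, d) (i.e., R_g S_h = S_h R_g, R_g T_h = T_h R_g, and S_g T_h = T_h S_g for all g, h ∈ G). Then for all ε > 0, the set J_ε = {(g, h, k) ∈ G³ : there exists x ∈ X such that the diameter of {x, T_g x, S_h x, R_k x, T_g S_h x, T_g R_k x, S_h R_k x, T_g S_h R_k x} is less than ε} is both left syndetic and right syndetic in G × G × G. -/
open MeasureTheory Filter

/-- A function is bounded if its absolute values are. -/
def IsBdd {α : Type*} (f : α → ℝ) : Prop := ∃ C, ∀ x, |f x| ≤ C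

namespace IsBdd

variable {α β : Type*} {f g : α → ℝ}

theorem const (c : ℝ) : IsBdd (fun _ : α => c) := ⟨|c|, fun _ => le_rfl⟩

theorem add (hf : IsBdd f) (hg : IsBdd g) : IsBdd (fun x => f x + g x) := by
  obtain ⟨C, hC⟩ := hf
  obtain ⟨D, hD⟩ := hg
  exact ⟨C + D, fun x => (abs_add_le _ _).trans (add_le_add (hC x) (hD x))⟩

theorem mul (hf : IsBdd f) (hg : IsBdd g) : IsBdd (fun x => f x * g x) := by
  obtain ⟨C, hC⟩ := hf
  obtain ⟨D, hD⟩ := hg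
  refine ⟨C * D, fun x => ?_⟩
  rw [abs_mul]
  exact mul_le_mul (hC x) (hD x) (abs_nonneg _) ((abs_nonneg _).trans (hC x))

theorem neg (hf : IsBdd f) : IsBdd (fun x => -f x) := by
  obtain ⟨C, hC⟩ := hf
  exact ⟨C, fun x => by rw [abs_neg]; exact hC x⟩

theorem sub (hf : IsBdd f) (hg : IsBdd g) : IsBdd (fun x => f x - g x) := by
  simpa only [sub_eq_add_neg] using hf.add hg.neg

theorem pow (hf : IsBdd f) (n : ℕ) : IsBdd (fun x => f x ^ n) := by
  obtain ⟨C, hC⟩ := hf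
  exact ⟨C ^ n, fun x => by rw [abs_pow]; exact pow_le_pow_left₀ (abs_nonneg _) (hC x) n⟩

theorem prod {κ : Type*} {s : Finset κ} {F : κ → α → ℝ} (hF : ∀ k ∈ s, IsBdd (F k)) :
    IsBdd (fun x => ∏ k ∈ s, F k x) := by
  classical
  induction s using Finset.induction_on with
  | empty => simpa using IsBdd.const (α := α) 1
  | insert a s ha ih =>
    simp only [Finset.prod_insert ha]
    exact (hF a (Finset.mem_insert_self a s)).mul
      (ih fun k hk => hF k (Finset.mem_insert_of_mem hk))

theorem comp (hf : IsBdd f) (φ : β → α) : IsBdd (fun y => f (φ y)) := by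
  obtain ⟨C, hC⟩ := hf
  exact ⟨C, fun y => hC (φ y)⟩

end IsBdd

/-- A finitely additive mean: a linear functional that is normalized, and nonnegative on bounded
nonnegative functions. Its values on unbounded functions carry no information. -/
structure FinMean (α : Type*) where
  toLin : (α → ℝ) →ₗ[ℝ] ℝ
  map_one' : toLin (fun _ => 1) = 1
  nonneg' : ∀ f, IsBdd f → (∀ x, 0 ≤ f x) → 0 ≤ toLin f

namespace FinMean

variable {α β : Type*}

instance : CoeFun (FinMean α) fun _ => (α → ℝ) → ℝ := ⟨fun m => m.toLin⟩

variable (m : FinMean α) {f g : α → ℝ}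

theorem map_add (f g : α → ℝ) : m (fun x => f x + g x) = m f + m g := m.toLin.map_add f g

theorem map_sub (f g : α → ℝ) : m (fun x => f x - g x) = m f - m g := m.toLin.map_sub f g

theorem map_mul_left (c : ℝ) (f : α → ℝ) : m (fun x => c * f x) = c * m f :=
  m.toLin.map_smul c f

theorem map_const (c : ℝ) : m (fun _ => c) = c := by
  have := m.map_mul_left c fun _ => 1
  rw [m.map_one'] at this
  simpa using this

theorem mono (hf : IsBdd f) (hg : IsBdd g) (h : ∀ x, f x ≤ g x) : m f ≤ m g := by
  have := m.nonneg' (fun x => g x - f x) (hg.sub hf) fun x => sub_nonneg.2 (h x)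
  have h2 := m.map_sub g f
  linarith

theorem abs_le {C : ℝ} (h : ∀ x, |f x| ≤ C) : |m f| ≤ C := by
  have hf : IsBdd f := ⟨C, h⟩
  rw [_root_.abs_le]
  constructor
  · simpa [m.map_const] using m.mono (IsBdd.const (-C)) hf fun x => (_root_.abs_le.1 (h x)).1
  · simpa [m.map_const] using m.mono hf (IsBdd.const C) fun x => (_root_.abs_le.1 (h x)).2

theorem exists_le (hf : IsBdd f) {ε : ℝ} (hε : 0 < ε) : ∃ x, f x ≤ m f + ε := by
  by_contra! h
  have := m.mono (IsBdd.const (m f + ε)) hf fun x => (h x).le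
  rw [m.map_const] at this
  linarith

theorem sq_le (hf : IsBdd f) : m f ^ 2 ≤ m (fun x => f x ^ 2) := by
  have h := m.nonneg' (fun x => (f x - m f) ^ 2) ((hf.sub (.const _)).pow 2) fun x => sq_nonneg _
  have h2 : m (fun x => (f x - m f) ^ 2) = m (fun x => f x ^ 2) - m f ^ 2 := by
    have : (fun x => (f x - m f) ^ 2) =
        fun x => (f x ^ 2 - (2 * m f) * f x) + m f ^ 2 := by funext x; ring
    rw [this, m.map_add (fun x => f x ^ 2 - (2 * m f) * f x) (fun _ => m f ^ 2),
      m.map_sub (fun x => f x ^ 2) (fun x => (2 * m f) * f x), m.map_mul_left, m.map_const]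
    ring
  have h3 : 0 ≤ m (fun x => (f x - m f) ^ 2) := h
  linarith

theorem pow_two_pow_le (hf : IsBdd f) (k : ℕ) :
    m f ^ 2 ^ k ≤ m (fun x => f x ^ 2 ^ k) := by
  induction k with
  | zero => simp
  | succ k ih =>
    rcases k.eq_zero_or_pos with rfl | hk
    · simpa using m.sq_le hf
    have he : Even (2 ^ k) := (Nat.even_pow.2 ⟨even_two, hk.ne'⟩)
    rw [pow_succ, pow_mul]
    simp only [pow_mul]
    exact (pow_le_pow_left₀ (he.pow_nonneg _) ih 2).trans (m.sq_le (hf.pow _))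

/-- The image of a mean under a map. -/
def map (φ : α → β) : FinMean β where
  toLin := m.toLin ∘ₗ LinearMap.funLeft ℝ ℝ φ
  map_one' := m.map_one'
  nonneg' _ hf h := m.nonneg' _ (hf.comp φ) fun x => h (φ x)

theorem map_apply (φ : α → β) (f : β → ℝ) : m.map φ f = m (fun x => f (φ x)) := rfl

/-- The mixture, along a mean, of a family of means. -/
def bind (k : α → FinMean β) : FinMean β where
  toLin := m.toLin ∘ₗ LinearMap.pi fun a => (k a).toLin
  map_one' := by
    have : (LinearMap.pi fun a => (k a).toLin) (fun _ : β => (1 : ℝ)) = fun _ => 1 := by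
      funext a; exact (k a).map_one'
    rw [LinearMap.comp_apply, this, m.map_one']
  nonneg' f hf h := by
    obtain ⟨C, hC⟩ := hf
    exact m.nonneg' _ ⟨C, fun a => (k a).abs_le hC⟩ fun a => (k a).nonneg' f ⟨C, hC⟩ h

theorem bind_apply (k : α → FinMean β) (f : β → ℝ) : m.bind k f = m (fun a => k a f) := rfl

/-- The uniform mean over a nonempty finite set. -/
noncomputable def uniform (s : Finset α) (hs : s.Nonempty) : FinMean α where
  toLin := (s.card : ℝ)⁻¹ • ∑ a ∈ s, LinearMap.proj a
  map_one' := by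
    have : (s.card : ℝ) ≠ 0 := by exact_mod_cast hs.card_pos.ne'
    simp [this]
  nonneg' f _ h := by
    simp only [LinearMap.smul_apply, LinearMap.coe_sum, Finset.sum_apply, LinearMap.proj_apply,
      smul_eq_mul]
    exact mul_nonneg (by positivity) (Finset.sum_nonneg fun a _ => h a)

theorem uniform_apply (s : Finset α) (hs : s.Nonempty) (f : α → ℝ) :
    uniform s hs f = (s.card : ℝ)⁻¹ * ∑ a ∈ s, f a := by
  simp [uniform]

theorem exists_tendsto_of_isBdd (U : Ultrafilter α) (hf : IsBdd f) :
    ∃ c, Tendsto f U (nhds c) := by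
  obtain ⟨C, hC⟩ := hf
  obtain ⟨c, -, hc⟩ := (isCompact_Icc (a := -C) (b := C)).ultrafilter_le_nhds (U.map f)
    (tendsto_principal.2 (Eventually.of_forall fun x => _root_.abs_le.1 (hC x)))
  exact ⟨c, hc⟩

/-- Limits along an ultrafilter extend to a mean. -/
theorem exists_of_ultrafilter (U : Ultrafilter α) :
    ∃ m : FinMean α, ∀ (f : α → ℝ) (c : ℝ), IsBdd f → Tendsto f U (nhds c) → m f = c := by
  let B : Submodule ℝ (α → ℝ) :=
    { carrier := {f | IsBdd f}
      add_mem' := fun hf hg => hf.add hg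
      zero_mem' := IsBdd.const 0
      smul_mem' := fun c _ hf => (IsBdd.const c).mul hf }
  choose L hL using fun f : B => exists_tendsto_of_isBdd U f.2
  let ℓ : B →ₗ[ℝ] ℝ :=
    { toFun := L
      map_add' := fun f g => tendsto_nhds_unique (hL (f + g)) ((hL f).add (hL g))
      map_smul' := fun c f => tendsto_nhds_unique (hL (c • f)) ((hL f).const_mul c) }
  obtain ⟨φ, hφ⟩ := LinearMap.exists_extend ℓ
  have key : ∀ (f : α → ℝ) (c : ℝ), IsBdd f → Tendsto f U (nhds c) → φ f = c := by
    intro f c hf hc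
    have h1 : φ f = L ⟨f, hf⟩ := LinearMap.congr_fun hφ ⟨f, hf⟩
    rw [h1]
    exact tendsto_nhds_unique (hL ⟨f, hf⟩) hc
  refine ⟨⟨φ, key _ 1 (IsBdd.const 1) tendsto_const_nhds, fun f hf h => ?_⟩, key⟩
  obtain ⟨c, hc⟩ := exists_tendsto_of_isBdd U hf
  rw [key f c hf hc]
  exact ge_of_tendsto' hc h

/-- A van der Corput type inequality: if the vectors `v γ` all have the same correlation with `P`,
then this correlation is controlled by the mean of their mutual correlations. -/
theorem sq_le_of_forall_correlation {κ : Type*} (ρ : FinMean κ) (P : α → ℝ) (v : κ → α → ℝ)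
    (hP : ∀ x, |P x| ≤ 1) (hv : ∀ k x, |v k x| ≤ 1) {l c : ℝ}
    (hl : ∀ k, m (fun x => P x * v k x) = l)
    (hc : ∀ k, ρ (fun k' => m (fun x => v k x * v k' x)) = c) : l ^ 2 ≤ c := by
  have hPb : IsBdd P := ⟨1, hP⟩
  have hvb : ∀ k, IsBdd (v k) := fun k => ⟨1, hv k⟩
  have step : ∀ ε : ℝ, 0 < ε → ∀ n : ℕ, ∃ w : α → ℝ, IsBdd w ∧
      m (fun x => P x * w x) = n * l ∧ IsBdd (fun k' => m (fun x => w x * v k' x)) ∧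
      ρ (fun k' => m (fun x => w x * v k' x)) = n * c ∧
      m (fun x => w x ^ 2) ≤ n + n * (n - 1) * c + n ^ 2 * ε := by
    intro ε hε n
    induction n with
    | zero =>
      refine ⟨fun _ => 0, IsBdd.const 0, ?_, ?_, ?_, ?_⟩
      · simp [map_const]
      · simp only [zero_mul, map_const]; exact IsBdd.const 0
      · simp [map_const]
      · simp [map_const]
    | succ n ih =>
      obtain ⟨w, hw, h1, h2, h3, h4⟩ := ih
      obtain ⟨k, hk⟩ := ρ.exists_le h2 (half_pos hε)
      rw [h3] at hk
      refine ⟨fun x => w x + v k x, hw.add (hvb k), ?_, ?_, ?_, ?_⟩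
      · simp only [mul_add, m.map_add, h1, hl]
        push_cast; ring
      · simp only [add_mul, m.map_add]
        refine h2.add ⟨1, fun k' => m.abs_le fun x => ?_⟩
        rw [abs_mul]
        exact mul_le_one₀ (hv k x) (abs_nonneg _) (hv k' x)
      · simp only [add_mul, m.map_add, ρ.map_add, h3, hc]
        push_cast; ring
      · have e : (fun x => (w x + v k x) ^ 2) =
            fun x => (w x ^ 2 + 2 * (w x * v k x)) + v k x ^ 2 := by funext x; ring
        have h5 : m (fun x => v k x ^ 2) ≤ 1 :=
          (le_abs_self _).trans (m.abs_le fun x => by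
            rw [abs_pow]; exact pow_le_one₀ (abs_nonneg _) (hv k x))
        rw [e, m.map_add (fun x => w x ^ 2 + 2 * (w x * v k x)),
          m.map_add (fun x => w x ^ 2), m.map_mul_left]
        push_cast
        have : 0 ≤ (n : ℝ) * ε := by positivity
        nlinarith
  have bound : ∀ ε : ℝ, 0 < ε → ∀ n : ℕ,
      (n * l) ^ 2 ≤ n + n * (n - 1) * c + n ^ 2 * ε := by
    intro ε hε n
    obtain ⟨w, hw, h1, -, -, h4⟩ := step ε hε n
    rw [← h1]
    refine (m.sq_le (hPb.mul hw)).trans ((m.mono ((hPb.mul hw).pow 2) (hw.pow 2) ?_).trans h4)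
    intro x
    rw [mul_pow]
    have : P x ^ 2 ≤ 1 := by rw [← sq_abs]; exact pow_le_one₀ (abs_nonneg _) (hP x)
    nlinarith [sq_nonneg (w x)]
  by_contra! hlt
  obtain ⟨n, hn⟩ := exists_nat_gt (2 * (1 - c) / (l ^ 2 - c))
  have hd : 0 < l ^ 2 - c := sub_pos.2 hlt
  have h := bound ((l ^ 2 - c) / 2) (half_pos hd) (n + 1)
  rw [div_lt_iff₀ hd] at hn
  push_cast at h
  have hn0 : (0 : ℝ) < n + 1 := by positivity
  have h' : ((n : ℝ) + 1) * ((n + 1) * ((l ^ 2 - c) / 2)) ≤ (n + 1) * (1 - c) := by nlinarith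
  have := le_of_mul_le_mul_left h' hn0
  nlinarith

end FinMean

universe v

theorem exists_leftInvariant_mean {G : Type*} [Group G] [DecidableEq G] {Φ : ℕ → Finset G}
    (hΦ : IsLeftFolner Φ) :
    ∃ m : FinMean G, ∀ f, IsBdd f → ∀ a, m (fun g => f (a * g)) = m f := by
  obtain ⟨U, hU⟩ := FinMean.exists_of_ultrafilter (hyperfilter ℕ)
  refine ⟨U.bind fun n => FinMean.uniform (Φ n) (hΦ.1 n), fun f hf a => ?_⟩
  rw [← sub_eq_zero, ← FinMean.map_sub, FinMean.bind_apply]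
  obtain ⟨C, hC⟩ := hf
  have hlim : Tendsto (fun n => 2 * C * (1 -
      ((Φ n ∩ (Φ n).image (a * ·)).card : ℝ) / ((Φ n).card : ℝ))) atTop (nhds 0) := by
    simpa using ((hΦ.2 a).const_sub 1).const_mul (2 * C)
  refine hU _ 0 ⟨C + C, fun n => FinMean.abs_le _ fun g => ?_⟩ ?_
  · exact (abs_sub _ _).trans (add_le_add (hC _) (hC _))
  refine Tendsto.mono_left (squeeze_zero_norm (fun n => ?_) hlim) Nat.hyperfilter_le_atTop
  have hpos : (0 : ℝ) < (Φ n).card := by exact_mod_cast (hΦ.1 n).card_pos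
  have hcard : ((Φ n).image (a * ·)).card = (Φ n).card :=
    Finset.card_image_of_injective _ (mul_right_injective a)
  have hsum : ∀ A B : Finset G, |∑ g ∈ A \ B, f g| ≤ C * (A.card - (A ∩ B).card) := by
    intro A B
    have h1 : ((A \ B).card : ℝ) = A.card - (A ∩ B).card := by
      rw [← Finset.card_sdiff_add_card_inter A B]; push_cast; ring
    rw [← h1, mul_comm, ← nsmul_eq_mul]
    exact (Finset.abs_sum_le_sum_abs _ _).trans (Finset.sum_le_card_nsmul _ _ _ fun g _ => hC g)
  have h1 := hsum (Φ n) ((Φ n).image (a * ·))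
  have h2 := hsum ((Φ n).image (a * ·)) (Φ n)
  rw [Finset.inter_comm, hcard] at h2
  have h3 : ∑ g ∈ Φ n, (f (a * g) - f g) =
      ∑ g ∈ (Φ n).image (a * ·) \ Φ n, f g - ∑ g ∈ Φ n \ (Φ n).image (a * ·), f g := by
    rw [Finset.sum_sdiff_sub_sum_sdiff, Finset.sum_sub_distrib,
      Finset.sum_image fun x _ y _ h => mul_left_cancel h]
  rw [FinMean.uniform_apply, h3, Real.norm_eq_abs, abs_mul, abs_inv, abs_of_pos hpos,
    inv_mul_le_iff₀ hpos]
  refine (abs_sub _ _).trans ((add_le_add h2 h1).trans (le_of_eq ?_))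
  field_simp
  ring

theorem exists_rightInvariant_mean {G : Type*} [Group G] [DecidableEq G] {Φ : ℕ → Finset G}
    (hΦ : IsLeftFolner Φ) :
    ∃ m : FinMean G, ∀ f, IsBdd f → ∀ a, m (fun g => f (g * a)) = m f := by
  obtain ⟨m, hm⟩ := exists_leftInvariant_mean hΦ
  refine ⟨m.map (·⁻¹), fun f hf a => ?_⟩
  have := hm (fun g => f g⁻¹) (hf.comp _) a⁻¹
  simpa [FinMean.map_apply] using this

theorem abs_prod_le_one {κ : Type*} {s : Finset κ} {f : κ → ℝ} (h : ∀ k ∈ s, |f k| ≤ 1) :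
    |∏ k ∈ s, f k| ≤ 1 := by
  rw [Finset.abs_prod]
  exact Finset.prod_le_one (fun _ _ => abs_nonneg _) h

theorem abs_mul_comp_le_one {α : Type*} {f : α → ℝ} (hf : ∀ x, |f x| ≤ 1) (φ : α → α) (x : α) :
    |f x * f (φ x)| ≤ 1 := by
  rw [abs_mul]
  exact mul_le_one₀ (hf _) (abs_nonneg _) (hf _)

section Cut

variable {ι G : Type*} [DecidableEq ι] [Group G]

/-- The element of `ι → G` obtained from `g` by replacing the coordinates outside `e` by `1`. -/
def cut (e : Finset ι) (g : ι → G) : ι → G := fun i => if i ∈ e then g i else 1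

theorem cut_mul (e : Finset ι) (g h : ι → G) : cut e (g * h) = cut e g * cut e h := by
  funext i; by_cases hi : i ∈ e <;> simp [cut, hi]

theorem cut_mulSingle {e : Finset ι} {i : ι} (hi : i ∈ e) (t : G) :
    cut e (Pi.mulSingle i t) = Pi.mulSingle i t := by
  funext j
  rcases eq_or_ne j i with rfl | h
  · simp [cut, hi]
  · simp [cut, h]

theorem cut_mulSingle_of_notMem {e : Finset ι} {i : ι} (hi : i ∉ e) (t : G) :
    cut e (Pi.mulSingle i t) = 1 := by
  funext j
  rcases eq_or_ne j i with rfl | h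
  · simp [cut, hi]
  · simp [cut, h]

theorem cut_eq_mulSingle_mul {e : Finset ι} {i : ι} (hi : i ∈ e) (g : ι → G) :
    cut e g = Pi.mulSingle i (g i) * cut (e.erase i) g := by
  funext j
  rcases eq_or_ne j i with rfl | h
  · simp [cut, hi]
  · simp [cut, h]

theorem cut_eq_mul_mulSingle {e : Finset ι} {i : ι} (hi : i ∈ e) (g : ι → G) :
    cut e g = cut (e.erase i) g * Pi.mulSingle i (g i) := by
  funext j
  rcases eq_or_ne j i with rfl | h
  · simp [cut, hi]
  · simp [cut, h]

theorem cut_empty (g : ι → G) : cut ∅ g = 1 := by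
  funext i; simp [cut]

/-- Insert `i` into `e`, or remove it. -/
def toggle (i : ι) (e : Finset ι) : Finset ι := if i ∈ e then e.erase i else insert i e

theorem toggle_involutive (i : ι) : Function.Involutive (toggle i) := by
  intro e
  by_cases hi : i ∈ e <;> simp [toggle, hi]

theorem prod_ite_mem_eq_prod_ite_notMem [Fintype ι] (i : ι) (A : Finset ι → Finset ι → ℝ) :
    ∏ e, (if i ∈ e then A (e.erase i) e else 1) =
      ∏ e, (if i ∈ e then 1 else A e (insert i e)) := by
  refine Fintype.prod_bijective _ (toggle_involutive i).bijective _ _ fun e => ?_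
  by_cases hi : i ∈ e <;> simp [toggle, hi]

end Cut

/-- A measure-preserving system in the finitely additive sense: an action together with an invariant
mean. -/
structure MeanSys (Γ : Type v) [Group Γ] where
  Ω : Type v
  [act : MulAction Γ Ω]
  m : FinMean Ω
  invariant : ∀ f, IsBdd f → ∀ g : Γ, m (fun x => f (g • x)) = m f

attribute [instance] MeanSys.act

namespace MeanSys

section Average

variable {ι : Type} {G : Type v} [DecidableEq ι] [Group G] (S : MeanSys (ι → G))

/-- The family obtained from `F` by a multiplicative differentiation in the direction `i`. -/
def diff (F : Finset ι → S.Ω → ℝ) (i : ι) (t : G) : Finset ι → S.Ω → ℝ := fun e x =>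
  if i ∈ e then 1 else
    F (insert i e) x * F (insert i e) ((Pi.mulSingle i t : ι → G) • x)

variable {S}

theorem abs_diff_le_one {F : Finset ι → S.Ω → ℝ} (hF : ∀ e x, |F e x| ≤ 1) (i : ι) (t : G)
    (e : Finset ι) (x : S.Ω) : |S.diff F i t e x| ≤ 1 := by
  unfold diff
  split_ifs
  · simp
  · rw [abs_mul]
    exact mul_le_one₀ (hF _ _) (abs_nonneg _) (hF _ _)

variable [Fintype ι]

variable (S) in
/-- The average over `g`, along the mean `M`, of the correlations of the functions `F e`, moved by
the elements `cut e g`. -/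
def cubeAvg (M : FinMean (ι → G)) (F : Finset ι → S.Ω → ℝ) : ℝ :=
  M fun g => S.m fun x => ∏ e, F e (cut e g • x)

theorem abs_cubeAvg_le_one (M : FinMean (ι → G)) {F : Finset ι → S.Ω → ℝ}
    (hF : ∀ e x, |F e x| ≤ 1) : |S.cubeAvg M F| ≤ 1 :=
  M.abs_le fun _ => S.m.abs_le fun _ => abs_prod_le_one fun _ _ => hF _ _

theorem sq_cubeAvg_le (M : FinMean (ι → G)) (hM : ∀ f, IsBdd f → ∀ a, M (fun g => f (a * g)) = M f)
    (ρ : FinMean G) (hρ : ∀ f, IsBdd f → ∀ a, ρ (fun g => f (g * a)) = ρ f)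
    {F : Finset ι → S.Ω → ℝ} (hF : ∀ e x, |F e x| ≤ 1) (i : ι) :
    S.cubeAvg M F ^ 2 ≤ ρ fun t => S.cubeAvg M (S.diff F i t) := by
  let N : FinMean ((ι → G) × S.Ω) := M.bind fun g => S.m.map fun x => (g, x)
  have hN : ∀ f, N f = M fun g => S.m fun x => f (g, x) := fun f => rfl
  refine N.sq_le_of_forall_correlation ρ
    (fun p => ∏ e, if i ∈ e then 1 else F e (cut e p.1 • p.2))
    (fun t p => ∏ e, if i ∈ e then F e (cut e (Pi.mulSingle i t * p.1) • p.2) else 1)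
    (fun p => abs_prod_le_one fun e _ => ?_) (fun t p => abs_prod_le_one fun e _ => ?_)
    (fun t => ?_) fun t => ?_
  · split_ifs
    · simp
    · exact hF _ _
  · split_ifs
    · exact hF _ _
    · simp
  · have h1 : ∀ p : (ι → G) × S.Ω, ((∏ e, if i ∈ e then 1 else F e (cut e p.1 • p.2)) *
        ∏ e, if i ∈ e then F e (cut e (Pi.mulSingle i t * p.1) • p.2) else 1) =
        ∏ e, F e (cut e (Pi.mulSingle i t * p.1) • p.2) := by
      intro p
      rw [← Finset.prod_mul_distrib]
      refine Finset.prod_congr rfl fun e _ => ?_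
      by_cases hi : i ∈ e
      · simp [hi]
      · simp [hi, cut_mul, cut_mulSingle_of_notMem]
    simp only [h1, hN]
    exact hM (fun g => S.m fun x => ∏ e, F e (cut e g • x))
      ⟨1, fun g => S.m.abs_le fun x => abs_prod_le_one fun e _ => hF _ _⟩ (Pi.mulSingle i t)
  · have hb : ∀ s : G, IsBdd fun g : ι → G => S.m fun x => ∏ e, if i ∈ e then
        F e (cut e g • x) * F e ((Pi.mulSingle i s : ι → G) • cut e g • x) else 1 := fun s =>
      ⟨1, fun g => S.m.abs_le fun x => abs_prod_le_one fun e _ => by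
        split_ifs
        · rw [abs_mul]
          exact mul_le_one₀ (hF _ _) (abs_nonneg _) (hF _ _)
        · simp⟩
    have h1 : ∀ t', N (fun p => (∏ e, if i ∈ e then
        F e (cut e (Pi.mulSingle i t * p.1) • p.2) else 1) *
        ∏ e, if i ∈ e then F e (cut e (Pi.mulSingle i t' * p.1) • p.2) else 1) =
        S.cubeAvg M (S.diff F i (t' * t⁻¹)) := by
      intro t'
      have h2 := hM _ (hb (t' * t⁻¹)) (Pi.mulSingle i t)
      have h3 : ∀ g : ι → G, (S.m fun x => ∏ e, if i ∈ e then
          F e (cut e g • x) * F e ((Pi.mulSingle i (t' * t⁻¹) : ι → G) • cut e g • x) else 1) =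
          S.m fun x => ∏ e, S.diff F i (t' * t⁻¹) e (cut e g • x) := by
        intro g
        have h4 := S.invariant (fun x => ∏ e, S.diff F i (t' * t⁻¹) e (cut e g • x))
          ⟨1, fun x => abs_prod_le_one fun e _ => abs_diff_le_one hF _ _ _ _⟩
          (Pi.mulSingle i (g i))
        rw [← h4]
        congr 1
        funext x
        have h5 := prod_ite_mem_eq_prod_ite_notMem i fun e e' =>
          F e' (cut e g • (Pi.mulSingle i (g i) : ι → G) • x) *
          F e' ((Pi.mulSingle i (t' * t⁻¹) : ι → G) •
            cut e g • (Pi.mulSingle i (g i) : ι → G) • x)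
        refine Eq.trans (Finset.prod_congr rfl fun e _ => ?_) h5
        by_cases hi : i ∈ e
        · simp only [hi, if_true, smul_smul, cut_eq_mul_mulSingle hi g]
        · simp [hi]
      rw [hN, cubeAvg, ← funext h3, ← h2]
      simp only [← Finset.prod_mul_distrib]
      congr 1
      funext g
      congr 1
      funext x
      refine Finset.prod_congr rfl fun e _ => ?_
      by_cases hi : i ∈ e
      · have h6 : (Pi.mulSingle i t' : ι → G) =
            Pi.mulSingle i (t' * t⁻¹) * Pi.mulSingle i t := by
          rw [← Pi.mulSingle_mul]; simp
        simp only [hi, if_true, cut_mul, cut_mulSingle hi, smul_smul, h6, mul_assoc]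
      · simp [hi]
    simp only [h1]
    exact hρ (fun s => S.cubeAvg M (S.diff F i s))
      ⟨1, fun s => abs_cubeAvg_le_one M (abs_diff_le_one hF i s)⟩ t⁻¹

end Average

end MeanSys

namespace MeanSys

/-- An extension of systems: an equivariant mean-preserving map. -/
structure Ext {Γ : Type v} [Group Γ] (S S' : MeanSys Γ) where
  π : S'.Ω → S.Ω
  map_smul : ∀ (g : Γ) x, π (g • x) = g • π x
  mean_comp : ∀ f, IsBdd f → S'.m (fun x => f (π x)) = S.m f

/-- The trivial extension. -/
def Ext.refl {Γ : Type v} [Group Γ] (S : MeanSys Γ) : S.Ext S :=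
  ⟨id, fun _ _ => rfl, fun _ _ => rfl⟩

/-- The composition of two extensions. -/
def Ext.trans {Γ : Type v} [Group Γ] {S S' S'' : MeanSys Γ} (E : S.Ext S') (E' : S'.Ext S'') :
    S.Ext S'' where
  π x := E.π (E'.π x)
  map_smul g x := by rw [E'.map_smul, E.map_smul]
  mean_comp f hf := by rw [E'.mean_comp (fun x => f (E.π x)) (hf.comp _), E.mean_comp f hf]

section Box

variable {ι : Type} {G : Type v} [DecidableEq ι] [Group G] (S : MeanSys (ι → G))

/-- The box average of `f` in the directions `l`. -/
def box (ρ : FinMean G) : List ι → (S.Ω → ℝ) → ℝ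
  | [], f => S.m f
  | i :: l, f => ρ fun t => box ρ l fun x => f x * f ((Pi.mulSingle i t : ι → G) • x)

/-- Invariance under the action of the coordinate `i`. -/
def AxisInvariant (i : ι) (a : S.Ω → ℝ) : Prop :=
  ∀ (t : G) x, a ((Pi.mulSingle i t : ι → G) • x) = a x

/-- The functions that are combinations of products of bounded functions, each invariant in some
direction of `e`. -/
def structured (e : Finset ι) : Subalgebra ℝ (S.Ω → ℝ) :=
  Algebra.adjoin ℝ {a | IsBdd a ∧ ∃ i ∈ e, S.AxisInvariant i a}

variable {S}

theorem abs_box_le_one (ρ : FinMean G) (l : List ι) :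
    ∀ f : S.Ω → ℝ, (∀ x, |f x| ≤ 1) → |S.box ρ l f| ≤ 1 := by
  induction l with
  | nil => exact fun f hf => S.m.abs_le hf
  | cons i l ih => exact fun f hf => ρ.abs_le fun t => ih _ (abs_mul_comp_le_one hf _)

theorem cubeAvg_eq_mean [Fintype ι] (M : FinMean (ι → G)) {F : Finset ι → S.Ω → ℝ} (e : Finset ι)
    (he : IsBdd (F e)) (hF : ∀ e', e' ≠ e → ∀ x, F e' x = 1) : S.cubeAvg M F = S.m (F e) := by
  have : ∀ g : ι → G, (S.m fun x => ∏ e, F e (cut e g • x)) = S.m (F e) := by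
    intro g
    rw [← S.invariant (F e) he (cut e g)]
    congr 1
    funext x
    exact Fintype.prod_eq_single e fun e' h => hF e' h _
  simp only [cubeAvg, this, M.map_const]

theorem cubeAvg_pow_le_box [Fintype ι] (M : FinMean (ι → G))
    (hM : ∀ f, IsBdd f → ∀ a, M (fun g => f (a * g)) = M f)
    (ρ : FinMean G) (hρ : ∀ f, IsBdd f → ∀ a, ρ (fun g => f (g * a)) = ρ f) (l : List ι) :
    ∀ F : Finset ι → S.Ω → ℝ, l.Nodup → (∀ e x, |F e x| ≤ 1) →
      (∀ e, l.toFinset ⊂ e → ∀ x, F e x = 1) →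
      S.cubeAvg M F ^ 2 ^ l.length ≤ S.box ρ l (F l.toFinset) := by
  induction l with
  | nil =>
    intro F _ hF h1
    rw [cubeAvg_eq_mean M ∅ ⟨1, hF ∅⟩ fun e he => h1 e (by
      simpa using Finset.nonempty_iff_ne_empty.2 he)]
    simp [box]
  | cons i l ih =>
    intro F hl hF h1
    rw [List.nodup_cons] at hl
    have hil : i ∉ l.toFinset := by simpa using hl.1
    have hb : IsBdd fun t => S.cubeAvg M (S.diff F i t) :=
      ⟨1, fun t => abs_cubeAvg_le_one M (abs_diff_le_one hF i t)⟩
    have h2 := sq_cubeAvg_le M hM ρ hρ hF i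
    rw [List.length_cons, pow_succ', pow_mul]
    refine (pow_le_pow_left₀ (sq_nonneg _) h2 _).trans ((ρ.pow_two_pow_le hb _).trans ?_)
    refine ρ.mono (hb.pow _) ⟨1, fun t => abs_box_le_one ρ l _ (abs_mul_comp_le_one (hF _) _)⟩
      fun t => ?_
    refine (ih _ hl.2 (abs_diff_le_one hF i t) fun e he x => ?_).trans (le_of_eq ?_)
    · unfold diff
      split_ifs with hi
      · rfl
      · have : (i :: l).toFinset ⊂ insert i e := by
          rw [List.toFinset_cons]
          refine Finset.ssubset_iff_subset_ne.2 ⟨Finset.insert_subset_insert _ he.1, fun h => ?_⟩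
          exact he.ne (by rw [← Finset.erase_insert hil, h, Finset.erase_insert hi])
        rw [h1 _ this, h1 _ this, one_mul]
    · congr 1
      funext x
      simp [diff, hl.1]

theorem exists_ext_box_eq (ρ : FinMean G)
    (hρ : ∀ f, IsBdd f → ∀ a, ρ (fun g => f (g * a)) = ρ f) (l : List ι) (hl : l.Nodup) :
    ∃ (S' : MeanSys (ι → G)) (E : S.Ext S'), ∀ f : S.Ω → ℝ, (∀ x, |f x| ≤ 1) →
      ∃ a : ι → S'.Ω → ℝ, (∀ i ∈ l, S'.AxisInvariant i (a i)) ∧ (∀ i x, |a i x| ≤ 1) ∧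
        S.box ρ l f = S'.m fun x => f (E.π x) * ∏ i ∈ l.toFinset, a i x := by
  induction l with
  | nil =>
    refine ⟨S, Ext.refl S, fun f hf => ⟨fun _ _ => 1, by simp, by simp, ?_⟩⟩
    simp [box, Ext.refl]
  | cons i l ih =>
    rw [List.nodup_cons] at hl
    obtain ⟨S', E, h⟩ := ih hl.2
    let act : MulAction (ι → G) (S'.Ω × G) :=
      { smul := fun g p => (g • p.1, p.2 * (g i)⁻¹)
        one_smul := fun p => by
          change ((1 : ι → G) • p.1, p.2 * ((1 : ι → G) i)⁻¹) = p
          simp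
        mul_smul := fun g g' p => by
          change ((g * g') • p.1, p.2 * ((g * g') i)⁻¹) = (g • g' • p.1, p.2 * (g' i)⁻¹ * (g i)⁻¹)
          simp [mul_smul, mul_assoc] }
    let S'' : MeanSys (ι → G) :=
      { Ω := S'.Ω × G
        act := act
        m := ρ.bind fun t => S'.m.map fun y => (y, t)
        invariant := by
          intro f hf g
          have h1 : ∀ t, (S'.m fun y => f (g • y, t * (g i)⁻¹)) =
              S'.m fun y => f (y, t * (g i)⁻¹) := fun t =>
            S'.invariant (fun y => f (y, t * (g i)⁻¹)) (hf.comp _) g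
          obtain ⟨C, hC⟩ := hf
          exact (congrArg ρ (funext h1)).trans
            (hρ (fun t => S'.m fun y => f (y, t)) ⟨C, fun t => S'.m.abs_le fun y => hC _⟩ _) }
    have hm : ∀ f : S'.Ω × G → ℝ, S''.m f = ρ fun t => S'.m fun y => f (y, t) := fun f => rfl
    let E' : S'.Ext S'' :=
      { π := fun p => p.1
        map_smul := fun _ _ => rfl
        mean_comp := fun f _ => (hm _).trans (ρ.map_const (S'.m f)) }
    refine ⟨S'', E.trans E', fun f hf => ?_⟩
    choose a ha1 ha2 ha3 using fun t : G =>
      h (fun x => f x * f ((Pi.mulSingle i t : ι → G) • x)) (abs_mul_comp_le_one hf _)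
    refine ⟨fun j p => if j = i then f ((Pi.mulSingle i p.2 : ι → G) • E.π p.1) else a p.2 j p.1,
      fun j hj => ?_, fun j p => ?_, ?_⟩
    · rintro t ⟨y, s⟩
      change (if j = i then f ((Pi.mulSingle i (s * ((Pi.mulSingle j t : ι → G) i)⁻¹) : ι → G) •
        E.π ((Pi.mulSingle j t : ι → G) • y)) else a (s * ((Pi.mulSingle j t : ι → G) i)⁻¹) j
          ((Pi.mulSingle j t : ι → G) • y)) =
        if j = i then f ((Pi.mulSingle i s : ι → G) • E.π y) else a s j y
      rcases eq_or_ne j i with rfl | hji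
      · simp [E.map_smul, smul_smul, ← Pi.mulSingle_mul]
      · have : j ∈ l := by simpa [hji] using hj
        simp [hji, hji.symm, ha1 s j this t y]
    · dsimp only
      split_ifs
      · exact hf _
      · exact ha2 _ _ _
    · refine Eq.trans ?_ (hm _).symm
      refine congrArg ρ (funext fun t => (ha3 t).trans (congrArg S'.m (funext fun y => ?_)))
      have hil : i ∉ l.toFinset := by simpa using hl.1
      rw [List.toFinset_cons, Finset.prod_insert hil]
      dsimp only
      rw [if_pos rfl, ← mul_assoc]
      exact congrArg _ (Finset.prod_congr rfl fun j hj =>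
        (if_neg fun h : j = i => hil (h ▸ hj)).symm)

end Box

end MeanSys

namespace MeanSys

section Structured

variable {ι : Type} {G : Type v} [DecidableEq ι] [Group G] {S : MeanSys (ι → G)}

theorem isBdd_of_mem_structured {e : Finset ι} {s : S.Ω → ℝ} (hs : s ∈ S.structured e) :
    IsBdd s := by
  induction hs using Algebra.adjoin_induction with
  | mem x hx => exact hx.1
  | algebraMap r => exact IsBdd.const r
  | add x y _ _ hx hy => exact hx.add hy
  | mul x y _ _ hx hy => exact hx.mul hy

theorem Ext.comp_mem_structured {S' : MeanSys (ι → G)} (E : S.Ext S') {e : Finset ι} {s : S.Ω → ℝ}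
    (hs : s ∈ S.structured e) : (fun x => s (E.π x)) ∈ S'.structured e := by
  induction hs using Algebra.adjoin_induction with
  | mem x hx =>
    obtain ⟨hb, i, hi, ha⟩ := hx
    exact Algebra.subset_adjoin ⟨hb.comp _, i, hi, fun t y =>
      (congrArg x (E.map_smul _ _)).trans (ha t _)⟩
  | algebraMap r => exact (S'.structured e).algebraMap_mem r
  | add x y _ _ hx hy => exact add_mem hx hy
  | mul x y _ _ hx hy => exact mul_mem hx hy

/-- Structured functions can be clipped to an interval, up to a small error. -/
theorem exists_clip_mem_structured {e : Finset ι} {s : S.Ω → ℝ} (hs : s ∈ S.structured e) {η : ℝ}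
    (hη : 0 < η) : ∃ s' ∈ S.structured e, ∀ x, |s' x - max (-1) (min 1 (s x))| ≤ η := by
  obtain ⟨C, hC⟩ := isBdd_of_mem_structured hs
  obtain ⟨p, hp⟩ := exists_polynomial_near_of_continuousOn (-C) C
    (fun y => max (-1) (min 1 y)) (by fun_prop) η hη
  refine ⟨Polynomial.aeval s p, ?_, fun x => ?_⟩
  · exact Algebra.adjoin_le (Set.singleton_subset_iff.2 hs)
      (Polynomial.aeval_mem_adjoin_singleton ℝ s)
  · have : (Polynomial.aeval s p) x = p.eval (s x) := by
      rw [Polynomial.aeval_fn_apply, Polynomial.coe_aeval_eq_eval]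
    rw [this]
    exact (hp _ (abs_le.1 (hC x))).le

theorem sq_sub_le_of_abs_sub_clip_le {a b c η : ℝ} (ha : |a| ≤ 1) (hη : 0 < η) (hη1 : η ≤ 1)
    (h : |c - max (-1) (min 1 b)| ≤ η) : (a - c) ^ 2 ≤ (a - b) ^ 2 + 5 * η := by
  set b' := max (-1) (min 1 b) with hb'
  have ha' := abs_le.1 ha
  have h' := abs_le.1 h
  have h1 : b' ≤ 1 := max_le (by norm_num) (min_le_left _ _)
  have h2 : -1 ≤ b' := le_max_left _ _
  have h3 : (a - b') ^ 2 ≤ (a - b) ^ 2 := by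
    rcases le_total b (-1) with hb | hb
    · have : b' = -1 := by
        rw [hb', min_eq_right (by linarith), max_eq_left hb]
      rw [this]; nlinarith
    · rcases le_total b 1 with hb1 | hb1
      · have : b' = b := by rw [hb', min_eq_right hb1, max_eq_right hb]
        rw [this]
      · have : b' = 1 := by rw [hb', min_eq_left hb1, max_eq_right (by norm_num)]
        rw [this]; nlinarith
  have h4 : (c - b') ^ 2 ≤ η := by nlinarith
  have h5 : -2 * (a - b') * (c - b') ≤ 4 * η := by
    have h6 : |a - b'| ≤ 2 := abs_le.2 ⟨by linarith, by linarith⟩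
    calc -2 * (a - b') * (c - b') ≤ |-2 * (a - b') * (c - b')| := le_abs_self _
      _ = 2 * |a - b'| * |c - b'| := by rw [abs_mul, abs_mul]; norm_num
      _ ≤ 2 * 2 * η := by gcongr
      _ = 4 * η := by ring
  nlinarith

/-- After passing to an extension, a function is the sum of a structured function and a function
that is almost orthogonal to all structured products in all further extensions. -/
theorem exists_sated (e : Finset ι) {f : S.Ω → ℝ} (hf : ∀ x, |f x| ≤ 1) {δ : ℝ} (hδ : 0 < δ)
    (hδ1 : δ ≤ 1) :
    ∃ (S₁ : MeanSys (ι → G)) (E₁ : S.Ext S₁) (s : S₁.Ω → ℝ), s ∈ S₁.structured e ∧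
      (∀ x, |s x| ≤ 2) ∧ ∀ (S₂ : MeanSys (ι → G)) (E₂ : S₁.Ext S₂) (a : ι → S₂.Ω → ℝ),
        (∀ i ∈ e, S₂.AxisInvariant i (a i)) → (∀ i x, |a i x| ≤ 1) →
        (S₂.m fun x => (f (E₁.π (E₂.π x)) - s (E₂.π x)) * ∏ i ∈ e, a i x) ≤ δ := by
  let D : Set ℝ := {r | ∃ (S₁ : MeanSys (ι → G)) (E₁ : S.Ext S₁) (s : S₁.Ω → ℝ),
    s ∈ S₁.structured e ∧ r = S₁.m fun x => (f (E₁.π x) - s x) ^ 2}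
  have hfb : IsBdd f := ⟨1, hf⟩
  have hD : BddBelow D := by
    refine ⟨0, ?_⟩
    rintro _ ⟨S₁, E₁, s, hs, rfl⟩
    exact S₁.m.nonneg' _ (((hfb.comp _).sub (isBdd_of_mem_structured hs)).pow 2)
      fun x => sq_nonneg _
  have hne : D.Nonempty := ⟨_, S, Ext.refl S, 0, zero_mem _, rfl⟩
  obtain ⟨_, ⟨S₁, E₁, s₀, hs₀, rfl⟩, hlt⟩ := exists_lt_of_csInf_lt hne
    (lt_add_of_pos_right (sInf D) (show 0 < δ ^ 2 / 4 by positivity))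
  have hη : 0 < δ ^ 2 / 20 := by positivity
  have hη1 : δ ^ 2 / 20 ≤ 1 := by nlinarith
  obtain ⟨s, hs, hclip⟩ := exists_clip_mem_structured hs₀ hη
  have hsb := isBdd_of_mem_structured hs
  have hs₀b := isBdd_of_mem_structured hs₀
  have hs2 : S₁.m (fun x => (f (E₁.π x) - s x) ^ 2) < sInf D + δ ^ 2 / 2 := by
    have h1 := S₁.m.mono (((hfb.comp E₁.π).sub hsb).pow 2)
      ((((hfb.comp E₁.π).sub hs₀b).pow 2).add (.const (5 * (δ ^ 2 / 20))))
      fun x => sq_sub_le_of_abs_sub_clip_le (hf (E₁.π x)) hη hη1 (hclip x)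
    rw [S₁.m.map_add (fun x => (f (E₁.π x) - s₀ x) ^ 2), S₁.m.map_const] at h1
    linarith
  refine ⟨S₁, E₁, s, hs, fun x => ?_, fun S₂ E₂ a ha ha1 => ?_⟩
  · have h1 := abs_le.1 (hclip x)
    have h2 : max (-1) (min 1 (s₀ x)) ≤ 1 := max_le (by norm_num) (min_le_left _ _)
    have h3 : -1 ≤ max (-1) (min 1 (s₀ x)) := le_max_left _ _
    exact abs_le.2 ⟨by linarith, by linarith⟩
  · by_contra! hcon
    set ψ : S₂.Ω → ℝ := fun x => ∏ i ∈ e, a i x with hψ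
    have hψ1 : ∀ x, |ψ x| ≤ 1 := fun x => abs_prod_le_one fun i _ => ha1 i x
    have hψs : ψ ∈ S₂.structured e := by
      have : ψ = ∏ i ∈ e, a i := by funext x; simp [hψ]
      rw [this]
      exact prod_mem fun i hi => Algebra.subset_adjoin ⟨⟨1, ha1 i⟩, i, hi, ha i hi⟩
    have hmem : (fun x => s (E₂.π x) + δ * ψ x) ∈ S₂.structured e :=
      add_mem (E₂.comp_mem_structured hs) ((S₂.structured e).smul_mem hψs δ)
    have h1 := csInf_le hD ⟨S₂, E₁.trans E₂, _, hmem, rfl⟩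
    have h2 : (S₂.m fun x => (f ((E₁.trans E₂).π x) - (s (E₂.π x) + δ * ψ x)) ^ 2) =
        S₁.m (fun x => (f (E₁.π x) - s x) ^ 2) -
          2 * δ * (S₂.m fun x => (f (E₁.π (E₂.π x)) - s (E₂.π x)) * ψ x) +
          δ ^ 2 * S₂.m fun x => ψ x ^ 2 := by
      rw [← E₂.mean_comp _ (((hfb.comp E₁.π).sub hsb).pow 2), ← FinMean.map_mul_left,
        ← FinMean.map_mul_left, ← FinMean.map_sub, ← FinMean.map_add]
      congr 1
      funext x
      simp only [Ext.trans]
      ring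
    have h3 : (S₂.m fun x => ψ x ^ 2) ≤ 1 := (le_abs_self _).trans (S₂.m.abs_le fun x => by
      rw [abs_pow]; exact pow_le_one₀ (abs_nonneg _) (hψ1 x))
    nlinarith [mul_lt_mul_of_pos_left hcon hδ, mul_le_mul_of_nonneg_left h3 (sq_nonneg δ)]

end Structured

end MeanSys

namespace MeanSys

section Independence

variable {ι : Type} {G : Type v} [DecidableEq ι] [Fintype ι] [Group G] {S : MeanSys (ι → G)}

theorem cubeAvg_comp_ext {S' : MeanSys (ι → G)} (E : S.Ext S') (M : FinMean (ι → G))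
    {F : Finset ι → S.Ω → ℝ} (hF : ∀ e, IsBdd (F e)) :
    S'.cubeAvg M (fun e x => F e (E.π x)) = S.cubeAvg M F := by
  unfold cubeAvg
  congr 1
  funext g
  rw [← E.mean_comp _ (IsBdd.prod fun e _ => (hF e).comp fun x => cut e g • x)]
  simp only [E.map_smul]

theorem cubeAvg_update (M : FinMean (ι → G)) (F : Finset ι → S.Ω → ℝ) (e : Finset ι)
    (f : S.Ω → ℝ) : S.cubeAvg M (Function.update F e f) =
      M fun g => S.m fun x => f (cut e g • x) * ∏ e' ∈ Finset.univ.erase e, F e' (cut e' g • x) := by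
  unfold cubeAvg
  congr 1
  funext g
  congr 1
  funext x
  rw [← Finset.mul_prod_erase _ _ (Finset.mem_univ e), Function.update_self]
  congr 1
  exact Finset.prod_congr rfl fun e' he' => by
    rw [Function.update_of_ne (Finset.ne_of_mem_erase he')]

theorem cubeAvg_update_add (M : FinMean (ι → G)) (F : Finset ι → S.Ω → ℝ) (e : Finset ι)
    (f f' : S.Ω → ℝ) : S.cubeAvg M (Function.update F e (f + f')) =
      S.cubeAvg M (Function.update F e f) + S.cubeAvg M (Function.update F e f') := by
  simp only [cubeAvg_update, Pi.add_apply, add_mul, FinMean.map_add]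

theorem cubeAvg_update_smul (M : FinMean (ι → G)) (F : Finset ι → S.Ω → ℝ) (e : Finset ι)
    (c : ℝ) (f : S.Ω → ℝ) : S.cubeAvg M (Function.update F e (c • f)) =
      c * S.cubeAvg M (Function.update F e f) := by
  simp only [cubeAvg_update, Pi.smul_apply, smul_eq_mul, mul_assoc, FinMean.map_mul_left]

theorem cubeAvg_mul_const (M : FinMean (ι → G)) (F : Finset ι → S.Ω → ℝ) (c : Finset ι → ℝ) :
    S.cubeAvg M (fun e x => c e * F e x) = (∏ e, c e) * S.cubeAvg M F := by
  simp only [cubeAvg, Finset.prod_mul_distrib, FinMean.map_mul_left]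

/-- A factor that is invariant in the direction `i` can be moved from the slot `e` to the slot
`e.erase i`. -/
theorem cubeAvg_update_mul_axisInvariant (M : FinMean (ι → G)) (F : Finset ι → S.Ω → ℝ)
    {e : Finset ι} {i : ι} (hi : i ∈ e) {a : S.Ω → ℝ} (ha : S.AxisInvariant i a) (f : S.Ω → ℝ) :
    S.cubeAvg M (Function.update F e (a * f)) = S.cubeAvg M
      (Function.update (Function.update F (e.erase i) (a * F (e.erase i))) e f) := by
  have hne : e.erase i ∈ Finset.univ.erase e :=
    Finset.mem_erase.2 ⟨(Finset.erase_ssubset hi).ne, Finset.mem_univ _⟩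
  rw [cubeAvg_update, cubeAvg_update]
  congr 1
  funext g
  congr 1
  funext x
  have h1 : a (cut e g • x) = a (cut (e.erase i) g • x) := by
    rw [cut_eq_mulSingle_mul hi g, mul_smul, ha]
  have h2 : ∏ e' ∈ (Finset.univ.erase e).erase (e.erase i),
      Function.update F (e.erase i) (a * F (e.erase i)) e' (cut e' g • x) =
      ∏ e' ∈ (Finset.univ.erase e).erase (e.erase i), F e' (cut e' g • x) :=
    Finset.prod_congr rfl fun e' he' => by rw [Function.update_of_ne (Finset.ne_of_mem_erase he')]
  rw [← Finset.mul_prod_erase _ _ hne, ← Finset.mul_prod_erase _ _ hne, h2, Function.update_self,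
    Pi.mul_apply, Pi.mul_apply, h1]
  ring

variable {M M' : FinMean (ι → G)} {ρ : FinMean G}
  (hM : ∀ f, IsBdd f → ∀ a, M (fun g => f (a * g)) = M f)
  (hM' : ∀ f, IsBdd f → ∀ a, M' (fun g => f (a * g)) = M' f)
  (hρ : ∀ f, IsBdd f → ∀ a, ρ (fun g => f (g * a)) = ρ f)

/-- If the averages do not depend on the mean when the slot `e` is trivial, then they do not when
the slot `e` is structured. -/
theorem cubeAvg_update_structured {𝓓 : Finset (Finset ι)} {e : Finset ι}
    (h𝓓 : ∀ i, e.erase i ∈ 𝓓)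
    (ih : ∀ F : Finset ι → S.Ω → ℝ, (∀ e', IsBdd (F e')) →
      (∀ e', e' ∉ 𝓓.erase e → ∀ x, F e' x = 1) → S.cubeAvg M F = S.cubeAvg M' F)
    {s : S.Ω → ℝ} (hs : s ∈ S.structured e) {F : Finset ι → S.Ω → ℝ} (hF : ∀ e', IsBdd (F e'))
    (hF1 : ∀ e', e' ∉ 𝓓 → ∀ x, F e' x = 1) :
    S.cubeAvg M (Function.update F e s) = S.cubeAvg M' (Function.update F e s) := by
  have hs' : s ∈ Submodule.span ℝ
      (Submonoid.closure {a | IsBdd a ∧ ∃ i ∈ e, S.AxisInvariant i a} : Set (S.Ω → ℝ)) := by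
    rw [← Algebra.adjoin_eq_span]
    exact hs
  clear hs
  induction hs' using Submodule.span_induction with
  | mem s hs =>
    induction hs using Submonoid.closure_induction_left generalizing F with
    | one =>
      refine ih _ (fun e' => ?_) fun e' he' x => ?_
      · rcases eq_or_ne e' e with rfl | h
        · rw [Function.update_self]; exact IsBdd.const 1
        · rw [Function.update_of_ne h]; exact hF e'
      · rcases eq_or_ne e' e with rfl | h
        · rw [Function.update_self]; rfl
        · rw [Function.update_of_ne h]
          exact hF1 e' (fun h' => he' (Finset.mem_erase.2 ⟨h, h'⟩)) x
    | mul_left a ha f _ hind =>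
      obtain ⟨hb, i, hi, hinv⟩ := ha
      rw [cubeAvg_update_mul_axisInvariant M F hi hinv,
        cubeAvg_update_mul_axisInvariant M' F hi hinv]
      refine hind (fun e' => ?_) fun e' he' x => ?_
      · rcases eq_or_ne e' (e.erase i) with rfl | h
        · rw [Function.update_self]; exact hb.mul (hF _)
        · rw [Function.update_of_ne h]; exact hF e'
      · have h : e' ≠ e.erase i := fun h => he' (h ▸ h𝓓 i)
        rw [Function.update_of_ne h]
        exact hF1 e' he' x
  | zero =>
    have h := fun M : FinMean (ι → G) => cubeAvg_update_smul (S := S) M F e 0 0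
    simp only [zero_smul, zero_mul] at h
    rw [h, h]
  | add f f' _ _ h h' => rw [cubeAvg_update_add, cubeAvg_update_add, h, h']
  | smul c f _ h => rw [cubeAvg_update_smul, cubeAvg_update_smul, h]

include hM hM' hρ

/-- The induction step of `cubeAvg_eq_cubeAvg` for families bounded by one. -/
theorem cubeAvg_eq_of_maximal {𝓓 : Finset (Finset ι)} {e : Finset ι} (he : e.Nonempty)
    (h𝓓 : ∀ i, e.erase i ∈ 𝓓) (hmax : ∀ e', e ⊂ e' → e' ∉ 𝓓)
    (ih : ∀ (S : MeanSys (ι → G)) (F : Finset ι → S.Ω → ℝ), (∀ e', IsBdd (F e')) →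
      (∀ e', e' ∉ 𝓓.erase e → ∀ x, F e' x = 1) → S.cubeAvg M F = S.cubeAvg M' F)
    {F : Finset ι → S.Ω → ℝ} (hF : ∀ e' x, |F e' x| ≤ 1)
    (hF1 : ∀ e', e' ∉ 𝓓 → ∀ x, F e' x = 1) :
    S.cubeAvg M F = S.cubeAvg M' F := by
  refine eq_of_abs_sub_le_all fun η' hη' => ?_
  obtain ⟨η, hη, hη1, hηη'⟩ : ∃ η : ℝ, 0 < η ∧ η ≤ 1 ∧ 6 * η ≤ η' :=
    ⟨min 1 (η' / 6), by positivity, min_le_left _ _, by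
      have := min_le_right 1 (η' / 6); linarith⟩
  have hk : e.toList.length ≠ 0 := by simpa using he.ne_empty
  obtain ⟨S₁, E₁, s, hs, hs2, hsat⟩ := exists_sated e (hF e)
    (δ := η ^ 2 ^ e.toList.length) (by positivity) (pow_le_one₀ hη.le hη1)
  set F₁ : Finset ι → S₁.Ω → ℝ := fun e' x => F e' (E₁.π x) with hF₁
  set h : S₁.Ω → ℝ := fun x => (1 / 3) * (F e (E₁.π x) - s x) with hh
  have hh1 : ∀ x, |h x| ≤ 1 := by
    intro x
    have h1 := abs_le.1 (hF e (E₁.π x))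
    have h2 := abs_le.1 (hs2 x)
    rw [hh]
    exact abs_le.2 ⟨by linarith, by linarith⟩
  have hdec : F₁ = Function.update F₁ e (s + (3 : ℝ) • h) := by
    have : s + (3 : ℝ) • h = F₁ e := by
      funext x
      simp only [hh, hF₁, Pi.add_apply, Pi.smul_apply, smul_eq_mul]
      ring
    rw [this, Function.update_eq_self]
  have herr : ∀ N : FinMean (ι → G), (∀ f, IsBdd f → ∀ a, N (fun g => f (a * g)) = N f) →
      |S₁.cubeAvg N (Function.update F₁ e h)| ≤ η := by
    intro N hN
    have h1 := cubeAvg_pow_le_box N hN ρ hρ e.toList (Function.update F₁ e h) e.nodup_toList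
      (fun e' x => by
        rcases eq_or_ne e' e with rfl | hne
        · rw [Function.update_self]; exact hh1 x
        · rw [Function.update_of_ne hne]; exact hF _ _)
      (fun e' he' x => by
        rw [Finset.toList_toFinset] at he'
        rw [Function.update_of_ne he'.ne']
        exact hF1 e' (hmax e' he') _)
    rw [Finset.toList_toFinset, Function.update_self] at h1
    obtain ⟨S₂, E₂, hbox⟩ := exists_ext_box_eq (S := S₁) ρ hρ e.toList e.nodup_toList
    obtain ⟨a, ha, ha1, hb⟩ := hbox h hh1
    rw [hb, Finset.toList_toFinset] at h1
    have h2 := hsat S₂ E₂ a (fun i hi => ha i (Finset.mem_toList.2 hi)) ha1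
    have h3 : (S₂.m fun x => h (E₂.π x) * ∏ i ∈ e, a i x) = (1 / 3) *
        S₂.m fun x => (F e (E₁.π (E₂.π x)) - s (E₂.π x)) * ∏ i ∈ e, a i x := by
      rw [← FinMean.map_mul_left]
      congr 1
      funext x
      simp only [hh]
      ring
    rw [h3] at h1
    have hpos : 0 < η ^ 2 ^ e.toList.length := by positivity
    have heven : Even (2 ^ e.toList.length) := Nat.even_pow.2 ⟨even_two, hk⟩
    refine le_of_pow_le_pow_left₀ (n := 2 ^ e.toList.length) (by positivity) hη.le ?_
    rw [heven.pow_abs]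
    linarith
  have hstr : S₁.cubeAvg M (Function.update F₁ e s) = S₁.cubeAvg M' (Function.update F₁ e s) :=
    cubeAvg_update_structured h𝓓 (ih S₁) hs (fun e' => ⟨1, fun x => hF _ _⟩)
      fun e' he' x => hF1 e' he' _
  rw [← cubeAvg_comp_ext E₁ M fun e' => ⟨1, hF e'⟩, ← cubeAvg_comp_ext E₁ M' fun e' => ⟨1, hF e'⟩]
  change |S₁.cubeAvg M F₁ - S₁.cubeAvg M' F₁| ≤ η'
  rw [hdec, cubeAvg_update_add, cubeAvg_update_add, cubeAvg_update_smul, cubeAvg_update_smul, hstr]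
  have h1 := abs_le.1 (herr M hM)
  have h2 := abs_le.1 (herr M' hM')
  exact abs_le.2 ⟨by linarith, by linarith⟩

/-- The averages do not depend on the choice of the invariant mean. -/
theorem cubeAvg_eq_of_downClosed (n : ℕ) : ∀ 𝓓 : Finset (Finset ι), 𝓓.card = n →
    (∀ e ∈ 𝓓, ∀ i, e.erase i ∈ 𝓓) → ∀ (S : MeanSys (ι → G)) (F : Finset ι → S.Ω → ℝ),
      (∀ e, IsBdd (F e)) → (∀ e, e ∉ 𝓓 → ∀ x, F e x = 1) → S.cubeAvg M F = S.cubeAvg M' F := by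
  induction n with
  | zero =>
    intro 𝓓 hc _ S F hF h1
    rw [Finset.card_eq_zero] at hc
    subst hc
    rw [cubeAvg_eq_mean M ∅ (hF ∅) fun e _ => h1 e (by simp),
      cubeAvg_eq_mean M' ∅ (hF ∅) fun e _ => h1 e (by simp)]
  | succ n ih =>
    intro 𝓓 hc h𝓓 S F hF h1
    by_cases hne : (𝓓.filter Finset.Nonempty).Nonempty
    · obtain ⟨e, he, hmax⟩ := Finset.exists_maximal hne
      rw [Finset.mem_filter] at he
      have hmax' : ∀ e', e ⊂ e' → e' ∉ 𝓓 := fun e' hee' he' =>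
        hee'.2 (hmax (Finset.mem_filter.2 ⟨he', he.2.mono hee'.1⟩) hee'.1)
      choose C hC using hF
      let c : Finset ι → ℝ := fun e' => if e' ∈ 𝓓 then max 1 (C e') else 1
      have hc1 : ∀ e', 1 ≤ c e' := fun e' => by
        simp only [c]
        split_ifs
        · exact le_max_left _ _
        · exact le_rfl
      have hFc : F = fun e' x => c e' * ((c e')⁻¹ * F e' x) := by
        funext e' x
        rw [mul_inv_cancel_left₀ (by linarith [hc1 e'])]
      rw [hFc, cubeAvg_mul_const M, cubeAvg_mul_const M']
      congr 1
      refine cubeAvg_eq_of_maximal hM hM' hρ he.2 (h𝓓 e he.1) hmax'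
        (ih (𝓓.erase e) (by rw [Finset.card_erase_of_mem he.1, hc]; rfl) fun e' he' i => ?_)
        (fun e' x => ?_) fun e' he' x => ?_
      · rw [Finset.mem_erase] at he' ⊢
        refine ⟨fun h => ?_, h𝓓 e' he'.2 i⟩
        exact hmax' e' (Finset.ssubset_iff_subset_ne.2
          ⟨h ▸ Finset.erase_subset _ _, he'.1.symm⟩) he'.2
      · rw [abs_mul, abs_inv, abs_of_pos (by linarith [hc1 e']),
          inv_mul_le_iff₀ (by linarith [hc1 e']), mul_one]
        by_cases h : e' ∈ 𝓓
        · simp only [c, if_pos h]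
          exact (hC e' x).trans (le_max_right _ _)
        · simp only [c, if_neg h, h1 e' h, abs_one, le_refl]
      · simp only [c, if_neg he', h1 e' he', inv_one, mul_one]
    · have h2 : ∀ e, e ≠ ∅ → ∀ x, F e x = 1 := fun e he => h1 e fun h =>
        hne ⟨e, Finset.mem_filter.2 ⟨h, Finset.nonempty_iff_ne_empty.2 he⟩⟩
      rw [cubeAvg_eq_mean M ∅ (hF ∅) h2, cubeAvg_eq_mean M' ∅ (hF ∅) h2]

/-- The averages do not depend on the choice of the invariant mean. -/
theorem cubeAvg_eq_cubeAvg (F : Finset ι → S.Ω → ℝ) (hF : ∀ e, IsBdd (F e)) :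
    S.cubeAvg M F = S.cubeAvg M' F :=
  cubeAvg_eq_of_downClosed hM hM' hρ _ Finset.univ rfl (by simp) S F hF (by simp)

end Independence

end MeanSys

section Positivity

variable {ι : Type} {G : Type v} [DecidableEq ι] [Group G]

theorem cut_insert {e : Finset ι} {i : ι} (hi : i ∉ e) (g : ι → G) (t : G) :
    cut (insert i e) (Function.update g i t) = Pi.mulSingle i t * cut e g := by
  funext j
  rcases eq_or_ne j i with rfl | h
  · simp [cut, hi]
  · simp [cut, h]

theorem cut_update {e : Finset ι} {i : ι} (hi : i ∉ e) (g : ι → G) (t : G) :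
    cut e (Function.update g i t) = cut e g := by
  funext j
  rcases eq_or_ne j i with rfl | h
  · simp [cut, hi]
  · simp [cut, h]

theorem cut_inv_mul [Fintype ι] (e : Finset ι) (g : ι → G) : cut e g⁻¹ * g = cut eᶜ g := by
  funext i; by_cases hi : i ∈ e <;> simp [cut, hi]

/-- The mean on `ι → G` that applies the mean `ρ` successively in the coordinates `l`, the other
coordinates being `1`. -/
noncomputable def FinMean.iterate (ρ : FinMean G) : List ι → FinMean (ι → G)
  | [] => FinMean.uniform {1} (Finset.singleton_nonempty 1)
  | i :: l => ρ.bind fun t => (FinMean.iterate ρ l).map fun g => Function.update g i t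

theorem FinMean.iterate_nil (ρ : FinMean G) (f : (ι → G) → ℝ) :
    FinMean.iterate ρ [] f = f 1 := by
  simp [FinMean.iterate, FinMean.uniform_apply]

theorem FinMean.iterate_cons (ρ : FinMean G) (i : ι) (l : List ι) (f : (ι → G) → ℝ) :
    FinMean.iterate ρ (i :: l) f =
      ρ fun t => FinMean.iterate ρ l fun g => f (Function.update g i t) := rfl

theorem FinMean.iterate_mul_right {ρ : FinMean G}
    (hρ : ∀ f, IsBdd f → ∀ a, ρ (fun g => f (g * a)) = ρ f) (l : List ι) :
    ∀ (f : (ι → G) → ℝ), IsBdd f → ∀ a : ι → G, (∀ i, i ∉ l → a i = 1) →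
      FinMean.iterate ρ l (fun g => f (g * a)) = FinMean.iterate ρ l f := by
  induction l with
  | nil =>
    intro f _ a ha
    have : a = 1 := funext fun i => ha i (by simp)
    simp [this]
  | cons i l ih =>
    intro f hf a ha
    have h1 : ∀ (t : G) (g : ι → G), Function.update g i t * a =
        Function.update (g * Function.update a i 1) i (t * a i) := by
      intro t g
      funext j
      rcases eq_or_ne j i with rfl | h
      · simp
      · simp [h]
    have h2 : ∀ t, (FinMean.iterate ρ l fun g => f (Function.update g i t * a)) =
        FinMean.iterate ρ l fun g => f (Function.update g i (t * a i)) := by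
      intro t
      simp only [h1]
      refine ih (fun g => f (Function.update g i (t * a i))) (hf.comp _) _ fun j hj => ?_
      rcases eq_or_ne j i with rfl | h
      · simp
      · rw [Function.update_of_ne h]
        exact ha j (by simp [h, hj])
    obtain ⟨C, hC⟩ := hf
    rw [FinMean.iterate_cons, FinMean.iterate_cons, funext h2]
    exact hρ (fun t => FinMean.iterate ρ l fun g => f (Function.update g i t))
      ⟨C, fun t => FinMean.abs_le _ fun g => hC _⟩ _

namespace MeanSys

variable {S : MeanSys (ι → G)}

theorem box_eq_iterate (ρ : FinMean G) (l : List ι) : ∀ (f : S.Ω → ℝ), l.Nodup →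
    S.box ρ l f = FinMean.iterate ρ l fun g =>
      S.m fun x => ∏ e ∈ l.toFinset.powerset, f (cut e g • x) := by
  induction l with
  | nil =>
    intro f _
    simp [box, FinMean.iterate_nil, cut_empty]
  | cons i l ih =>
    intro f hl
    rw [List.nodup_cons] at hl
    have hil : i ∉ l.toFinset := by simpa using hl.1
    rw [box, FinMean.iterate_cons]
    congr 1
    funext t
    rw [ih _ hl.2]
    congr 1
    funext g
    congr 1
    funext x
    rw [List.toFinset_cons, Finset.prod_powerset_insert hil, ← Finset.prod_mul_distrib]
    refine Finset.prod_congr rfl fun e he => ?_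
    have hie : i ∉ e := fun h => hil (Finset.mem_powerset.1 he h)
    rw [cut_insert hie, cut_update hie, mul_smul]

/-- For the mean on `ι → G` obtained by iterating `ρ`, the averages of a function with nonzero mean
are positive. -/
theorem exists_mean_pow_le_cubeAvg [Fintype ι] {ρ : FinMean G}
    (hρ : ∀ f, IsBdd f → ∀ a, ρ (fun g => f (g * a)) = ρ f) :
    ∃ M : FinMean (ι → G), (∀ f, IsBdd f → ∀ a, M (fun g => f (a * g)) = M f) ∧
      ∃ k : ℕ, ∀ (S : MeanSys (ι → G)) (f : S.Ω → ℝ), (∀ x, |f x| ≤ 1) →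
        S.m f ^ k ≤ S.cubeAvg M fun _ => f := by
  set l : List ι := (Finset.univ : Finset ι).toList with hl
  have hnd : l.Nodup := Finset.nodup_toList _
  have hlu : l.toFinset = Finset.univ := Finset.toList_toFinset _
  have hM : ∀ f, IsBdd f → ∀ a : ι → G,
      (FinMean.iterate ρ l).map (·⁻¹) (fun g => f (a * g)) =
      (FinMean.iterate ρ l).map (·⁻¹) f := by
    intro f hf a
    have := FinMean.iterate_mul_right hρ l (fun g => f g⁻¹) (hf.comp _) a⁻¹ fun i hi => by
      simp [hl] at hi
    simpa [FinMean.map_apply] using this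
  refine ⟨(FinMean.iterate ρ l).map (·⁻¹), hM, 2 ^ l.length, fun S f hf => ?_⟩
  have h1 := cubeAvg_pow_le_box (S := S) _ hM ρ hρ l
    (fun e => if e = Finset.univ then f else fun _ => 1) hnd
    (fun e x => by
      split_ifs
      · exact hf x
      · simp)
    (fun e he x => by
      rw [hlu] at he
      exact absurd he.2 (by simp))
  rw [cubeAvg_eq_mean _ Finset.univ (by simpa using ⟨1, hf⟩) fun e he x => by simp [he]] at h1
  simp only [if_true, hlu] at h1
  refine h1.trans (le_of_eq ?_)
  rw [box_eq_iterate ρ l f hnd, cubeAvg, FinMean.map_apply, hlu]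
  congr 1
  funext g
  rw [← S.invariant (fun x => ∏ e, f (cut e g⁻¹ • x)) (IsBdd.prod fun e _ => ⟨1, fun _ => hf _⟩) g]
  congr 1
  funext x
  simp only [smul_smul, cut_inv_mul]
  rw [Finset.powerset_univ]
  exact (Fintype.prod_bijective _ compl_bijective _ _ fun e => rfl).symm

end MeanSys

end Positivity

/-- A set that is not left syndetic is negligible for some invariant mean. -/
theorem exists_mean_eq_zero_of_not_leftSyndetic {Γ : Type*} [Group Γ] {M' : FinMean Γ}
    (hM' : ∀ f, IsBdd f → ∀ a, M' (fun g => f (a * g)) = M' f) {J : Set Γ}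
    (hJ : ¬ LeftSyndetic J) :
    ∃ M : FinMean Γ, (∀ f, IsBdd f → ∀ a, M (fun g => f (a * g)) = M f) ∧
      ∀ f, IsBdd f → (∀ g, g ∉ J → f g = 0) → M f = 0 := by
  classical
  have hA : ∀ K : Finset Γ, ∃ x, ∀ γ ∈ K, γ * x ∉ J := by
    intro K
    by_contra! h
    refine hJ ⟨K.image (·⁻¹), fun x => ?_⟩
    obtain ⟨γ, hγ, hx⟩ := h x
    exact ⟨γ⁻¹, Finset.mem_image_of_mem _ hγ, by simpa using hx⟩
  choose u hu using hA
  obtain ⟨L, hL⟩ := FinMean.exists_of_ultrafilter (Ultrafilter.of (atTop : Filter (Finset Γ)))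
  refine ⟨M'.bind fun γ => L.map fun K => γ * u K, fun f hf a => ?_, fun f hf h0 => ?_⟩
  · obtain ⟨C, hC⟩ := hf
    have := hM' (fun γ => L fun K => f (γ * u K)) ⟨C, fun γ => L.abs_le fun _ => hC _⟩ a
    simpa only [FinMean.bind_apply, FinMean.map_apply, mul_assoc] using this
  · have h1 : ∀ γ, (L fun K => f (γ * u K)) = 0 := by
      intro γ
      refine hL _ 0 (hf.comp _) (tendsto_const_nhds.congr' ?_)
      filter_upwards [Ultrafilter.of_le _ (mem_atTop ({γ} : Finset Γ))] with K hK
      exact (h0 _ (hu K γ (hK (Finset.mem_singleton_self γ)))).symm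
    simp only [FinMean.bind_apply, FinMean.map_apply, h1, FinMean.map_const]

theorem LeftSyndetic.rightSyndetic_of_inv_mem_s19 {Γ : Type*} [Group Γ] {J : Set Γ}
    (hJ : LeftSyndetic J) (hinv : ∀ g ∈ J, g⁻¹ ∈ J) : RightSyndetic J := by
  classical
  obtain ⟨F, hF⟩ := hJ
  refine ⟨F.image (·⁻¹), fun x => ?_⟩
  obtain ⟨g, hg, h⟩ := hF x⁻¹
  exact ⟨g⁻¹, Finset.mem_image_of_mem _ hg, by simpa using hinv _ h⟩

theorem LeftSyndetic.of_mulEquiv {Γ Γ' : Type*} [Group Γ] [Group Γ'] {J : Set Γ} {J' : Set Γ'}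
    (hJ : LeftSyndetic J) (φ : Γ ≃* Γ') (h : ∀ g ∈ J, φ g ∈ J') : LeftSyndetic J' := by
  classical
  obtain ⟨F, hF⟩ := hJ
  refine ⟨F.image φ, fun x => ?_⟩
  obtain ⟨g, hg, hx⟩ := hF (φ.symm x)
  exact ⟨φ g, Finset.mem_image_of_mem _ hg, by simpa using h _ hx⟩

theorem RightSyndetic.of_mulEquiv {Γ Γ' : Type*} [Group Γ] [Group Γ'] {J : Set Γ} {J' : Set Γ'}
    (hJ : RightSyndetic J) (φ : Γ ≃* Γ') (h : ∀ g ∈ J, φ g ∈ J') : RightSyndetic J' := by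
  classical
  obtain ⟨F, hF⟩ := hJ
  refine ⟨F.image φ, fun x => ?_⟩
  obtain ⟨g, hg, hx⟩ := hF (φ.symm x)
  exact ⟨φ g, Finset.mem_image_of_mem _ hg, by simpa using h _ hx⟩

section Cube

variable {ι : Type} {G : Type v} [DecidableEq ι] [Fintype ι] [Group G]
  {X : Type*} [MulAction (ι → G) X] [PseudoMetricSpace X]

/-- The elements `g` for which the cube spanned by some point lies in a ball of radius `r`. -/
def smallCubes (ι : Type) (G : Type v) [DecidableEq ι] [Group G] (X : Type*)
    [MulAction (ι → G) X] [PseudoMetricSpace X] (r : ℝ) : Set (ι → G) :=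
  {g | ∃ x y : X, ∀ e : Finset ι, cut e g • x ∈ Metric.ball y r}

theorem inv_mem_smallCubes {r : ℝ} {g : ι → G} (hg : g ∈ smallCubes ι G X r) :
    g⁻¹ ∈ smallCubes ι G X r := by
  obtain ⟨x, y, h⟩ := hg
  exact ⟨g • x, y, fun e => by rw [smul_smul, cut_inv_mul]; exact h _⟩

theorem leftSyndetic_smallCubes [CompactSpace X] [Nonempty X] {ρ : FinMean G}
    (hρ : ∀ f, IsBdd f → ∀ a, ρ (fun g => f (g * a)) = ρ f) {r : ℝ} (hr : 0 < r) :
    LeftSyndetic (smallCubes ι G X r) := by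
  classical
  by_contra hJ
  obtain ⟨M', hM', k, hpos⟩ := MeanSys.exists_mean_pow_le_cubeAvg (ι := ι) hρ
  obtain ⟨M, hM, hM0⟩ := exists_mean_eq_zero_of_not_leftSyndetic hM' hJ
  let S : MeanSys (ι → G) := { Ω := ι → G, m := M', invariant := hM' }
  obtain ⟨t, -, ht, hcover⟩ := finite_cover_balls_of_compact (isCompact_univ (X := X)) hr
  let x₀ : X := Classical.arbitrary X
  let f : X → (ι → G) → ℝ := fun y γ => if γ • x₀ ∈ Metric.ball y r then 1 else 0
  have hf : ∀ y γ, |f y γ| ≤ 1 := by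
    intro y γ
    simp only [f]
    split_ifs <;> simp
  have hf0 : ∀ y γ, 0 ≤ f y γ := by
    intro y γ
    simp only [f]
    split_ifs <;> simp
  obtain ⟨y, hy⟩ : ∃ y, 0 < S.m (f y) := by
    by_contra! h
    have h1 : S.m (fun γ => ∑ y ∈ ht.toFinset, f y γ) = ∑ y ∈ ht.toFinset, S.m (f y) := by
      rw [← map_sum]
      congr 1
      funext γ
      simp
    have h2 : (1 : ℝ) ≤ S.m (fun γ => ∑ y ∈ ht.toFinset, f y γ) := by
      rw [← S.m.map_const 1]
      refine S.m.mono (.const 1) ⟨∑ y ∈ ht.toFinset, 1, fun γ =>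
        (Finset.abs_sum_le_sum_abs _ _).trans (Finset.sum_le_sum fun y _ => hf y γ)⟩ fun γ => ?_
      have h3 := hcover (Set.mem_univ ((γ : ι → G) • x₀))
      simp only [Set.mem_iUnion] at h3
      obtain ⟨y, hyt, hy⟩ := h3
      refine le_trans (le_of_eq (if_pos hy).symm)
        (Finset.single_le_sum (f := fun y => f y γ) (fun y _ => hf0 y γ) (ht.mem_toFinset.2 hyt))
    have h3 := Finset.sum_nonpos fun y (_ : y ∈ ht.toFinset) => h y
    linarith
  have h1 : 0 < S.cubeAvg M' fun _ => f y := (pow_pos hy k).trans_le (hpos S (f y) (hf y))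
  rw [← MeanSys.cubeAvg_eq_cubeAvg (S := S) hM hM' hρ (fun _ => f y) fun _ => ⟨1, hf y⟩] at h1
  refine h1.ne' (hM0 _ ⟨1, fun g => S.m.abs_le fun x => abs_prod_le_one fun e _ => hf y _⟩
    fun g hg => ?_)
  have h2 : ∀ x : ι → G, ∏ e, f y (cut e g • x) = 0 := by
    intro x
    by_contra hne
    rw [← ne_eq, Finset.prod_ne_zero_iff] at hne
    refine hg ⟨x • x₀, y, fun e => ?_⟩
    have h3 := hne e (Finset.mem_univ e)
    by_contra hcon
    refine h3 (if_neg fun h => hcon ?_)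
    rwa [smul_smul]
  exact (congrArg S.m (funext h2)).trans (S.m.map_const 0)

end Cube

/-- The group of functions `Fin 3 → G` as a product. -/
def finThreeMulEquiv (G : Type*) [Group G] : (Fin 3 → G) ≃* G × G × G where
  toFun g := (g 0, g 1, g 2)
  invFun p := ![p.1, p.2.1, p.2.2]
  left_inv g := by funext i; fin_cases i <;> rfl
  right_inv _ := rfl
  map_mul' _ _ := rfl

theorem finThreeMulEquiv_apply {G : Type*} [Group G] (g : Fin 3 → G) :
    finThreeMulEquiv G g = (g 0, g 1, g 2) := rfl

/-- Theorem 5.5, topological multiple recurrence. Let `R, S, T` be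
pairwise commuting actions of a countable group `G` (admitting a two-sided Følner
sequence) by homeomorphisms of a compact metric space `X`. Then for every `ε > 0` the set
of `(g,h,k) ∈ G³` for which some `x ∈ X` has
`diam{x, T_g x, S_h x, R_k x, T_g S_h x, T_g R_k x, S_h R_k x, T_g S_h R_k x} < ε` is both
left and right syndetic in `G × G × G`. -/
theorem topological_multiple_recurrence
    {G : Type*} [Group G] [Countable G] [DecidableEq G]
    (hFol : ∃ Φ : ℕ → Finset G, IsTwoSidedFolner Φ)
    {X : Type*} [MetricSpace X] [CompactSpace X] [Nonempty X]
    (R S T : G → X → X)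
    (hRc : ∀ g, Continuous (R g)) (hSc : ∀ g, Continuous (S g))
    (hTc : ∀ g, Continuous (T g))
    (hR1 : ∀ x, R 1 x = x) (hS1 : ∀ x, S 1 x = x) (hT1 : ∀ x, T 1 x = x)
    (hRact : ∀ g h x, R (g * h) x = R g (R h x))
    (hSact : ∀ g h x, S (g * h) x = S g (S h x))
    (hTact : ∀ g h x, T (g * h) x = T g (T h x))
    (hRS : ∀ g h x, R g (S h x) = S h (R g x))
    (hRT : ∀ g h x, R g (T h x) = T h (R g x))
    (hST : ∀ g h x, S g (T h x) = T h (S g x)) :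
    ∀ ε : ℝ, 0 < ε →
      LeftSyndetic {p : G × G × G | ∃ x : X,
          Metric.diam ({x, T p.1 x, S p.2.1 x, R p.2.2 x, T p.1 (S p.2.1 x),
            T p.1 (R p.2.2 x), S p.2.1 (R p.2.2 x),
            T p.1 (S p.2.1 (R p.2.2 x))} : Set X) < ε} ∧
      RightSyndetic {p : G × G × G | ∃ x : X,
          Metric.diam ({x, T p.1 x, S p.2.1 x, R p.2.2 x, T p.1 (S p.2.1 x),
            T p.1 (R p.2.2 x), S p.2.1 (R p.2.2 x),
            T p.1 (S p.2.1 (R p.2.2 x))} : Set X) < ε} := by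
  intro ε hε
  obtain ⟨Φ, hΦ, -⟩ := hFol
  obtain ⟨ρ, hρ⟩ := exists_rightInvariant_mean hΦ
  let act : MulAction (Fin 3 → G) X :=
    { smul := fun g x => T (g 0) (S (g 1) (R (g 2) x))
      one_smul := fun x => by
        change T 1 (S 1 (R 1 x)) = x
        rw [hR1, hS1, hT1]
      mul_smul := fun g h x => by
        change T (g 0 * h 0) (S (g 1 * h 1) (R (g 2 * h 2) x)) =
          T (g 0) (S (g 1) (R (g 2) (T (h 0) (S (h 1) (R (h 2) x)))))
        simp only [hRact, hSact, hTact, hRT, hRS, hST] }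
  have hact : ∀ (g : Fin 3 → G) (x : X), g • x = T (g 0) (S (g 1) (R (g 2) x)) := fun _ _ => rfl
  have hleft := leftSyndetic_smallCubes (ι := Fin 3) (X := X) hρ (r := ε / 3) (by positivity)
  have hmem : ∀ g ∈ smallCubes (Fin 3) G X (ε / 3), finThreeMulEquiv G g ∈
      {p : G × G × G | ∃ x : X,
        Metric.diam ({x, T p.1 x, S p.2.1 x, R p.2.2 x, T p.1 (S p.2.1 x),
          T p.1 (R p.2.2 x), S p.2.1 (R p.2.2 x),
          T p.1 (S p.2.1 (R p.2.2 x))} : Set X) < ε} := by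
    rintro g ⟨x, y, h⟩
    refine ⟨x, (Metric.diam_mono (t := Metric.ball y (ε / 3)) ?_ Metric.isBounded_ball).trans_lt
      ((Metric.diam_ball (by positivity)).trans_lt (by linarith))⟩
    have h0 := h ∅
    have h1 := h {0}
    have h2 := h {1}
    have h3 := h {2}
    have h4 := h {0, 1}
    have h5 := h {0, 2}
    have h6 := h {1, 2}
    have h7 := h {0, 1, 2}
    simp [hact, cut, hR1, hS1, hT1, -Metric.mem_ball] at h0 h1 h2 h3 h4 h5 h6 h7
    simp [Set.insert_subset_iff, finThreeMulEquiv_apply, -Metric.mem_ball, *]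
  exact ⟨hleft.of_mulEquiv _ hmem,
    (hleft.rightSyndetic_of_inv_mem_s19 fun _ => inv_mem_smallCubes).of_mulEquiv _ hmem⟩
end
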